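/- arXiv:math/0411117 — 4 statements merged into one kernel-verified Lean document; each statement's English description precedes it below -/
import Mathlib

section
/- If (Q, ≤_Q) is a bqo, then the class C of all Q-cclos is a wqo under smc-embeddability ⪯: every infinite sequence ⟨K_n : n < ω⟩ of Q-cclos contains indices n < m with K_n ⪯ K_m. -/
open Set Filter Topology

/-- A `Q`-labeled countable closed linear ordering (`Q`-cclo): a function whose
domain is a countable closed subset of `ℝ` and whose values lie in `Q`. -/
structure QCclo (Q : Type) where
  dom : Set ℝ
  dom_countable : dom.Countable
  dom_closed : IsClosed dom
  val : ℝ → Q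

/-- `h` is a strictly monotone continuous (smc-) embedding of `V₁` into `V₂`. -/
def IsSmcEmbedding (V₁ V₂ : Set ℝ) (h : ℝ → ℝ) : Prop :=
  (∀ x ∈ V₁, h x ∈ V₂) ∧
  (∀ x ∈ V₁, ∀ y ∈ V₁, x < y → h x < h y) ∧
  ContinuousOn h V₁

/-- `A ⪯ B`: there is an smc-embedding of `dom A` into `dom B` increasing labels. -/
def QCclo.Emb {Q : Type} [Preorder Q] (A B : QCclo Q) : Prop :=
  ∃ h : ℝ → ℝ, IsSmcEmbedding A.dom B.dom h ∧ ∀ a ∈ A.dom, A.val a ≤ B.val (h a)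

/-- Bi-embeddability of `Q`-cclos. -/
def QCclo.Equiv {Q : Type} [Preorder Q] (A B : QCclo Q) : Prop :=
  QCclo.Emb A B ∧ QCclo.Emb B A

/-- `A < B` for domains: one of them is empty, or they are separated
by an open interval (here witnessed by a point strictly between them). -/
def DomLt (A B : Set ℝ) : Prop :=
  A = ∅ ∨ B = ∅ ∨ ∃ c : ℝ, (∀ a ∈ A, a < c) ∧ ∀ b ∈ B, c < b

/-- `L` is the sum `L₀ + L₁ + ⋯ + p + ⋯ + ¹L + ⁰L` (with `Ls n = L_n`,
`Rs n = ⁿL`, central point `x` labeled `p`). -/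
def IsOmegaSum {Q : Type} (L : QCclo Q) (Ls Rs : ℕ → QCclo Q) (p : Q) (x : ℝ) : Prop :=
  ((∀ n, (Ls n).dom = ∅) ∨ ∀ n, (Ls n).dom.Nonempty) ∧
  ((∀ n, (Rs n).dom = ∅) ∨ ∀ n, (Rs n).dom.Nonempty) ∧
  (¬ ((∀ n, (Ls n).dom = ∅) ∧ ∀ n, (Rs n).dom = ∅)) ∧
  (∀ n, DomLt (Ls n).dom (Ls (n+1)).dom) ∧
  (∀ n, DomLt (Ls (n+1)).dom (Rs (n+1)).dom) ∧
  (∀ n, DomLt (Rs (n+1)).dom (Rs n).dom) ∧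
  (∀ a : ℕ → ℝ, (∀ n, a n ∈ (Ls n).dom) → Tendsto a atTop (𝓝 x)) ∧
  (∀ a : ℕ → ℝ, (∀ n, a n ∈ (Rs n).dom) → Tendsto a atTop (𝓝 x)) ∧
  L.dom = (⋃ n, (Ls n).dom) ∪ {x} ∪ ⋃ n, (Rs n).dom ∧
  (∀ n, ∀ y ∈ (Ls n).dom, L.val y = (Ls n).val y) ∧
  (∀ n, ∀ y ∈ (Rs n).dom, L.val y = (Rs n).val y) ∧
  L.val x = p

/-- `L` is the finite sum `L₁ + ⋯ + L_n` of the nonempty `Q`-cclos `Ls 0, …, Ls (n-1)`. -/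
def IsFinSum {Q : Type} (L : QCclo Q) (n : ℕ) (Ls : Fin n → QCclo Q) : Prop :=
  0 < n ∧ (∀ i, (Ls i).dom.Nonempty) ∧
  (∀ i j : Fin n, i < j → ∀ a ∈ (Ls i).dom, ∀ b ∈ (Ls j).dom, a < b) ∧
  L.dom = ⋃ i, (Ls i).dom ∧
  ∀ i, ∀ y ∈ (Ls i).dom, L.val y = (Ls i).val y

/-- `S(𝒪)`: finite sums and ω-sums of members of `𝒪`. -/
def SSum {Q : Type} (O : Set (QCclo Q)) : Set (QCclo Q) :=
  {L | (∃ n Ls, IsFinSum L n Ls ∧ ∀ i, Ls i ∈ O) ∨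
       ∃ Ls Rs p x, IsOmegaSum L Ls Rs p x ∧ (∀ n, Ls n ∈ O) ∧ ∀ n, Rs n ∈ O}

/-- `S'(𝒪)`: unbounded ω-sums of members of `𝒪`. -/
def S'Sum {Q : Type} [Preorder Q] (O : Set (QCclo Q)) : Set (QCclo Q) :=
  {L | ∃ Ls Rs p x, IsOmegaSum L Ls Rs p x ∧ (∀ n, Ls n ∈ O) ∧ (∀ n, Rs n ∈ O) ∧
       (∀ n, ∃ k > n, QCclo.Emb (Ls n) (Ls k)) ∧
       ∀ n, ∃ k > n, QCclo.Emb (Rs n) (Rs k)}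

/-- The hierarchy `C_α`: `C₀` = empty/singleton domains, `C_{α+1} = S(C_α) ∪ C_α`,
unions at limits. -/
noncomputable def CFam (Q : Type) [Preorder Q] : Ordinal → Set (QCclo Q) := fun α =>
  Ordinal.limitRecOn α
    {L : QCclo Q | L.dom = ∅ ∨ ∃ x : ℝ, L.dom = {x}}
    (fun _ C => SSum C ∪ C)
    (fun _ _ ih => ⋃ (β : Ordinal) (h : β < _), ih β h)

/-- The hierarchy `C'_α`: `C'₀` = empty/singleton domains, `C'_{α+1} = S'(C'_α) ∪ C'_α`,
unions at limits. -/
noncomputable def CFam' (Q : Type) [Preorder Q] : Ordinal → Set (QCclo Q) := fun α =>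
  Ordinal.limitRecOn α
    {L : QCclo Q | L.dom = ∅ ∨ ∃ x : ℝ, L.dom = {x}}
    (fun _ C => S'Sum C ∪ C)
    (fun _ _ ih => ⋃ (β : Ordinal) (h : β < _), ih β h)

/-- A sequence is good for `r` iff `r (f n) (f k)` for some `n < k`;
`r` is a wqo on `S` iff every sequence in `S` is good. -/
def IsWqoOn {P : Type*} (r : P → P → Prop) (S : Set P) : Prop :=
  ∀ f : ℕ → P, (∀ n, f n ∈ S) → ∃ n k, n < k ∧ r (f n) (f k)

/-- `d` extends the finite set `c`: `c = {i ∈ d : i ≤ max c}`. -/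
def SExtends (d : Set ℕ) (c : Finset ℕ) : Prop :=
  (c : Set ℕ) = {i ∈ d | ∃ m ∈ c, i ≤ m}

/-- `B` is a block: an infinite set of finite subsets of `ℕ` such that every infinite
subset of `⋃ B` has an initial segment in `B`. -/
def IsBlock (B : Set (Finset ℕ)) : Prop :=
  B.Infinite ∧
  ∀ X : Set ℕ, X.Infinite → X ⊆ (⋃ b ∈ B, (b : Set ℕ)) → ∃ b ∈ B, SExtends X b

/-- A barrier: a block with no two elements comparable under inclusion. -/
def IsBarrier (B : Set (Finset ℕ)) : Prop :=
  IsBlock B ∧ ∀ b₁ ∈ B, ∀ b₂ ∈ B, b₁ ≠ b₂ → ¬ b₁ ⊆ b₂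

/-- Precedence `b₁ ◁ b₂`: there are `i₁ < i₂ < ⋯ < i_m` with `b₁ = {i₁,…,i_k}`,
`b₂ = {i₂,…,i_m}`, `1 ≤ k < m`. -/
def BarrierPrec (b₁ b₂ : Finset ℕ) : Prop :=
  ∃ (m k : ℕ) (i : ℕ → ℕ), 1 ≤ k ∧ k < m ∧
    StrictMonoOn i (Set.Icc 1 m) ∧
    b₁ = (Finset.Icc 1 k).image i ∧ b₂ = (Finset.Icc 2 m).image i

/-- `f : B → P` is bad: `¬ r (f b₁) (f b₂)` whenever `b₁ ◁ b₂` in `B`. -/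
def IsBadOn {P : Type*} (r : P → P → Prop) (B : Set (Finset ℕ)) (f : Finset ℕ → P) : Prop :=
  ∀ b₁ ∈ B, ∀ b₂ ∈ B, BarrierPrec b₁ b₂ → ¬ r (f b₁) (f b₂)

/-- `r` is a bqo on `S`: every function from a barrier into `S` is good. -/
def IsBqoOn {P : Type*} (r : P → P → Prop) (S : Set P) : Prop :=
  ∀ B : Set (Finset ℕ), IsBarrier B → ∀ f : Finset ℕ → P,
    (∀ b ∈ B, f b ∈ S) → ¬ IsBadOn r B f

/-- `r` is a bqo: every function from a barrier into `P` is good. -/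
def IsBqo {P : Type*} (r : P → P → Prop) : Prop :=
  ∀ B : Set (Finset ℕ), IsBarrier B → ∀ f : Finset ℕ → P, ¬ IsBadOn r B f

namespace CcloBqo

/-! ### Infinite subsets of `ℕ` and the Nash-Williams partition theorem -/

/-- The set `X` without its least element. -/
def tl (X : Set ℕ) : Set ℕ := {x ∈ X | sInf X < x}

/-- `X` and `Y` have the same elements up to `m`. -/
def Agree (m : ℕ) (X Y : Set ℕ) : Prop := ∀ i ≤ m, (i ∈ X ↔ i ∈ Y)

/-- `f` is locally determined on the infinite subsets of `A`. -/
def LocDet {α : Type*} (A : Set ℕ) (f : Set ℕ → α) : Prop :=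
  ∀ X ⊆ A, X.Infinite → ∃ m, ∀ Y ⊆ A, Y.Infinite → Agree m X Y → f Y = f X

/-- `f` is a bad array on the infinite subsets of `A`. -/
def BadArray {P : Type*} (r : P → P → Prop) (A : Set ℕ) (f : Set ℕ → P) : Prop :=
  ∀ X ⊆ A, X.Infinite → ¬ r (f X) (f (tl X))

/-- Better-quasi-orders in terms of locally determined arrays. -/
def ArrayBqo {P : Type*} (r : P → P → Prop) : Prop :=
  ∀ A : Set ℕ, A.Infinite → ∀ f : Set ℕ → P, LocDet A f → ¬ BadArray r A f

theorem tl_subset (X : Set ℕ) : tl X ⊆ X := fun _ h => h.1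

theorem tl_infinite {X : Set ℕ} (hX : X.Infinite) : (tl X).Infinite := by
  have h : X ⊆ insert (sInf X) (tl X) := by
    intro x hx
    rcases (Nat.sInf_le hx).eq_or_lt with h | h
    · exact Or.inl h.symm
    · exact Or.inr ⟨hx, h⟩
  intro hf
  exact hX ((hf.insert _).subset h)

theorem Agree.symm {m : ℕ} {X Y : Set ℕ} (h : Agree m X Y) : Agree m Y X :=
  fun i hi => (h i hi).symm

theorem Agree.mono {m n : ℕ} {X Y : Set ℕ} (h : Agree n X Y) (hmn : m ≤ n) : Agree m X Y :=
  fun i hi => h i (hi.trans hmn)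

theorem Agree.sInf_eq {m : ℕ} {X Y : Set ℕ} (h : Agree m X Y) (hm : m ∈ X) :
    sInf X = sInf Y := by
  have hY : m ∈ Y := (h m le_rfl).1 hm
  apply le_antisymm
  · exact Nat.sInf_le ((h _ (Nat.sInf_le hY)).2 (Nat.sInf_mem ⟨m, hY⟩))
  · exact Nat.sInf_le ((h _ (Nat.sInf_le hm)).1 (Nat.sInf_mem ⟨m, hm⟩))

theorem Agree.tl {m : ℕ} {X Y : Set ℕ} (h : Agree m X Y) (hm : m ∈ X) :
    Agree m (tl X) (tl Y) := by
  intro i hi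
  simp only [CcloBqo.tl, mem_ofPred_eq, h i hi, h.sInf_eq hm]

theorem LocDet.mono {α : Type*} {A B : Set ℕ} {f : Set ℕ → α} (h : LocDet A f) (hB : B ⊆ A) :
    LocDet B f := by
  intro X hX hXi
  obtain ⟨m, hm⟩ := h X (hX.trans hB) hXi
  exact ⟨m, fun Y hY => hm Y (hY.trans hB)⟩

theorem LocDet.comp {α β : Type*} {A : Set ℕ} {f : Set ℕ → α} (h : LocDet A f) (g : α → β) :
    LocDet A (fun X => g (f X)) := by
  intro X hX hXi
  obtain ⟨m, hm⟩ := h X hX hXi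
  exact ⟨m, fun Y hY hYi hXY => congrArg g (hm Y hY hYi hXY)⟩

theorem LocDet.comp_tl {α β : Type*} {A : Set ℕ} {f : Set ℕ → α} (h : LocDet A f)
    (g : α → α → β) : LocDet A (fun X => g (f X) (f (CcloBqo.tl X))) := by
  intro X hX hXi
  obtain ⟨m, hm⟩ := h X hX hXi
  obtain ⟨n, hn⟩ := h _ ((tl_subset X).trans hX) (tl_infinite hXi)
  obtain ⟨k, hk, hkm⟩ := hXi.exists_gt (max m n)
  refine ⟨k, fun Y hY hYi hXY => ?_⟩
  have h1 := hm Y hY hYi (hXY.mono (by omega))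
  have h2 := hn _ ((tl_subset Y).trans hY) (tl_infinite hYi) ((hXY.tl hk).mono (by omega))
  simp only [h1, h2]

/-- The finite set `s` is an initial segment of `X`. -/
def Ext (s : Finset ℕ) (X : Set ℕ) : Prop :=
  (∀ x ∈ s, x ∈ X) ∧ ∀ y ∈ X, y ∉ s → ∀ x ∈ s, x < y

theorem Ext.of_insert {s : Finset ℕ} {x : ℕ} {X : Set ℕ} (h : Ext (insert x s) X)
    (hx : ∀ y ∈ s, y < x) : Ext s X := by
  refine ⟨fun y hy => h.1 y (Finset.mem_insert_of_mem hy), fun y hy hys z hz => ?_⟩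
  by_cases hyx : y = x
  · exact hyx ▸ hx z hz
  · exact h.2 y hy (by simp [hyx, hys]) z (Finset.mem_insert_of_mem hz)

theorem Ext.agree {s : Finset ℕ} {X Y : Set ℕ} {m : ℕ} (hX : Ext s X) (hY : Ext s Y)
    (hm : ∃ x ∈ s, m ≤ x) : Agree m X Y := by
  obtain ⟨x, hx, hmx⟩ := hm
  intro i hi
  by_cases his : i ∈ s
  · exact iff_of_true (hX.1 i his) (hY.1 i his)
  · refine iff_of_false (fun h => ?_) (fun h => ?_)
    · have := hX.2 i h his x hx; omega
    · have := hY.2 i h his x hx; omega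

theorem exists_ext {s : Finset ℕ} {A : Set ℕ} (hA : A.Infinite) (hs : ∀ x ∈ s, x ∈ A) :
    ∃ X ⊆ A, X.Infinite ∧ Ext s X := by
  refine ⟨↑s ∪ {y ∈ A | ∀ x ∈ s, x < y}, ?_, ?_, ?_, ?_⟩
  · rintro y (hy | hy)
    · exact hs y hy
    · exact hy.1
  · refine Set.Infinite.mono subset_union_right (Set.infinite_of_forall_exists_gt fun a => ?_)
    obtain ⟨b, hb, hab⟩ := hA.exists_gt (max a (s.sup id))
    refine ⟨b, ⟨hb, fun x hx => ?_⟩, by omega⟩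
    have : x ≤ s.sup id := Finset.le_sup (f := id) hx
    omega
  · intro x hx
    exact Or.inl hx
  · rintro y (hy | hy) hys
    · exact absurd hy hys
    · exact hy.2

/-- A family of finite sets closed under some end-extension generates an infinite set. -/
theorem exists_fusion (N : Finset ℕ → Prop) {s₀ : Finset ℕ} (h₀ : N s₀)
    (hstep : ∀ s, N s → ∃ x, (∀ y ∈ s, y < x) ∧ N (insert x s)) :
    ∃ X : Set ℕ, X.Infinite ∧ ∀ m, ∃ s, N s ∧ Ext s X ∧ ∃ x ∈ s, m < x := by
  choose! nx hnx using hstep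
  let s : ℕ → Finset ℕ := fun n => Nat.rec s₀ (fun _ s => insert (nx s) s) n
  have hs : ∀ n, s (n + 1) = insert (nx (s n)) (s n) := fun n => rfl
  have hN : ∀ n, N (s n) := by
    intro n
    induction n with
    | zero => exact h₀
    | succ n ih => rw [hs]; exact (hnx _ ih).2
  have hmono : ∀ n m, n ≤ m → s n ⊆ s m := by
    intro n m h
    induction h with
    | refl => exact subset_rfl
    | step _ ih => exact ih.trans (by rw [hs]; exact Finset.subset_insert _ _)
  have hnew : ∀ n m, n ≤ m → ∀ y ∈ s m, y ∉ s n → ∀ x ∈ s n, x < y := by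
    intro n m h
    induction h with
    | refl => intro y hy hy'; exact absurd hy hy'
    | @step m hnm ih =>
      intro y hy hy' x hx
      rw [Nat.succ_eq_add_one, hs, Finset.mem_insert] at hy
      rcases hy with rfl | hy
      · exact (hnx _ (hN m)).1 x (hmono n m hnm hx)
      · exact ih y hy hy' x hx
  have hext : ∀ n, Ext (s n) ({y | ∃ k, y ∈ s k}) := by
    intro n
    refine ⟨fun x hx => ⟨n, hx⟩, fun y hy hyn x hx => ?_⟩
    obtain ⟨k, hk⟩ := hy
    rcases le_total n k with h | h
    · exact hnew n k h y hk hyn x hx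
    · exact absurd (hmono k n h hk) hyn
  have hbig : ∀ m, ∃ x ∈ s (m + 1), m ≤ x := by
    intro m
    induction m with
    | zero => exact ⟨nx (s 0), by rw [hs]; exact Finset.mem_insert_self _ _, Nat.zero_le _⟩
    | succ m ih =>
      obtain ⟨x, hx, hmx⟩ := ih
      refine ⟨nx (s (m + 1)), by rw [hs]; exact Finset.mem_insert_self _ _, ?_⟩
      have := (hnx _ (hN (m + 1))).1 x hx
      omega
  refine ⟨{y | ∃ k, y ∈ s k}, Set.infinite_of_forall_exists_gt fun a => ?_, fun m => ?_⟩
  · obtain ⟨x, hx, hax⟩ := hbig (a + 1)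
    exact ⟨x, ⟨a + 1 + 1, hx⟩, by omega⟩
  · obtain ⟨x, hx, hax⟩ := hbig (m + 1)
    exact ⟨s (m + 1 + 1), hN (m + 1 + 1), hext (m + 1 + 1), x, hx, by omega⟩

/-- `U`-almost all end-extensions of the finite set lie in `W`. -/
inductive AlmostAll (U : Ultrafilter ℕ) (A : Set ℕ) (W : Set ℕ → Prop) : Finset ℕ → Prop
  | decided (s : Finset ℕ) (h : ∀ X ⊆ A, X.Infinite → Ext s X → W X) : AlmostAll U A W s
  | step (s : Finset ℕ) (S : Set ℕ) (hS : S ∈ U)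
      (h : ∀ x ∈ S, AlmostAll U A W (insert x s)) : AlmostAll U A W s

section Ramsey

variable {U : Ultrafilter ℕ} {A : Set ℕ} {W : Set ℕ → Prop}

theorem eventually_gt_finset (hU : (U : Filter ℕ) ≤ cofinite) (s : Finset ℕ) :
    ∀ᶠ x in (U : Filter ℕ), ∀ y ∈ s, y < x := by
  have h : ∀ᶠ x in (cofinite : Filter ℕ), ∀ y ∈ s, y < x := by
    rw [Nat.cofinite_eq_atTop]
    filter_upwards [eventually_gt_atTop (s.sup id)] with x hx y hy
    exact lt_of_le_of_lt (Finset.le_sup (f := id) hy) hx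
  exact hU h

theorem AlmostAll.eventually (hU : (U : Filter ℕ) ≤ cofinite) {s : Finset ℕ}
    (h : AlmostAll U A W s) : ∀ᶠ x in (U : Filter ℕ), AlmostAll U A W (insert x s) := by
  cases h with
  | decided _ h =>
    filter_upwards [eventually_gt_finset hU s] with x hx
    exact .decided _ fun X hX hXi hXs => h X hX hXi (hXs.of_insert hx)
  | step _ S hS h => exact mem_of_superset hS h

theorem AlmostAll.exists_mem (hU : (U : Filter ℕ) ≤ cofinite) (hA : A.Infinite) (hAU : A ∈ U)
    {s : Finset ℕ} (h : AlmostAll U A W s) (hs : ∀ x ∈ s, x ∈ A) :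
    ∃ X ⊆ A, X.Infinite ∧ Ext s X ∧ W X := by
  induction h with
  | decided s h =>
    obtain ⟨X, h1, h2, h3⟩ := exists_ext hA hs
    exact ⟨X, h1, h2, h3, h X h1 h2 h3⟩
  | step s S hS h ih =>
    have hS' : ∀ᶠ x in (U : Filter ℕ), x ∈ S := hS
    have hA' : ∀ᶠ x in (U : Filter ℕ), x ∈ A := hAU
    obtain ⟨x, hxS, hxA, hx⟩ := (hS'.and (hA'.and (eventually_gt_finset hU s))).exists
    obtain ⟨X, h1, h2, h3, h4⟩ := ih x hxS (by
      intro y hy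
      rcases Finset.mem_insert.1 hy with rfl | hy
      exacts [hxA, hs y hy])
    exact ⟨X, h1, h2, h3.of_insert hx, h4⟩

theorem almostAll_or (hU : (U : Filter ℕ) ≤ cofinite) (hAU : A ∈ U) (hW : LocDet A W) :
    AlmostAll U A W ∅ ∨ AlmostAll U A (fun X => ¬ W X) ∅ := by
  by_contra hcon
  rw [not_or] at hcon
  obtain ⟨X, hXi, hX⟩ := exists_fusion
    (fun s => (∀ x ∈ s, x ∈ A) ∧ ¬ AlmostAll U A W s ∧ ¬ AlmostAll U A (fun X => ¬ W X) s)
    (s₀ := ∅) ⟨by simp, hcon⟩ (by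
      rintro s ⟨hsA, h1, h2⟩
      have h1' : ∀ᶠ x in (U : Filter ℕ), ¬ AlmostAll U A W (insert x s) := by
        rw [Ultrafilter.eventually_not]
        exact fun h => h1 (.step s _ h fun x hx => hx)
      have h2' : ∀ᶠ x in (U : Filter ℕ), ¬ AlmostAll U A (fun X => ¬ W X) (insert x s) := by
        rw [Ultrafilter.eventually_not]
        exact fun h => h2 (.step s _ h fun x hx => hx)
      have hA' : ∀ᶠ x in (U : Filter ℕ), x ∈ A := hAU
      obtain ⟨x, hx1, hx2, hxA, hx⟩ :=
        (h1'.and (h2'.and (hA'.and (eventually_gt_finset hU s)))).exists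
      refine ⟨x, hx, ?_, hx1, hx2⟩
      intro y hy
      rcases Finset.mem_insert.1 hy with rfl | hy
      exacts [hxA, hsA y hy])
  have hXA : X ⊆ A := by
    intro x hx
    obtain ⟨s, hs, hsX, y, hy, hxy⟩ := hX x
    refine hs.1 x (by_contra fun hxs => ?_)
    have := hsX.2 x hx hxs y hy
    omega
  obtain ⟨m, hm⟩ := hW X hXA hXi
  obtain ⟨s, ⟨_, h1, h2⟩, hsX, y, hy, hmy⟩ := hX m
  have key : ∀ Y ⊆ A, Y.Infinite → Ext s Y → W Y = W X := fun Y hY hYi hYs =>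
    hm Y hY hYi (hsX.agree hYs ⟨y, hy, hmy.le⟩)
  by_cases hWX : W X
  · exact h1 (.decided s fun Y hY hYi hYs => by rw [key Y hY hYi hYs]; exact hWX)
  · exact h2 (.decided s fun Y hY hYi hYs => by rw [key Y hY hYi hYs]; exact hWX)

theorem AlmostAll.exists_homogeneous (hU : (U : Filter ℕ) ≤ cofinite) (hA : A.Infinite)
    (hAU : A ∈ U) (hW : LocDet A W) (h : AlmostAll U A W ∅) :
    ∃ B ⊆ A, B.Infinite ∧ ∀ X ⊆ B, X.Infinite → W X := by
  obtain ⟨B, hBi, hB⟩ := exists_fusion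
    (fun s => (∀ x ∈ s, x ∈ A) ∧ ∀ t ⊆ s, AlmostAll U A W t)
    (s₀ := ∅) ⟨by simp, fun t ht => by rwa [Finset.subset_empty.1 ht]⟩ (by
      rintro s ⟨hsA, hs⟩
      have h1 : ∀ᶠ x in (U : Filter ℕ), ∀ t ∈ s.powerset, AlmostAll U A W (insert x t) := by
        rw [Finset.eventually_all]
        exact fun t ht => (hs t (Finset.mem_powerset.1 ht)).eventually hU
      have hA' : ∀ᶠ x in (U : Filter ℕ), x ∈ A := hAU
      obtain ⟨x, hx1, hxA, hx⟩ := (h1.and (hA'.and (eventually_gt_finset hU s))).exists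
      refine ⟨x, hx, ?_, fun t ht => ?_⟩
      · intro y hy
        rcases Finset.mem_insert.1 hy with rfl | hy
        exacts [hxA, hsA y hy]
      · by_cases hxt : x ∈ t
        · have := hx1 (t.erase x) (by
            rw [Finset.mem_powerset]
            intro y hy
            rw [Finset.mem_erase] at hy
            exact (Finset.mem_insert.1 (ht hy.2)).resolve_left hy.1)
          rwa [Finset.insert_erase hxt] at this
        · exact hs t fun y hy => (Finset.mem_insert.1 (ht hy)).resolve_left
            fun h => hxt (h ▸ hy))
  have hBA : B ⊆ A := by
    intro x hx
    obtain ⟨s, hs, hsX, y, hy, hxy⟩ := hB x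
    refine hs.1 x (by_contra fun hxs => ?_)
    have := hsX.2 x hx hxs y hy
    omega
  refine ⟨B, hBA, hBi, fun X hX hXi => by_contra fun hWX => ?_⟩
  obtain ⟨m, hm⟩ := hW X (hX.trans hBA) hXi
  obtain ⟨k, hkX, hmk⟩ := hXi.exists_gt m
  classical
  obtain ⟨s, ⟨hsA, hs⟩, hsB, y, hy, hky⟩ := hB k
  let t := s.filter (fun i => i ∈ X ∧ i ≤ k)
  have hmem : ∀ i ≤ k, i ∈ X → i ∈ t := by
    intro i hi hiX
    refine Finset.mem_filter.2 ⟨by_contra fun his => ?_, hiX, hi⟩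
    have := hsB.2 i (hX hiX) his y hy
    omega
  have htX : Ext t X := by
    refine ⟨fun i hi => (Finset.mem_filter.1 hi).2.1, fun i hiX hit j hj => ?_⟩
    have h1 := (Finset.mem_filter.1 hj).2.2
    by_contra h2
    exact hit (hmem i (by omega) hiX)
  obtain ⟨Z, hZA, hZi, hZt, hWZ⟩ := (hs t (Finset.filter_subset _ _)).exists_mem hU hA hAU
    fun x hx => hsA x (Finset.filter_subset _ _ hx)
  have := hm Z hZA hZi (htX.agree hZt ⟨k, hmem k le_rfl hkX, hmk.le⟩)
  rw [this] at hWZ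
  exact hWX hWZ

end Ramsey

/-- The Nash-Williams partition theorem for locally determined properties. -/
theorem exists_homogeneous {A : Set ℕ} (hA : A.Infinite) {W : Set ℕ → Prop} (hW : LocDet A W) :
    ∃ B ⊆ A, B.Infinite ∧
      ((∀ X ⊆ B, X.Infinite → W X) ∨ ∀ X ⊆ B, X.Infinite → ¬ W X) := by
  have : NeBot (cofinite ⊓ 𝓟 A) := cofinite_inf_principal_neBot_iff.2 hA
  let U : Ultrafilter ℕ := Ultrafilter.of (cofinite ⊓ 𝓟 A)
  have hU : (U : Filter ℕ) ≤ cofinite ⊓ 𝓟 A := Ultrafilter.of_le _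
  have hAU : A ∈ U := hU (mem_inf_of_right (mem_principal_self A))
  have hUc : (U : Filter ℕ) ≤ cofinite := hU.trans inf_le_left
  rcases almostAll_or hUc hAU hW with h | h
  · obtain ⟨B, h1, h2, h3⟩ := h.exists_homogeneous hUc hA hAU hW
    exact ⟨B, h1, h2, Or.inl h3⟩
  · obtain ⟨B, h1, h2, h3⟩ := h.exists_homogeneous hUc hA hAU (hW.comp Not)
    exact ⟨B, h1, h2, Or.inr h3⟩

/-! ### Minimal bad arrays -/

/-- An array on the infinite subsets of `A`, whose value at `X` is determined by the
elements of `X` up to `τ X`. -/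
structure Arr (P : Type*) where
  /-- the base of the array -/
  A : Set ℕ
  /-- the length of the determining initial segment -/
  τ : Set ℕ → ℕ
  /-- the values of the array -/
  f : Set ℕ → P

section MinBad

variable {P : Type*} {r lt : P → P → Prop}

/-- `a` is a bad array with a correct modulus. -/
def Arr.IsBad (r : P → P → Prop) (a : Arr P) : Prop :=
  a.A.Infinite ∧
  (∀ X ⊆ a.A, X.Infinite → a.τ X ∈ X ∧
    ∀ Y ⊆ a.A, Y.Infinite → Agree (a.τ X) X Y → a.τ Y = a.τ X ∧ a.f Y = a.f X) ∧
  BadArray r a.A a.f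

/-- `a` arises from `b` by shrinking the base and decreasing values at longer segments. -/
def Arr.Le (lt : P → P → Prop) (a b : Arr P) : Prop :=
  a.A ⊆ b.A ∧ ∀ X ⊆ a.A, X.Infinite →
    (a.τ X = b.τ X ∧ a.f X = b.f X) ∨ (b.τ X < a.τ X ∧ lt (a.f X) (b.f X))

theorem Arr.Le.refl (a : Arr P) : Arr.Le lt a a :=
  ⟨subset_rfl, fun _ _ _ => Or.inl ⟨rfl, rfl⟩⟩

theorem Arr.Le.trans (hlt : ∀ ⦃x y z⦄, lt x y → lt y z → lt x z) {a b c : Arr P}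
    (hab : Arr.Le lt a b)
    (hbc : Arr.Le lt b c) : Arr.Le lt a c := by
  refine ⟨hab.1.trans hbc.1, fun X hX hXi => ?_⟩
  rcases hab.2 X hX hXi with ⟨h1, h2⟩ | ⟨h1, h2⟩ <;>
    rcases hbc.2 X (hX.trans hab.1) hXi with ⟨h3, h4⟩ | ⟨h3, h4⟩
  · exact Or.inl ⟨h1.trans h3, h2.trans h4⟩
  · exact Or.inr ⟨h1 ▸ h3, h2 ▸ h4⟩
  · exact Or.inr ⟨h3 ▸ h1, h4 ▸ h2⟩
  · exact Or.inr ⟨h3.trans h1, hlt h2 h4⟩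

theorem Arr.Le.tau_le {a b : Arr P} (hab : Arr.Le lt a b) {X : Set ℕ} (hX : X ⊆ a.A)
    (hXi : X.Infinite) : b.τ X ≤ a.τ X := by
  rcases hab.2 X hX hXi with ⟨h1, _⟩ | ⟨h1, _⟩
  exacts [h1.ge, h1.le]

theorem Arr.Le.rel (hr : ∀ x y z, r z x → lt x y → r z y) {a b : Arr P} (hab : Arr.Le lt a b)
    {X : Set ℕ} (hX : X ⊆ a.A) (hXi : X.Infinite) {z : P} (h : r z (a.f X)) : r z (b.f X) := by
  rcases hab.2 X hX hXi with ⟨_, h2⟩ | ⟨_, h2⟩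
  · rwa [← h2]
  · exact hr _ _ _ h h2

/-- Every locally determined bad array has a modulus. -/
theorem exists_arr {A : Set ℕ} (hA : A.Infinite) {f : Set ℕ → P} (hf : LocDet A f)
    (hbad : BadArray r A f) : ∃ a : Arr P, a.IsBad r ∧ a.A = A ∧ a.f = f := by
  let D : Set ℕ → Set ℕ := fun X => {m ∈ X | ∀ Y ⊆ A, Y.Infinite → Agree m X Y → f Y = f X}
  have hD : ∀ X ⊆ A, X.Infinite → (D X).Nonempty := by
    intro X hX hXi
    obtain ⟨m, hm⟩ := hf X hX hXi
    obtain ⟨k, hk, hmk⟩ := hXi.exists_gt m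
    exact ⟨k, hk, fun Y hY hYi hXY => hm Y hY hYi (hXY.mono hmk.le)⟩
  refine ⟨⟨A, fun X => sInf (D X), f⟩, ⟨hA, fun X hX hXi => ?_, hbad⟩, rfl, rfl⟩
  have hmem := Nat.sInf_mem (hD X hX hXi)
  refine ⟨hmem.1, fun Y hY hYi hXY => ?_⟩
  have hval := hmem.2 Y hY hYi hXY
  refine ⟨le_antisymm ?_ ?_, hval⟩
  · refine Nat.sInf_le ⟨(hXY _ le_rfl).1 hmem.1, fun Z hZ hZi hYZ => ?_⟩
    rw [hval]
    exact hmem.2 Z hZ hZi fun i hi => (hXY i hi).trans (hYZ i hi)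
  · by_contra hlt
    rw [not_le] at hlt
    have hmemY := Nat.sInf_mem (hD Y hY hYi)
    refine absurd (Nat.sInf_le (s := D X) ⟨(hXY _ hlt.le).2 hmemY.1, fun Z hZ hZi hXZ => ?_⟩)
      (not_le.2 hlt)
    rw [← hval]
    exact hmemY.2 Z hZ hZi fun i hi => (hXY i (hi.trans hlt.le)).symm.trans (hXZ i hi)

/-- One step in the construction of a minimal bad array: shorten as early as possible. -/
theorem exists_step (hr : ∀ x y z, r z x → lt x y → r z y) {a : Arr P}
    (ha : a.IsBad r)
    (hex : ∃ b : Arr P, b.IsBad r ∧ Arr.Le lt b a ∧ ∃ X ⊆ b.A, X.Infinite ∧ a.τ X < b.τ X) :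
    ∃ (a' : Arr P) (n : ℕ) (X : Set ℕ), a'.IsBad r ∧ Arr.Le lt a' a ∧
      (∀ i ≤ n, i ∈ a'.A ↔ i ∈ a.A) ∧ X ⊆ a'.A ∧ X.Infinite ∧ a.τ X = n ∧ n ∈ a'.A ∧
      (∀ Y ⊆ a'.A, Y.Infinite → Agree n X Y → n < a'.τ Y) ∧
      (∀ b : Arr P, b.IsBad r → Arr.Le lt b a → ∀ X ⊆ b.A, X.Infinite → a.τ X < b.τ X →
        n ≤ a.τ X) := by
  classical
  let S : Set ℕ := {n | ∃ b : Arr P, b.IsBad r ∧ Arr.Le lt b a ∧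
    ∃ X ⊆ b.A, X.Infinite ∧ a.τ X < b.τ X ∧ a.τ X = n}
  have hS : S.Nonempty := by
    obtain ⟨b, h1, h2, X, h3, h4, h5⟩ := hex
    exact ⟨_, b, h1, h2, X, h3, h4, h5, rfl⟩
  obtain ⟨b, hb, hba, X, hXb, hXi, hXlt, hXn⟩ := Nat.sInf_mem hS
  set n := sInf S with hn
  have hmin : ∀ b : Arr P, b.IsBad r → Arr.Le lt b a → ∀ X ⊆ b.A, X.Infinite →
      a.τ X < b.τ X → n ≤ a.τ X := fun b h1 h2 X h3 h4 h5 =>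
    Nat.sInf_le ⟨b, h1, h2, X, h3, h4, h5, rfl⟩
  let A' : Set ℕ := {y ∈ a.A | y ≤ n ∨ y ∈ b.A}
  have hA'a : A' ⊆ a.A := fun y hy => hy.1
  have hbA' : b.A ⊆ A' := fun y hy => ⟨hba.1 hy, Or.inr hy⟩
  let a' : Arr P := ⟨A', fun Y => if Y ⊆ b.A then b.τ Y else a.τ Y,
    fun Y => if Y ⊆ b.A then b.f Y else a.f Y⟩
  have hτ1 : ∀ Y, Y ⊆ b.A → a'.τ Y = b.τ Y := fun Y hY => if_pos hY
  have hτ2 : ∀ Y, ¬ Y ⊆ b.A → a'.τ Y = a.τ Y := fun Y hY => if_neg hY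
  have hf1 : ∀ Y, Y ⊆ b.A → a'.f Y = b.f Y := fun Y hY => if_pos hY
  have hf2 : ∀ Y, ¬ Y ⊆ b.A → a'.f Y = a.f Y := fun Y hY => if_neg hY
  have hle : Arr.Le lt a' a := by
    refine ⟨hA'a, fun Y hY hYi => ?_⟩
    by_cases hYb : Y ⊆ b.A
    · rw [hτ1 Y hYb, hf1 Y hYb]
      exact hba.2 Y hYb hYi
    · rw [hτ2 Y hYb, hf2 Y hYb]
      exact Or.inl ⟨rfl, rfl⟩
  have hsame : ∀ Y ⊆ A', Y.Infinite → a.τ Y < n → a'.τ Y = a.τ Y ∧ a'.f Y = a.f Y := by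
    intro Y hY hYi hYn
    by_cases hYb : Y ⊆ b.A
    · rw [hτ1 Y hYb, hf1 Y hYb]
      rcases hba.2 Y hYb hYi with h | h
      · exact h
      · have := hmin b hb hba Y hYb hYi h.1
        omega
    · exact ⟨hτ2 Y hYb, hf2 Y hYb⟩
  have hcoh : ∀ Y ⊆ A', ∀ Z ⊆ A', Agree n Y Z → Y ⊆ b.A → Z ⊆ b.A := by
    intro Y hY Z hZ hYZ hYb z hz
    rcases (hZ hz).2 with h | h
    · exact hYb ((hYZ z h).2 hz)
    · exact h
  have hbad : a'.IsBad r := by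
    refine ⟨hb.1.mono hbA', fun Y hY hYi => ⟨?_, fun Z hZ hZi hYZ => ?_⟩, fun Y hY hYi h => ?_⟩
    · by_cases hYb : Y ⊆ b.A
      · rw [hτ1 Y hYb]
        exact (hb.2.1 Y hYb hYi).1
      · rw [hτ2 Y hYb]
        exact (ha.2.1 Y (hY.trans hA'a) hYi).1
    · have haYZ : a.τ Z = a.τ Y ∧ a.f Z = a.f Y :=
        (ha.2.1 Y (hY.trans hA'a) hYi).2 Z (hZ.trans hA'a) hZi
          (hYZ.mono (hle.tau_le hY hYi))
      rcases lt_or_ge (a.τ Y) n with hYn | hYn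
      · rw [(hsame Y hY hYi hYn).1, (hsame Y hY hYi hYn).2,
          (hsame Z hZ hZi (haYZ.1 ▸ hYn)).1, (hsame Z hZ hZi (haYZ.1 ▸ hYn)).2]
        exact haYZ
      · have hn' : Agree n Y Z := hYZ.mono (hYn.trans (hle.tau_le hY hYi))
        by_cases hYb : Y ⊆ b.A
        · have hZb := hcoh Y hY Z hZ hn' hYb
          rw [hτ1 Y hYb] at hYZ
          rw [hτ1 Y hYb, hf1 Y hYb, hτ1 Z hZb, hf1 Z hZb]
          exact (hb.2.1 Y hYb hYi).2 Z hZb hZi hYZ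
        · have hZb : ¬ Z ⊆ b.A := fun h => hYb (hcoh Z hZ Y hY hn'.symm h)
          rw [hτ2 Y hYb, hf2 Y hYb, hτ2 Z hZb, hf2 Z hZb]
          exact haYZ
    · have htl : tl Y ⊆ A' := (tl_subset Y).trans hY
      by_cases hYb : Y ⊆ b.A
      · rw [hf1 Y hYb, hf1 _ ((tl_subset Y).trans hYb)] at h
        exact hb.2.2 Y hYb hYi h
      · rw [hf2 Y hYb] at h
        exact ha.2.2 Y (hY.trans hA'a) hYi (hle.rel hr htl (tl_infinite hYi) h)
  have hnX : n ∈ X := hXn ▸ (ha.2.1 X (hXb.trans hba.1) hXi).1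
  refine ⟨a', n, X, hbad, hle, fun i hi => ⟨fun h => h.1, fun h => ⟨h, Or.inl hi⟩⟩,
    hXb.trans hbA', hXi, hXn, hbA' (hXb hnX), fun Y hY hYi hXY => ?_, hmin⟩
  have haY : a.τ Y = n := by
    rw [← hXn]
    exact ((ha.2.1 X (hXb.trans hba.1) hXi).2 Y (hY.trans hA'a) hYi (by rwa [hXn])).1
  have h1 : n ≤ a'.τ Y := haY ▸ hle.tau_le hY hYi
  refine lt_of_le_of_ne h1 fun h2 => ?_
  have h3 := ((hbad.2.1 Y hY hYi).2 X (hXb.trans hbA') hXi (h2 ▸ hXY.symm)).1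
  rw [hτ1 X hXb, ← h2] at h3
  omega

/-- Below every bad array there is a minimal one. -/
theorem exists_minimal_bad (hwf : WellFounded lt) (hlt : ∀ ⦃x y z⦄, lt x y → lt y z → lt x z)
    (hr : ∀ x y z, r z x → lt x y → r z y) {a₀ : Arr P} (ha₀ : a₀.IsBad r) :
    ∃ a : Arr P, a.IsBad r ∧ ∀ b : Arr P, b.IsBad r → Arr.Le lt b a →
      ∀ X ⊆ b.A, X.Infinite → ¬ a.τ X < b.τ X := by
  by_contra hcon
  push Not at hcon
  have hstep : ∀ a : Arr P, a.IsBad r → ∃ (a' : Arr P) (n : ℕ) (X : Set ℕ),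
      a'.IsBad r ∧ Arr.Le lt a' a ∧
      (∀ i ≤ n, i ∈ a'.A ↔ i ∈ a.A) ∧ X ⊆ a'.A ∧ X.Infinite ∧ a.τ X = n ∧ n ∈ a'.A ∧
      (∀ Y ⊆ a'.A, Y.Infinite → Agree n X Y → n < a'.τ Y) ∧
      (∀ b : Arr P, b.IsBad r → Arr.Le lt b a → ∀ X ⊆ b.A, X.Infinite → a.τ X < b.τ X →
        n ≤ a.τ X) := by
    intro a ha
    obtain ⟨b, h1, h2, X, h3, h4, h5⟩ := hcon a ha
    exact exists_step hr ha ⟨b, h1, h2, X, h3, h4, h5⟩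
  choose! nx nn XX hbad' hle' hkeep' hXsub' hXinf' hXn' hnmem' hlong' hmin' using hstep
  let a : ℕ → Arr P := fun n => Nat.rec a₀ (fun _ a => nx a) n
  have ha : ∀ i, (a i).IsBad r := by
    intro i
    induction i with
    | zero => exact ha₀
    | succ i ih => exact hbad' _ ih
  have hle : ∀ i j, i ≤ j → Arr.Le lt (a j) (a i) := by
    intro i j hij
    induction hij with
    | refl => exact .refl _
    | step _ ih => exact (hle' _ (ha _)).trans hlt ih
  let n : ℕ → ℕ := fun i => nn (a i)
  let X : ℕ → Set ℕ := fun i => XX (a i)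
  have hkeep : ∀ i, ∀ k ≤ n i, k ∈ (a (i + 1)).A ↔ k ∈ (a i).A := fun i => hkeep' _ (ha i)
  have hXsub : ∀ i, X i ⊆ (a (i + 1)).A := fun i => hXsub' _ (ha i)
  have hXinf : ∀ i, (X i).Infinite := fun i => hXinf' _ (ha i)
  have hXn : ∀ i, (a i).τ (X i) = n i := fun i => hXn' _ (ha i)
  have hnmem : ∀ i, n i ∈ (a (i + 1)).A := fun i => hnmem' _ (ha i)
  have hlong : ∀ i, ∀ Y ⊆ (a (i + 1)).A, Y.Infinite → Agree (n i) (X i) Y →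
      n i < (a (i + 1)).τ Y := fun i => hlong' _ (ha i)
  have hmin : ∀ i, ∀ b : Arr P, b.IsBad r → Arr.Le lt b (a i) → ∀ X ⊆ b.A, X.Infinite →
      (a i).τ X < b.τ X → n i ≤ (a i).τ X := fun i => hmin' _ (ha i)
  have hXi : ∀ i, X i ⊆ (a i).A := fun i => (hXsub i).trans (hle i (i + 1) (by omega)).1
  have hnmono : Monotone n := by
    refine monotone_nat_of_le_succ fun i => ?_
    have h1 := (hle i (i + 1) (by omega)).tau_le (hXi (i + 1)) (hXinf (i + 1))
    have h2 : n (i + 1) < (a (i + 2)).τ (X (i + 1)) :=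
      hlong (i + 1) (X (i + 1)) (hXsub (i + 1)) (hXinf (i + 1)) (fun _ _ => Iff.rfl)
    have h3 := hXn (i + 1)
    have h4 := hmin i (a (i + 2)) (ha (i + 2)) (hle i (i + 2) (by omega))
      (X (i + 1)) (hXsub (i + 1))
      (hXinf (i + 1)) (by omega)
    omega
  have hunb : ∀ N, ∃ i, N < n i := by
    intro N
    by_contra hN
    push Not at hN
    classical
    let F : ℕ → ℕ × Finset ℕ := fun i => (n i, (Finset.range (N + 1)).filter (· ∈ X i))
    obtain ⟨i, -, j, -, hij, hF⟩ := Set.infinite_univ.exists_ne_map_eq_of_mapsTo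
      (f := F) (t := ↑((Finset.range (N + 1)) ×ˢ (Finset.range (N + 1)).powerset))
      (by
        intro i _
        simp only [Finset.coe_product, Set.mem_prod, Finset.mem_coe, Finset.mem_range,
          Finset.mem_powerset, F]
        exact ⟨by have := hN i; omega, Finset.filter_subset _ _⟩) (Finset.finite_toSet _)
    have key : ∀ i j, i < j → F i = F j → False := by
      intro i j hij hF
      have h1 : n i = n j := congrArg Prod.fst hF
      have h2 : (Finset.range (N + 1)).filter (· ∈ X i) =
        (Finset.range (N + 1)).filter (· ∈ X j) := congrArg Prod.snd hF
      have h3 : Agree (n i) (X i) (X j) := by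
        intro k hk
        have h4 := Finset.ext_iff.1 h2 k
        have := hN i
        simpa [show k < N + 1 by omega] using h4
      have h5 := hlong i (X j) ((hXi j).trans (hle (i + 1) j hij).1) (hXinf j) h3
      have h6 := (hle (i + 1) j hij).tau_le (hXi j) (hXinf j)
      have h7 := hXn j
      omega
    rcases lt_or_gt_of_ne hij with h | h
    exacts [key i j h hF, key j i h hF.symm]
  let A : Set ℕ := {y | ∀ i, y ∈ (a i).A}
  have hAsub : ∀ i, A ⊆ (a i).A := fun i y hy => hy i
  have hnA : ∀ i, n i ∈ A := by
    intro i j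
    rcases le_total j (i + 1) with h | h
    · exact (hle j (i + 1) h).1 (hnmem i)
    · induction h with
      | refl => exact hnmem i
      | @step j hj ih => exact (hkeep j _ (hnmono (by simp at hj; omega))).2 ih
  have hA : A.Infinite := Set.infinite_of_forall_exists_gt fun N => by
    obtain ⟨i, hi⟩ := hunb N
    exact ⟨n i, hnA i, hi⟩
  have hstab : ∀ X ⊆ A, X.Infinite → ∃ N, ∀ i, N ≤ i →
      (a i).τ X = (a N).τ X ∧ (a i).f X = (a N).f X := by
    intro X hX hXinf
    obtain ⟨_, ⟨N, rfl⟩, hN⟩ := hwf.has_min (Set.range fun i => (a i).f X) ⟨_, 0, rfl⟩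
    refine ⟨N, fun i hi => ?_⟩
    rcases (hle N i hi).2 X (hX.trans (hAsub i)) hXinf with h | h
    · exact h
    · exact absurd h.2 (hN _ ⟨i, rfl⟩)
  choose! st hst using hstab
  let c : Arr P := ⟨A, fun X => (a (st X)).τ X, fun X => (a (st X)).f X⟩
  have hc : ∀ X ⊆ A, X.Infinite → ∀ i, st X ≤ i →
      c.τ X = (a i).τ X ∧ c.f X = (a i).f X := fun X hX hXinf i hi =>
    ⟨(hst X hX hXinf i hi).1.symm, (hst X hX hXinf i hi).2.symm⟩
  have hcle : ∀ i, Arr.Le lt c (a i) := by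
    intro i
    refine ⟨hAsub i, fun X hX hXinf => ?_⟩
    obtain ⟨h1, h2⟩ := hc X hX hXinf (max i (st X)) (le_max_right _ _)
    rw [h1, h2]
    exact (hle i _ (le_max_left _ _)).2 X (hX.trans (hAsub _)) hXinf
  have hcbad : c.IsBad r := by
    refine ⟨hA, fun X hX hXinf => ⟨?_, fun Y hY hYinf hXY => ?_⟩, fun X hX hXinf h => ?_⟩
    · exact ((ha (st X)).2.1 X (hX.trans (hAsub _)) hXinf).1
    · obtain ⟨h1, h2⟩ := hc X hX hXinf (max (st X) (st Y)) (le_max_left _ _)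
      obtain ⟨h3, h4⟩ := hc Y hY hYinf (max (st X) (st Y)) (le_max_right _ _)
      rw [h1] at hXY
      rw [h1, h2, h3, h4]
      exact ((ha _).2.1 X (hX.trans (hAsub _)) hXinf).2 Y (hY.trans (hAsub _)) hYinf hXY
    · obtain ⟨h1, h2⟩ := hc X hX hXinf (max (st X) (st (tl X))) (le_max_left _ _)
      obtain ⟨h3, h4⟩ := hc (tl X) ((tl_subset X).trans hX) (tl_infinite hXinf)
        (max (st X) (st (tl X))) (le_max_right _ _)
      rw [h2, h4] at h
      exact (ha _).2.2 X (hX.trans (hAsub _)) hXinf h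
  obtain ⟨b, hb, hbc, Y, hY, hYinf, hlt'⟩ := hcon c hcbad
  obtain ⟨i, hi⟩ := hunb (c.τ Y)
  have h1 := (hcle i).tau_le (hY.trans hbc.1) hYinf
  have h2 := hmin i b hb (hbc.trans hlt (hcle i)) Y hY hYinf (by omega)
  omega

end MinBad

/-- A descent principle: if from every bad array one obtains, on a smaller base, a bad array
whose value at `X` is smaller and computed from the values at `X` and `tl X`, then
there are no bad arrays. -/
theorem arrayBqo_of_descent {P : Type*} {r lt : P → P → Prop} (hwf : WellFounded lt)
    (hlt : ∀ ⦃x y z⦄, lt x y → lt y z → lt x z) (hr : ∀ x y z, r z x → lt x y → r z y)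
    (hdesc : ∀ A : Set ℕ, A.Infinite → ∀ f : Set ℕ → P, LocDet A f → BadArray r A f →
      ∃ B ⊆ A, B.Infinite ∧ ∃ G : P → P → P,
        BadArray r B (fun X => G (f X) (f (tl X))) ∧
        ∀ X ⊆ B, X.Infinite → lt (G (f X) (f (tl X))) (f X)) :
    ArrayBqo r := by
  intro A₀ hA₀ f₀ hf₀ hbad₀
  obtain ⟨a₀, ha₀, -, -⟩ := exists_arr hA₀ hf₀ hbad₀
  obtain ⟨a, ha, hmin⟩ := exists_minimal_bad hwf hlt hr ha₀
  have hloc : LocDet a.A a.f := fun X hX hXi =>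
    ⟨a.τ X, fun Y hY hYi hXY => ((ha.2.1 X hX hXi).2 Y hY hYi hXY).2⟩
  obtain ⟨B, hBA, hB, G, hG, hGlt⟩ := hdesc a.A ha.1 a.f hloc ha.2.2
  let nxt : Set ℕ → ℕ := fun X => sInf {m ∈ X | max (a.τ X) (a.τ (tl X)) < m}
  have hnxt : ∀ X : Set ℕ, X.Infinite → nxt X ∈ {m ∈ X | max (a.τ X) (a.τ (tl X)) < m} := by
    intro X hX
    obtain ⟨k, hk, h⟩ := hX.exists_gt (max (a.τ X) (a.τ (tl X)))
    exact Nat.sInf_mem ⟨k, hk, h⟩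
  let b : Arr P := ⟨B, nxt, fun X => G (a.f X) (a.f (tl X))⟩
  have hb : b.IsBad r := by
    refine ⟨hB, fun X hX hXi => ⟨(hnxt X hXi).1, fun Y hY hYi hXY => ?_⟩, hG⟩
    have hX' : max (a.τ X) (a.τ (tl X)) < nxt X := (hnxt X hXi).2
    change Agree (nxt X) X Y at hXY
    obtain ⟨h1, h2⟩ := (ha.2.1 X (hX.trans hBA) hXi).2 Y (hY.trans hBA) hYi
      (hXY.mono (by omega))
    obtain ⟨h3, h4⟩ := (ha.2.1 (tl X) ((tl_subset X).trans (hX.trans hBA)) (tl_infinite hXi)).2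
      (tl Y) ((tl_subset Y).trans (hY.trans hBA)) (tl_infinite hYi)
      ((hXY.tl (hnxt X hXi).1).mono (by omega))
    refine ⟨?_, ?_⟩
    · change nxt Y = nxt X
      have hY' := hnxt Y hYi
      apply le_antisymm
      · exact Nat.sInf_le ⟨(hXY _ le_rfl).1 (hnxt X hXi).1, by rw [h1, h3]; exact hX'⟩
      · by_contra hlt
        rw [not_le] at hlt
        rw [h1, h3] at hY'
        exact absurd (Nat.sInf_le (s := {m ∈ X | max (a.τ X) (a.τ (tl X)) < m})
          ⟨(hXY _ hlt.le).2 hY'.1, hY'.2⟩) (not_le.2 hlt)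
    · change G (a.f Y) (a.f (tl Y)) = G (a.f X) (a.f (tl X))
      rw [h2, h4]
  have hlonger : ∀ X ⊆ B, X.Infinite → a.τ X < nxt X := fun X _ hXi =>
    lt_of_le_of_lt (le_max_left _ _) (hnxt X hXi).2
  exact hmin b hb ⟨hBA, fun X hX hXi => Or.inr ⟨hlonger X hX hXi, hGlt X hX hXi⟩⟩ B subset_rfl hB
    (hlonger B subset_rfl hB)

/-! ### From barriers to arrays -/

section Barrier

variable {P : Type*} {r : P → P → Prop}

open Classical in
/-- The initial segment of `X` determining the value of the array at `X`. -/
noncomputable def Arr.seg (a : Arr P) (X : Set ℕ) : Finset ℕ :=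
  (Finset.range (a.τ X + 1)).filter (· ∈ X)

theorem Arr.mem_seg {a : Arr P} {X : Set ℕ} {i : ℕ} : i ∈ a.seg X ↔ i ≤ a.τ X ∧ i ∈ X := by
  simp [Arr.seg]

theorem Arr.ext_seg (a : Arr P) (X : Set ℕ) : Ext (a.seg X) X := by
  refine ⟨fun x hx => (Arr.mem_seg.1 hx).2, fun y hy hys x hx => ?_⟩
  have h1 := (Arr.mem_seg.1 hx).1
  by_contra h
  exact hys (Arr.mem_seg.2 ⟨by omega, hy⟩)

theorem Arr.IsBad.tau_mem_seg {a : Arr P} (ha : a.IsBad r) {X : Set ℕ} (hX : X ⊆ a.A)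
    (hXi : X.Infinite) : a.τ X ∈ a.seg X :=
  Arr.mem_seg.2 ⟨le_rfl, (ha.2.1 X hX hXi).1⟩

theorem Arr.IsBad.of_ext {a : Arr P} (ha : a.IsBad r) {X Y : Set ℕ} (hX : X ⊆ a.A)
    (hXi : X.Infinite) (hY : Y ⊆ a.A) (hYi : Y.Infinite) (h : Ext (a.seg X) Y) :
    a.seg Y = a.seg X ∧ a.f Y = a.f X := by
  have hXY : Agree (a.τ X) X Y := (a.ext_seg X).agree h ⟨_, ha.tau_mem_seg hX hXi, le_rfl⟩
  obtain ⟨h1, h2⟩ := (ha.2.1 X hX hXi).2 Y hY hYi hXY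
  refine ⟨?_, h2⟩
  ext i
  rw [Arr.mem_seg, Arr.mem_seg, h1]
  exact and_congr_right fun hi => (hXY i hi).symm

/-- On a smaller base, the determining segments form an antichain. -/
theorem Arr.IsBad.exists_antichain {a : Arr P} (ha : a.IsBad r) :
    ∃ B ⊆ a.A, B.Infinite ∧ ∀ X ⊆ B, X.Infinite → ∀ Y ⊆ a.A, Y.Infinite →
      a.seg Y ⊆ a.seg X → a.seg Y = a.seg X := by
  obtain ⟨B, hBA, hB, hW⟩ := exists_homogeneous ha.1 (W := fun X => ∀ Y ⊆ a.A, Y.Infinite →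
      a.seg Y ⊆ a.seg X → a.seg Y = a.seg X) (by
    intro X hX hXi
    refine ⟨a.τ X, fun Y hY hYi hXY => ?_⟩
    have : a.seg Y = a.seg X := by
      ext i
      rw [Arr.mem_seg, Arr.mem_seg, ((ha.2.1 X hX hXi).2 Y hY hYi hXY).1]
      exact and_congr_right fun hi => (hXY i hi).symm
    simp only [this])
  refine ⟨B, hBA, hB, hW.resolve_right fun hneg => ?_⟩
  let S : Set ℕ := {n | ∃ X ⊆ B, X.Infinite ∧ (a.seg X).card = n}
  obtain ⟨X, hX, hXi, hXn⟩ := Nat.sInf_mem (s := S) ⟨_, B, subset_rfl, hB, rfl⟩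
  obtain ⟨Y, hY, hYi, hsub, hne⟩ : ∃ Y ⊆ a.A, Y.Infinite ∧ a.seg Y ⊆ a.seg X ∧
      a.seg Y ≠ a.seg X := by
    have := hneg X hX hXi
    push Not at this
    exact this
  obtain ⟨Z, hZ, hZi, hZY⟩ := exists_ext hB
    (fun x hx => hX ((a.ext_seg X).1 x (hsub hx)) : ∀ x ∈ a.seg Y, x ∈ B)
  have hZ' := (ha.of_ext hY hYi (hZ.trans hBA) hZi hZY).1
  have h1 : sInf S ≤ (a.seg Z).card := Nat.sInf_le ⟨Z, hZ, hZi, rfl⟩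
  have h2 := Finset.card_lt_card (hsub.ssubset_of_ne hne)
  rw [hZ'] at h1
  omega

theorem ext_of_prec {m k : ℕ} {i : ℕ → ℕ} (hk : 1 ≤ k) (hkm : k < m)
    (hi : StrictMonoOn i (Icc 1 m)) {Z : Set ℕ} (hZ : Ext ((Finset.Icc 1 m).image i) Z) :
    Ext ((Finset.Icc 1 k).image i) Z ∧ Ext ((Finset.Icc 2 m).image i) (tl Z) := by
  have hmem : ∀ j, 1 ≤ j → j ≤ m → i j ∈ Z := fun j h1 h2 =>
    hZ.1 _ (Finset.mem_image_of_mem i (Finset.mem_Icc.2 ⟨h1, h2⟩))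
  have hcase : ∀ y ∈ Z, (∃ j, 1 ≤ j ∧ j ≤ m ∧ i j = y) ∨ ∀ j, 1 ≤ j → j ≤ m → i j < y := by
    intro y hy
    by_cases h : y ∈ (Finset.Icc 1 m).image i
    · obtain ⟨j, hj, hjy⟩ := Finset.mem_image.1 h
      rw [Finset.mem_Icc] at hj
      exact Or.inl ⟨j, hj.1, hj.2, hjy⟩
    · exact Or.inr fun j h1 h2 =>
        hZ.2 y hy h _ (Finset.mem_image_of_mem i (Finset.mem_Icc.2 ⟨h1, h2⟩))
  have hinf : sInf Z = i 1 := by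
    apply le_antisymm (Nat.sInf_le (hmem 1 le_rfl (by omega)))
    rcases hcase _ (Nat.sInf_mem ⟨_, hmem 1 le_rfl (by omega)⟩) with ⟨j, h1, h2, h3⟩ | h
    · rw [← h3]
      exact hi.monotoneOn ⟨le_rfl, by omega⟩ ⟨h1, h2⟩ h1
    · exact (h 1 le_rfl (by omega)).le
  refine ⟨⟨?_, ?_⟩, ?_, ?_⟩
  · intro x hx
    obtain ⟨j, hj, rfl⟩ := Finset.mem_image.1 hx
    rw [Finset.mem_Icc] at hj
    exact hmem j hj.1 (by omega)
  · intro y hy hyn x hx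
    obtain ⟨j, hj, rfl⟩ := Finset.mem_image.1 hx
    rw [Finset.mem_Icc] at hj
    rcases hcase y hy with ⟨l, h1, h2, rfl⟩ | h
    · have : k < l := by
        by_contra h
        exact hyn (Finset.mem_image_of_mem i (Finset.mem_Icc.2 ⟨h1, by omega⟩))
      exact hi ⟨hj.1, by omega⟩ ⟨h1, h2⟩ (by omega)
    · exact h j hj.1 (by omega)
  · intro x hx
    obtain ⟨j, hj, rfl⟩ := Finset.mem_image.1 hx
    rw [Finset.mem_Icc] at hj
    refine ⟨hmem j (by omega) hj.2, ?_⟩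
    rw [hinf]
    exact hi ⟨le_rfl, by omega⟩ ⟨by omega, hj.2⟩ (by omega)
  · rintro y ⟨hy, hy1⟩ hyn x hx
    obtain ⟨j, hj, rfl⟩ := Finset.mem_image.1 hx
    rw [Finset.mem_Icc] at hj
    rw [hinf] at hy1
    rcases hcase y hy with ⟨l, h1, h2, rfl⟩ | h
    · exfalso
      rcases h1.eq_or_lt with rfl | h1
      · exact lt_irrefl _ hy1
      · exact hyn (Finset.mem_image_of_mem i (Finset.mem_Icc.2 ⟨h1, h2⟩))
    · exact h j (by omega) hj.2

theorem arrayBqo_of_isBqo (h : IsBqo r) : ArrayBqo r := by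
  intro A hA f hf hbad
  obtain ⟨a, ha, rfl, rfl⟩ := exists_arr hA hf hbad
  obtain ⟨B, hBA, hB, hanti⟩ := ha.exists_antichain
  let S : Set (Finset ℕ) := {b | ∃ X ⊆ B, X.Infinite ∧ a.seg X = b}
  have hSB : ∀ b ∈ S, ∀ x ∈ b, x ∈ B := by
    rintro b ⟨X, hX, hXi, rfl⟩ x hx
    exact hX ((a.ext_seg X).1 x hx)
  have hSinf : S.Infinite := by
    refine Set.Infinite.of_image (fun b => b.sup id)
      (Set.infinite_of_forall_exists_gt fun n => ?_)
    have hXi : ({y ∈ B | n < y}).Infinite := by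
      refine Set.infinite_of_forall_exists_gt fun m => ?_
      obtain ⟨y, hy, hmy⟩ := hB.exists_gt (max n m)
      exact ⟨y, ⟨hy, (le_max_left _ _).trans_lt hmy⟩, (le_max_right _ _).trans_lt hmy⟩
    have hX : {y ∈ B | n < y} ⊆ B := fun y hy => hy.1
    have hmem := ha.tau_mem_seg (hX.trans hBA) hXi
    exact ⟨_, ⟨_, ⟨_, hX, hXi, rfl⟩, rfl⟩,
      lt_of_lt_of_le ((a.ext_seg _).1 _ hmem).2 (Finset.le_sup (f := id) hmem)⟩
  have hbar : IsBarrier S := by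
    refine ⟨⟨hSinf, fun X hXi hX => ?_⟩, ?_⟩
    · have hXB : X ⊆ B := fun x hx => by
        obtain ⟨b, hb, hxb⟩ := mem_iUnion₂.1 (hX hx)
        exact hSB b hb x hxb
      refine ⟨a.seg X, ⟨X, hXB, hXi, rfl⟩, ?_⟩
      ext i
      constructor
      · exact fun hi => ⟨(a.ext_seg X).1 i hi, i, hi, le_rfl⟩
      · rintro ⟨hi, m, hm, him⟩
        exact Arr.mem_seg.2 ⟨him.trans (Arr.mem_seg.1 hm).1, hi⟩
    · rintro _ ⟨X, hX, hXi, rfl⟩ _ ⟨Y, hY, hYi, rfl⟩ hne hsub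
      exact hne (hanti Y hY hYi X (hX.trans hBA) hXi hsub)
  have hval : ∀ b : Finset ℕ, ∃ p, ∀ X ⊆ a.A, X.Infinite → (∃ Y ⊆ B, Y.Infinite ∧ a.seg Y = b) →
      Ext b X → a.f X = p := by
    intro b
    by_cases hb : ∃ Y ⊆ B, Y.Infinite ∧ a.seg Y = b
    · obtain ⟨Y, hY, hYi, rfl⟩ := hb
      exact ⟨a.f Y, fun X hX hXi _ hYX => (ha.of_ext (hY.trans hBA) hYi hX hXi hYX).2⟩
    · exact ⟨a.f B, fun X _ _ hb' => absurd hb' hb⟩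
  choose g hg using hval
  refine h S hbar g ?_
  rintro b₁ hb₁ b₂ hb₂ ⟨m, k, i, hk, hkm, hi, rfl, rfl⟩ hrel
  have hsub : ∀ x ∈ (Finset.Icc 1 m).image i, x ∈ B := by
    intro x hx
    obtain ⟨j, hj, rfl⟩ := Finset.mem_image.1 hx
    rw [Finset.mem_Icc] at hj
    by_cases hjk : j ≤ k
    · exact hSB _ hb₁ _ (Finset.mem_image_of_mem i (Finset.mem_Icc.2 ⟨hj.1, hjk⟩))
    · exact hSB _ hb₂ _ (Finset.mem_image_of_mem i (Finset.mem_Icc.2 ⟨by omega, hj.2⟩))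
  obtain ⟨Z, hZ, hZi, hZext⟩ := exists_ext hB hsub
  obtain ⟨h1, h2⟩ := ext_of_prec hk hkm hi hZext
  refine ha.2.2 Z (hZ.trans hBA) hZi ?_
  rw [hg _ Z (hZ.trans hBA) hZi hb₁ h1,
    hg _ (tl Z) ((tl_subset Z).trans (hZ.trans hBA)) (tl_infinite hZi) hb₂ h2]
  exact hrel

end Barrier

/-- The order on `Option Q` in which `none` is related only to itself. -/
def optLe {Q : Type*} (r : Q → Q → Prop) : Option Q → Option Q → Prop
  | some p, some q => r p q
  | none, none => True
  | _, _ => False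

theorem ArrayBqo.option {Q : Type*} {r : Q → Q → Prop} (h : ArrayBqo r) :
    ArrayBqo (optLe r) := by
  intro A hA f hf hbad
  obtain ⟨B, hBA, hB, hW⟩ := exists_homogeneous hA (hf.comp (fun o => o = none))
  rcases hW with hW | hW
  · refine hbad B hBA hB ?_
    have h1 : f B = none := hW B subset_rfl hB
    have h2 : f (tl B) = none := hW _ (tl_subset B) (tl_infinite hB)
    rw [h1, h2]
    trivial
  · obtain ⟨q, hq⟩ := Option.ne_none_iff_exists'.1 (hW B subset_rfl hB)
    refine h B hB (fun X => (f X).getD q) ((hf.mono hBA).comp (fun o => o.getD q)) ?_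
    intro X hX hXi hrel
    refine hbad X (hX.trans hBA) hXi ?_
    obtain ⟨p₁, h1⟩ := Option.ne_none_iff_exists'.1 (hW X hX hXi)
    obtain ⟨p₂, h2⟩ := Option.ne_none_iff_exists'.1
      (hW (tl X) ((tl_subset X).trans hX) (tl_infinite hXi))
    simp only [h1, h2, Option.getD_some] at hrel ⊢
    exact hrel

/-! ### Labelled trees with two sequences of children -/

/-- Codes for `Q`-labelled orders: `node q l r` stands for
`l 0 + l 1 + ⋯ + q + ⋯ + r 1 + r 0`. -/
inductive Tree (Q : Type*)
  | nil : Tree Q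
  | node (q : Q) (l r : ℕ → Tree Q) : Tree Q

namespace Tree

variable {Q : Type*} {ρ : Q → Q → Prop}

/-- Embeddability of trees. -/
inductive Le (ρ : Q → Q → Prop) : Tree Q → Tree Q → Prop
  | nil (t : Tree Q) : Le ρ nil t
  | left {s : Tree Q} (q : Q) (l r : ℕ → Tree Q) (k : ℕ) (h : Le ρ s (l k)) :
      Le ρ s (node q l r)
  | right {s : Tree Q} (q : Q) (l r : ℕ → Tree Q) (k : ℕ) (h : Le ρ s (r k)) :
      Le ρ s (node q l r)
  | node {q q' : Q} {l r l' r' : ℕ → Tree Q} (hq : ρ q q') (φ ψ : ℕ → ℕ)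
      (hl : ∀ n, Le ρ (l n) (l' (φ n))) (hr : ∀ n, Le ρ (r n) (r' (ψ n))) :
      Le ρ (node q l r) (node q' l' r')

theorem Le.refl (hρ : ∀ q, ρ q q) (t : Tree Q) : Le ρ t t := by
  induction t with
  | nil => exact .nil _
  | node q l r ihl ihr => exact .node (hρ q) id id ihl ihr

theorem Le.trans (hρ : ∀ p q s, ρ p q → ρ q s → ρ p s) {s t u : Tree Q} (hst : Le ρ s t)
    (htu : Le ρ t u) : Le ρ s u := by
  induction htu generalizing s with
  | nil u => cases hst; exact .nil _
  | left q l r k _ ih => exact .left q l r k (ih hst)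
  | right q l r k _ ih => exact .right q l r k (ih hst)
  | node hq φ ψ hl hr ihl ihr =>
    cases hst with
    | nil => exact .nil _
    | left q l r k h => exact .left _ _ _ _ (ihl k h)
    | right q l r k h => exact .right _ _ _ _ (ihr k h)
    | node hq' φ' ψ' hl' hr' =>
      exact .node (hρ _ _ _ hq' hq) (φ ∘ φ') (ψ ∘ ψ') (fun n => ihl _ (hl' n))
        fun n => ihr _ (hr' n)

/-- The label of the root. -/
def label : Tree Q → Option Q
  | nil => none
  | node q _ _ => some q

/-- The left children. -/
def lft : Tree Q → ℕ → Tree Q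
  | nil, _ => nil
  | node _ l _, n => l n

/-- The right children. -/
def rgt : Tree Q → ℕ → Tree Q
  | nil, _ => nil
  | node _ _ r, n => r n

/-- `s` is a child of `t`. -/
def Child (s t : Tree Q) : Prop := t ≠ nil ∧ ∃ n, s = t.lft n ∨ s = t.rgt n

theorem child_wf : WellFounded (Child (Q := Q)) := by
  refine ⟨fun t => ?_⟩
  induction t with
  | nil => exact ⟨_, fun _ h => absurd rfl h.1⟩
  | node q l r ihl ihr =>
    refine ⟨_, ?_⟩
    rintro s ⟨-, n, rfl | rfl⟩
    exacts [ihl n, ihr n]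

theorem Le.of_child {s t u : Tree Q} (h : Le ρ s t) (htu : Child t u) : Le ρ s u := by
  obtain ⟨hne, n, h' | h'⟩ := htu <;> cases u <;> first | exact absurd rfl hne | subst h'
  · exact .left _ _ _ n h
  · exact .right _ _ _ n h

theorem Le.of_transGen {s t u : Tree Q} (h : Le ρ s t) (htu : Relation.TransGen Child t u) :
    Le ρ s u := by
  induction htu with
  | single h' => exact h.of_child h'
  | tail _ h' ih => exact ih.of_child h'

theorem exists_descent {B : Set ℕ} {f : Set ℕ → Tree Q}
    (hne : ∀ X ⊆ B, X.Infinite → f X ≠ nil) {side : Tree Q → ℕ → Tree Q}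
    (hside : ∀ t n, t ≠ nil → Child (side t n) t)
    (h : ∀ X ⊆ B, X.Infinite → ∃ n, ∀ k, ¬ Le ρ (side (f X) n) (side (f (tl X)) k)) :
    ∃ G : Tree Q → Tree Q → Tree Q, BadArray (Le ρ) B (fun X => G (f X) (f (tl X))) ∧
      ∀ X ⊆ B, X.Infinite → Relation.TransGen Child (G (f X) (f (tl X))) (f X) := by
  have hG : ∀ x y : Tree Q, ∃ n, (∃ n, ∀ k, ¬ Le ρ (side x n) (side y k)) →
      ∀ k, ¬ Le ρ (side x n) (side y k) := by
    intro x y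
    by_cases hxy : ∃ n, ∀ k, ¬ Le ρ (side x n) (side y k)
    · obtain ⟨n, hn⟩ := hxy
      exact ⟨n, fun _ => hn⟩
    · exact ⟨0, fun h => absurd h hxy⟩
  choose g hg using hG
  refine ⟨fun x y => side x (g x y), fun X hX hXi => ?_,
    fun X hX hXi => .single (hside _ _ (hne X hX hXi))⟩
  exact hg _ _ (h X hX hXi) _

/-- Trees over a better-quasi-order are better-quasi-ordered. -/
theorem arrayBqo_le (hρ : ArrayBqo ρ) : ArrayBqo (Le ρ) := by
  refine arrayBqo_of_descent (child_wf (Q := Q)).transGen (fun _ _ _ => Relation.TransGen.trans)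
    (fun x y z h h' => h.of_transGen h') fun A hA f hf hbad => ?_
  have hne : ∀ X ⊆ A, X.Infinite → f X ≠ nil := by
    intro X hX hXi h
    refine hbad X hX hXi ?_
    rw [h]
    exact .nil _
  obtain ⟨B, hBA, hB, hW⟩ := exists_homogeneous hA
    (hf.comp_tl fun x y => optLe ρ (label x) (label y))
  have hBρ := hW.resolve_right fun h => hρ.option B hB _ ((hf.mono hBA).comp label) h
  obtain ⟨C, hCB, hC, hW⟩ := exists_homogeneous hB
    ((hf.mono hBA).comp_tl fun x y => ∃ n, ∀ k, ¬ Le ρ (lft x n) (lft y k))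
  rcases hW with hL | hL
  · exact ⟨C, hCB.trans hBA, hC, exists_descent (fun X hX => hne X (hX.trans (hCB.trans hBA)))
      (fun t n ht => ⟨ht, n, Or.inl rfl⟩) hL⟩
  obtain ⟨D, hDC, hD, hW⟩ := exists_homogeneous hC
    ((hf.mono (hCB.trans hBA)).comp_tl fun x y => ∃ n, ∀ k, ¬ Le ρ (rgt x n) (rgt y k))
  have hDA := hDC.trans (hCB.trans hBA)
  rcases hW with hR | hR
  · exact ⟨D, hDA, hD, exists_descent (fun X hX => hne X (hX.trans hDA))
      (fun t n ht => ⟨ht, n, Or.inr rfl⟩) hR⟩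
  exfalso
  have h0 := hbad D hDA hD
  have h1 := hBρ D (hDC.trans hCB) hD
  have h2 := hL D hDC hD
  have h3 := hR D subset_rfl hD
  revert h0 h1 h2 h3
  cases f D with
  | nil => exact fun h _ _ _ => h (.nil _)
  | node q l r =>
    cases f (tl D) with
    | nil => exact fun _ h _ _ => h.elim
    | node q' l' r' =>
      intro h0 h1 h2 h3
      push Not at h2 h3
      choose φ hφ using h2
      choose ψ hψ using h3
      exact h0 (.node h1 φ ψ hφ hψ)

end Tree

/-- A relation without bad arrays is a well-quasi-order. -/
theorem ArrayBqo.exists_lt {P : Type*} {r : P → P → Prop} (h : ArrayBqo r) (t : ℕ → P) :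
    ∃ i j, i < j ∧ r (t i) (t j) := by
  have hloc : LocDet univ fun X : Set ℕ => t (sInf X) := by
    intro X _ hXi
    obtain ⟨m, hm⟩ := hXi.nonempty
    exact ⟨m, fun Y _ _ hXY => congrArg t (hXY.sInf_eq hm).symm⟩
  have h' := h univ Set.infinite_univ _ hloc
  simp only [BadArray, not_forall, not_not] at h'
  obtain ⟨X, -, hXi, hX⟩ := h'
  exact ⟨_, _, (Nat.sInf_mem (tl_infinite hXi).nonempty).2, hX⟩

/-! ### Gluing embeddings -/

section Glue

variable {L : Type*} {ρ : L → L → Prop} {D E S T S' T' : Set ℝ} {v w : ℝ → L} {h : ℝ → ℝ}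

/-- `h` is a label-increasing, strictly monotone and continuous map of `S` into `T`. -/
structure IsEmb (ρ : L → L → Prop) (v w : ℝ → L) (S T : Set ℝ) (h : ℝ → ℝ) : Prop where
  maps : ∀ y ∈ S, h y ∈ T
  mono : StrictMonoOn h S
  cont : ContinuousOn h S
  lab : ∀ y ∈ S, ρ (v y) (w (h y))

theorem IsEmb.mono_right (hh : IsEmb ρ v w S T h) (hT : T ⊆ T') : IsEmb ρ v w S T' h :=
  ⟨fun y hy => hT (hh.maps y hy), hh.mono, hh.cont, hh.lab⟩

theorem IsEmb.empty (hS : ∀ y, y ∉ S) : IsEmb ρ v w S T id :=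
  ⟨fun y hy => (hS y hy).elim, strictMono_id.strictMonoOn _, continuousOn_id,
    fun y hy => (hS y hy).elim⟩

theorem IsEmb.neg (hh : IsEmb ρ v w S T h) :
    IsEmb ρ (fun y => v (-y)) (fun y => w (-y)) {y | -y ∈ S} {y | -y ∈ T}
      (fun y => -h (-y)) := by
  refine ⟨fun y hy => ?_, fun y hy z hz hyz => ?_, ?_, fun y hy => ?_⟩
  · simpa using hh.maps _ hy
  · exact neg_lt_neg (hh.mono hz hy (neg_lt_neg hyz))
  · exact (hh.cont.comp continuous_neg.continuousOn fun y hy => hy).neg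
  · simpa using hh.lab _ hy

theorem setOf_neg_mem_inter_Ioo (D : Set ℝ) (a b : ℝ) :
    {y | -y ∈ D ∩ Ioo a b} = {y | -y ∈ D} ∩ Ioo (-b) (-a) := by
  ext y
  constructor
  · rintro ⟨h1, h2, h3⟩
    exact ⟨h1, by linarith, by linarith⟩
  · rintro ⟨h1, h2, h3⟩
    exact ⟨h1, by linarith, by linarith⟩

theorem continuousWithinAt_of_eqOn {g : ℝ → ℝ} {y a b : ℝ} (hSD : S ⊆ D)
    (hy : y ∈ D ∩ Ioo a b) (hg : ContinuousOn g (D ∩ Ioo a b))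
    (hEq : ∀ z ∈ D ∩ Ioo a b, h z = g z) :
    ContinuousWithinAt h S y := by
  have h1 : ContinuousWithinAt h (D ∩ Ioo a b) y := (hg y hy).congr hEq (hEq y hy)
  exact ((continuousWithinAt_inter (Ioo_mem_nhds hy.2.1 hy.2.2)).1 h1).mono hSD

theorem isEmb_glue {a m b a' m' b' : ℝ} {g : ℝ → ℝ} (hm : m ∉ D)
    (hh : IsEmb ρ v w (D ∩ Ioo a m) (E ∩ Ioo a' m') h)
    (hg : IsEmb ρ v w (D ∩ Ioo m b) (E ∩ Ioo m' b') g) (ha' : a' ≤ m') (hb' : m' ≤ b') :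
    ∃ f, IsEmb ρ v w (D ∩ Ioo a b) (E ∩ Ioo a' b') f := by
  have hcase : ∀ y ∈ D ∩ Ioo a b, y ∈ D ∩ Ioo a m ∨ y ∈ D ∩ Ioo m b := by
    rintro y ⟨hy, h1, h2⟩
    rcases lt_trichotomy y m with h | rfl | h
    · exact Or.inl ⟨hy, h1, h⟩
    · exact absurd hy hm
    · exact Or.inr ⟨hy, h, h2⟩
  let f : ℝ → ℝ := fun y => if y < m then h y else g y
  have hf1 : ∀ y ∈ D ∩ Ioo a m, f y = h y := fun y hy => if_pos hy.2.2
  have hf2 : ∀ y ∈ D ∩ Ioo m b, f y = g y := fun y hy => if_neg hy.2.1.not_gt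
  refine ⟨f, fun y hy => ?_, fun y hy z hz hyz => ?_, fun y hy => ?_, fun y hy => ?_⟩
  · rcases hcase y hy with hy | hy
    · rw [hf1 y hy]
      have := hh.maps y hy
      exact ⟨this.1, this.2.1, this.2.2.trans_le hb'⟩
    · rw [hf2 y hy]
      have := hg.maps y hy
      exact ⟨this.1, ha'.trans_lt this.2.1, this.2.2⟩
  · rcases hcase y hy with hy | hy <;> rcases hcase z hz with hz | hz
    · rw [hf1 y hy, hf1 z hz]
      exact hh.mono hy hz hyz
    · rw [hf1 y hy, hf2 z hz]
      exact (hh.maps y hy).2.2.trans (hg.maps z hz).2.1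
    · exact absurd (hyz.trans hz.2.2) hy.2.1.not_gt
    · rw [hf2 y hy, hf2 z hz]
      exact hg.mono hy hz hyz
  · rcases hcase y hy with hy | hy
    · exact continuousWithinAt_of_eqOn inter_subset_left hy hh.cont hf1
    · exact continuousWithinAt_of_eqOn inter_subset_left hy hg.cont hf2
  · rcases hcase y hy with hy | hy
    · rw [hf1 y hy]
      exact hh.lab y hy
    · rw [hf2 y hy]
      exact hg.lab y hy

theorem exists_isEmb_left {c c' : ℕ → ℝ} {x x' : ℝ} {κ : ℕ → ℕ} (hc : StrictMono c)
    (hcx : Tendsto c atTop (𝓝 x)) (hcD : ∀ n, c (n + 1) ∉ D) (hc' : StrictMono c')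
    (hcx' : Tendsto c' atTop (𝓝 x')) (hκ : StrictMono κ)
    (hg : ∀ n, ∃ g, IsEmb ρ v w (D ∩ Ioo (c n) (c (n + 1)))
      (E ∩ Ioo (c' (κ n)) (c' (κ n + 1))) g) :
    ∃ h, IsEmb ρ v w (D ∩ Ioo (c 0) x) (E ∩ Ioo (c' 0) x') h ∧
      ∀ n, ∀ y ∈ D ∩ Ioo (c n) x, c' n < h y := by
  choose g hg using hg
  have hidx : ∀ y ∈ D ∩ Ioo (c 0) x, ∃ n, y ∈ Ioo (c n) (c (n + 1)) := by
    rintro y ⟨hy, h0, hyx⟩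
    have hex : ∃ N, y < c N := (hcx.eventually (lt_mem_nhds hyx)).exists
    classical
    obtain ⟨N, hN, hmin⟩ : ∃ N, y < c N ∧ ∀ m < N, ¬ y < c m :=
      ⟨Nat.find hex, Nat.find_spec hex, fun m hm => Nat.find_min hex hm⟩
    rcases N with _ | N
    · exact absurd hN h0.not_gt
    · refine ⟨N, lt_of_le_of_ne (not_lt.1 (hmin N (by omega))) ?_, hN⟩
      rintro rfl
      rcases N with _ | N
      · exact lt_irrefl _ h0
      · exact hcD N hy
  choose! i hi using hidx
  have hi_le : ∀ y ∈ D ∩ Ioo (c 0) x, ∀ n, c n < y → n ≤ i y := by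
    intro y hy n hn
    have := hc.lt_iff_lt.1 (hn.trans (hi y hy).2)
    omega
  have hi_eq : ∀ y ∈ D ∩ Ioo (c 0) x, ∀ n, y ∈ Ioo (c n) (c (n + 1)) → i y = n := by
    intro y hy n hn
    have h1 := hi_le y hy n hn.1
    have h2 := hc.lt_iff_lt.1 ((hi y hy).1.trans hn.2)
    omega
  have hκn : ∀ n, n ≤ κ n := hκ.id_le
  have hpiece : ∀ y ∈ D ∩ Ioo (c 0) x, y ∈ D ∩ Ioo (c (i y)) (c (i y + 1)) :=
    fun y hy => ⟨hy.1, hi y hy⟩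
  have hlow : ∀ n, ∀ y ∈ D ∩ Ioo (c n) x, c' n < g (i y) y := by
    intro n y hy
    have hy' : y ∈ D ∩ Ioo (c 0) x := ⟨hy.1, (hc.monotone (Nat.zero_le n)).trans_lt hy.2.1, hy.2.2⟩
    refine lt_of_le_of_lt (hc'.monotone ?_) ((hg (i y)).maps y (hpiece y hy')).2.1
    exact (hi_le y hy' n hy.2.1).trans (hκn _)
  have hsub : ∀ n, c n < x := fun n =>
    (hc n.lt_succ_self).trans_le (hc.monotone.ge_of_tendsto hcx _)
  refine ⟨fun y => g (i y) y, ⟨fun y hy => ⟨?_, ?_, ?_⟩, fun y hy z hz hyz => ?_, fun y hy => ?_,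
    fun y hy => (hg _).lab y (hpiece y hy)⟩, hlow⟩
  · exact ((hg _).maps y (hpiece y hy)).1
  · exact hlow 0 y hy
  · exact ((hg _).maps y (hpiece y hy)).2.2.trans_le (hc'.monotone.ge_of_tendsto hcx' _)
  · rcases (hi_le z hz _ ((hi y hy).1.trans hyz)).eq_or_lt with h | h
    · have hz' := hpiece z hz
      change g (i y) y < g (i z) z
      rw [← h] at hz' ⊢
      exact (hg _).mono (hpiece y hy) hz' hyz
    · refine ((hg _).maps y (hpiece y hy)).2.2.trans_le (le_trans (hc'.monotone ?_)
        ((hg _).maps z (hpiece z hz)).2.1.le)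
      exact hκ h
  · refine continuousWithinAt_of_eqOn inter_subset_left (hpiece y hy) (hg (i y)).cont fun z hz => ?_
    have hz' : z ∈ D ∩ Ioo (c 0) x :=
      ⟨hz.1, (hc.monotone (Nat.zero_le _)).trans_lt hz.2.1, hz.2.2.trans (hsub _)⟩
    change g (i z) z = g (i y) z
    rw [hi_eq z hz' _ hz.2]

theorem exists_isEmb_right {d d' : ℕ → ℝ} {x x' : ℝ} {κ : ℕ → ℕ} (hd : StrictAnti d)
    (hdx : Tendsto d atTop (𝓝 x)) (hdD : ∀ n, d (n + 1) ∉ D) (hd' : StrictAnti d')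
    (hdx' : Tendsto d' atTop (𝓝 x')) (hκ : StrictMono κ)
    (hg : ∀ n, ∃ g, IsEmb ρ v w (D ∩ Ioo (d (n + 1)) (d n))
      (E ∩ Ioo (d' (κ n + 1)) (d' (κ n))) g) :
    ∃ h, IsEmb ρ v w (D ∩ Ioo x (d 0)) (E ∩ Ioo x' (d' 0)) h ∧
      ∀ n, ∀ y ∈ D ∩ Ioo x (d n), h y < d' n := by
  obtain ⟨h, hh, hlow⟩ := exists_isEmb_left (ρ := ρ) (D := {y | -y ∈ D}) (E := {y | -y ∈ E})
    (v := fun y => v (-y)) (w := fun y => w (-y)) (c := fun n => -d n) (c' := fun n => -d' n)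
    (fun m n hmn => neg_lt_neg (hd hmn)) hdx.neg (fun n => by simpa using hdD n)
    (fun m n hmn => neg_lt_neg (hd' hmn)) hdx'.neg hκ (fun n => by
      obtain ⟨g, hg⟩ := hg n
      have := hg.neg
      rw [setOf_neg_mem_inter_Ioo, setOf_neg_mem_inter_Ioo] at this
      exact ⟨_, this⟩)
  have := hh.neg
  rw [← setOf_neg_mem_inter_Ioo, ← setOf_neg_mem_inter_Ioo] at this
  have hnn : ∀ S : Set ℝ, {y | -y ∈ {y | -y ∈ S}} = S := fun S => by ext y; simp
  rw [hnn, hnn] at this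
  simp only [neg_neg] at this
  refine ⟨_, this, fun n y hy => ?_⟩
  have h1 := hlow n (-y) ⟨by simpa using hy.1, by linarith [hy.2.2], by linarith [hy.2.1]⟩
  linarith

theorem exists_isEmb_center {c c' d d' : ℕ → ℝ} {x x' : ℝ} {g : ℝ → ℝ}
    (hcx : Tendsto c' atTop (𝓝 x')) (hdx : Tendsto d' atTop (𝓝 x'))
    (hc : ∀ n, c n < x) (hd : ∀ n, x < d n) (hc' : ∀ n, c' n < x') (hd' : ∀ n, x' < d' n)
    (hx' : x' ∈ E) (hlab : ρ (v x) (w x'))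
    (hh : IsEmb ρ v w (D ∩ Ioo (c 0) x) (E ∩ Ioo (c' 0) x') h)
    (hlow : ∀ n, ∀ y ∈ D ∩ Ioo (c n) x, c' n < h y)
    (hg : IsEmb ρ v w (D ∩ Ioo x (d 0)) (E ∩ Ioo x' (d' 0)) g)
    (hupp : ∀ n, ∀ y ∈ D ∩ Ioo x (d n), g y < d' n) :
    ∃ f, IsEmb ρ v w (D ∩ Ioo (c 0) (d 0)) (E ∩ Ioo (c' 0) (d' 0)) f := by
  have hcase : ∀ y ∈ D ∩ Ioo (c 0) (d 0),
      y ∈ D ∩ Ioo (c 0) x ∨ y = x ∨ y ∈ D ∩ Ioo x (d 0) := by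
    rintro y ⟨hy, h1, h2⟩
    rcases lt_trichotomy y x with h | h | h
    · exact Or.inl ⟨hy, h1, h⟩
    · exact Or.inr (Or.inl h)
    · exact Or.inr (Or.inr ⟨hy, h, h2⟩)
  let f : ℝ → ℝ := fun y => if y < x then h y else if y = x then x' else g y
  have hf1 : ∀ y, y < x → f y = h y := fun y hy => if_pos hy
  have hf0 : f x = x' := by simp [f]
  have hf2 : ∀ y, x < y → f y = g y := fun y hy =>
    (if_neg hy.not_gt).trans (if_neg hy.ne')
  refine ⟨f, fun y hy => ?_, fun y hy z hz hyz => ?_, fun y hy => ?_, fun y hy => ?_⟩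
  · rcases hcase y hy with hy | rfl | hy
    · rw [hf1 y hy.2.2]
      have := hh.maps y hy
      exact ⟨this.1, this.2.1, this.2.2.trans (hd' 0)⟩
    · rw [hf0]
      exact ⟨hx', hc' 0, hd' 0⟩
    · rw [hf2 y hy.2.1]
      have := hg.maps y hy
      exact ⟨this.1, (hc' 0).trans this.2.1, this.2.2⟩
  · rcases hcase y hy with hy | rfl | hy
    · rw [hf1 y hy.2.2]
      have hy' := (hh.maps y hy).2.2
      rcases hcase z hz with hz | rfl | hz
      · rw [hf1 z hz.2.2]
        exact hh.mono hy hz hyz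
      · rwa [hf0]
      · rw [hf2 z hz.2.1]
        exact hy'.trans (hg.maps z hz).2.1
    · rw [hf0, hf2 z hyz]
      exact (hg.maps z ⟨hz.1, hyz, hz.2.2⟩).2.1
    · have hxz := hy.2.1.trans hyz
      rw [hf2 y hy.2.1, hf2 z hxz]
      exact hg.mono hy ⟨hz.1, hxz, hz.2.2⟩ hyz
  · rcases hcase y hy with hy | rfl | hy
    · exact continuousWithinAt_of_eqOn inter_subset_left hy hh.cont fun z hz => hf1 z hz.2.2
    · rw [ContinuousWithinAt, hf0, tendsto_order]
      constructor
      · intro u hu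
        obtain ⟨n, hn⟩ := (hcx.eventually (lt_mem_nhds hu)).exists
        filter_upwards [self_mem_nhdsWithin, mem_nhdsWithin_of_mem_nhds (lt_mem_nhds (hc n))]
          with z hz hzn
        rcases hcase z hz with hz | rfl | hz
        · rw [hf1 z hz.2.2]
          exact hn.trans (hlow n z ⟨hz.1, hzn, hz.2.2⟩)
        · rwa [hf0]
        · rw [hf2 z hz.2.1]
          exact hu.trans (hg.maps z hz).2.1
      · intro u hu
        obtain ⟨n, hn⟩ := (hdx.eventually (gt_mem_nhds hu)).exists
        filter_upwards [self_mem_nhdsWithin, mem_nhdsWithin_of_mem_nhds (gt_mem_nhds (hd n))]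
          with z hz hzn
        rcases hcase z hz with hz | rfl | hz
        · rw [hf1 z hz.2.2]
          exact (hh.maps z hz).2.2.trans hu
        · rwa [hf0]
        · rw [hf2 z hz.2.1]
          exact (hupp n z ⟨hz.1, hz.2.1, hzn⟩).trans hn
    · exact continuousWithinAt_of_eqOn inter_subset_left hy hg.cont fun z hz => hf2 z hz.2.1
  · rcases hcase y hy with hy | rfl | hy
    · rw [hf1 y hy.2.2]
      exact hh.lab y hy
    · rwa [hf0]
    · rw [hf2 y hy.2.1]
      exact hg.lab y hy

end Glue

/-! ### Orders coded by trees -/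

section Realize

variable {L : Type*} {ρ : L → L → Prop} {D E : Set ℝ} {v w : ℝ → L}

/-- The labelled order `D ∩ (a, b)` is coded by the tree. -/
inductive Realizes (ρ : L → L → Prop) (D : Set ℝ) (v : ℝ → L) : Tree L → ℝ → ℝ → Prop
  | nil {a b : ℝ} (hab : a < b) (h : ∀ y, y ∉ D ∩ Ioo a b) : Realizes ρ D v .nil a b
  | node {x : ℝ} (hx : x ∈ D) (l r : ℕ → Tree L) (c d : ℕ → ℝ)
      (hc : StrictMono c) (hd : StrictAnti d)
      (hcx : Tendsto c atTop (𝓝 x)) (hdx : Tendsto d atTop (𝓝 x))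
      (hcD : ∀ n, c (n + 1) ∉ D) (hdD : ∀ n, d (n + 1) ∉ D)
      (hl : ∀ n, Realizes ρ D v (l n) (c n) (c (n + 1)))
      (hr : ∀ n, Realizes ρ D v (r n) (d (n + 1)) (d n))
      (hlu : ∀ n m, ∃ k, m ≤ k ∧ Tree.Le ρ (l n) (l k))
      (hru : ∀ n m, ∃ k, m ≤ k ∧ Tree.Le ρ (r n) (r k)) :
      Realizes ρ D v (.node (v x) l r) (c 0) (d 0)

theorem lt_of_strictMono_tendsto {c : ℕ → ℝ} {x : ℝ} (hc : StrictMono c)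
    (hcx : Tendsto c atTop (𝓝 x)) (n : ℕ) : c n < x :=
  (hc n.lt_succ_self).trans_le (hc.monotone.ge_of_tendsto hcx _)

theorem lt_of_strictAnti_tendsto {d : ℕ → ℝ} {x : ℝ} (hd : StrictAnti d)
    (hdx : Tendsto d atTop (𝓝 x)) (n : ℕ) : x < d n :=
  (hd.antitone.le_of_tendsto hdx _).trans_lt (hd n.lt_succ_self)

theorem Realizes.lt {t : Tree L} {a b : ℝ} (h : Realizes ρ D v t a b) : a < b := by
  cases h with
  | nil hab _ => exact hab
  | node _ _ _ c d hc hd hcx hdx =>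
    exact (lt_of_strictMono_tendsto hc hcx 0).trans (lt_of_strictAnti_tendsto hd hdx 0)

theorem exists_strictMono_of_forall_exists {p : ℕ → ℕ → Prop} (h : ∀ n m, ∃ k, m ≤ k ∧ p n k) :
    ∃ κ : ℕ → ℕ, StrictMono κ ∧ ∀ n, p n (κ n) :=
  extraction_forall_of_frequently fun n => frequently_atTop.2 (h n)

theorem Realizes.exists_isEmb (hρ : ∀ p q s, ρ p q → ρ q s → ρ p s) {s t : Tree L}
    (hst : Tree.Le ρ s t) {a b a' b' : ℝ} (hs : Realizes ρ D v s a b)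
    (ht : Realizes ρ E w t a' b') :
    ∃ h, IsEmb ρ v w (D ∩ Ioo a b) (E ∩ Ioo a' b') h := by
  induction t generalizing s a b a' b' with
  | nil =>
    cases hst
    cases hs with
    | nil _ h => exact ⟨id, .empty h⟩
  | node q' l' r' ihl ihr =>
    cases ht with
    | @node x' hx' _ _ c' d' hc' hd' hcx' hdx' hcD' hdD' hl' hr' hlu' hru' =>
    have hcx0 := lt_of_strictMono_tendsto hc' hcx'
    have hdx0 := lt_of_strictAnti_tendsto hd' hdx'
    cases hst with
    | nil =>
      cases hs with
      | nil _ h => exact ⟨id, .empty h⟩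
    | left _ _ _ k hk =>
      obtain ⟨h, hh⟩ := ihl k hk hs (hl' k)
      refine ⟨h, hh.mono_right (inter_subset_inter_right _ (Ioo_subset_Ioo ?_ ?_))⟩
      · exact hc'.monotone (Nat.zero_le k)
      · exact ((hcx0 _).trans (hdx0 _)).le
    | right _ _ _ k hk =>
      obtain ⟨h, hh⟩ := ihr k hk hs (hr' k)
      refine ⟨h, hh.mono_right (inter_subset_inter_right _ (Ioo_subset_Ioo ?_ ?_))⟩
      · exact ((hcx0 _).trans (hdx0 _)).le
      · exact hd'.antitone (Nat.zero_le k)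
    | @node _ _ l r _ _ hq φ ψ hφ hψ =>
      cases hs with
      | @node x hx _ _ c d hc hd hcx hdx hcD hdD hl hr hlu hru =>
      obtain ⟨κ, hκ, hκl⟩ := exists_strictMono_of_forall_exists
        (p := fun n k => Tree.Le ρ (l n) (l' k)) fun n m => by
          obtain ⟨k, hk, hle⟩ := hlu' (φ n) m
          exact ⟨k, hk, (hφ n).trans hρ hle⟩
      obtain ⟨μ, hμ, hμr⟩ := exists_strictMono_of_forall_exists
        (p := fun n k => Tree.Le ρ (r n) (r' k)) fun n m => by
          obtain ⟨k, hk, hle⟩ := hru' (ψ n) m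
          exact ⟨k, hk, (hψ n).trans hρ hle⟩
      obtain ⟨h, hh, hlow⟩ := exists_isEmb_left (D := D) (E := E) hc hcx hcD hc' hcx' hκ
        fun n => ihl (κ n) (hκl n) (hl n) (hl' (κ n))
      obtain ⟨g, hg, hupp⟩ := exists_isEmb_right (D := D) (E := E) hd hdx hdD hd' hdx' hμ
        fun n => ihr (μ n) (hμr n) (hr n) (hr' (μ n))
      exact exists_isEmb_center hcx' hdx' (lt_of_strictMono_tendsto hc hcx)
        (lt_of_strictAnti_tendsto hd hdx) hcx0 hdx0 hx' hq hh hlow hg hupp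

/-- The labelled order `D ∩ (a, b)` is the sum of orders coded by the trees of the list. -/
inductive RealizesSum (ρ : L → L → Prop) (D : Set ℝ) (v : ℝ → L) :
    List (Tree L) → ℝ → ℝ → Prop
  | nil (a : ℝ) : RealizesSum ρ D v [] a a
  | cons {t : Tree L} {ts : List (Tree L)} {a m b : ℝ} (hm : m ∉ D)
      (ht : Realizes ρ D v t a m) (hts : RealizesSum ρ D v ts m b) :
      RealizesSum ρ D v (t :: ts) a b

theorem RealizesSum.le {ts : List (Tree L)} {a b : ℝ} (h : RealizesSum ρ D v ts a b) :
    a ≤ b := by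
  induction h with
  | nil => exact le_rfl
  | cons _ ht _ ih => exact ht.lt.le.trans ih

theorem RealizesSum.exists_isEmb (hρ : ∀ p q s, ρ p q → ρ q s → ρ p s)
    {s t : List (Tree L)} (hst : List.SublistForall₂ (Tree.Le ρ) s t) {a b a' b' : ℝ}
    (hs : RealizesSum ρ D v s a b) (ht : RealizesSum ρ E w t a' b') :
    ∃ h, IsEmb ρ v w (D ∩ Ioo a b) (E ∩ Ioo a' b') h := by
  induction hst generalizing a b a' b' with
  | nil =>
    cases hs
    exact ⟨id, .empty (by simp)⟩
  | cons hle _ ih =>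
    cases hs with
    | cons hm hs hss =>
    cases ht with
    | cons hm' ht hts =>
    obtain ⟨h, hh⟩ := hs.exists_isEmb hρ hle ht
    obtain ⟨g, hg⟩ := ih hss hts
    exact isEmb_glue hm hh hg ht.lt.le hts.le
  | cons_right _ ih =>
    cases ht with
    | cons hm' ht hts =>
    obtain ⟨h, hh⟩ := ih hs hts
    exact ⟨h, hh.mono_right (inter_subset_inter_right _ (Ioo_subset_Ioo_left ht.lt.le))⟩

end Realize

/-! ### Every bounded piece of a countable closed set is coded by finitely many trees -/

section Sequences

variable {α T : Type*} {R : α → α → Prop}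

theorem exists_path_of_transGen {a b : α} (h : Relation.TransGen R a b) :
    ∃ (k : ℕ) (p : ℕ → α), 0 < k ∧ p 0 = a ∧ p k = b ∧ ∀ i < k, R (p i) (p (i + 1)) := by
  induction h with
  | @single b h =>
    refine ⟨1, fun i => if i = 0 then a else b, one_pos, rfl, rfl, fun i hi => ?_⟩
    obtain rfl : i = 0 := by omega
    exact h
  | @tail b c _ h ih =>
    obtain ⟨k, p, hk, h0, hpk, hp⟩ := ih
    refine ⟨k + 1, fun i => if i ≤ k then p i else c, by omega, by simp [h0], by simp,
      fun i hi => ?_⟩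
    rcases (Nat.lt_succ_iff.1 hi).lt_or_eq with h' | rfl
    · simpa [h'.le, Nat.succ_le_of_lt h'] using hp i h'
    · simpa [hpk] using h

theorem exists_path_seq {c : ℕ → α} (h : ∀ n, Relation.TransGen R (c n) (c (n + 1))) :
    ∃ (e : ℕ → α) (φ : ℕ → ℕ), StrictMono φ ∧ (∀ k, R (e k) (e (k + 1))) ∧
      ∀ n, e (φ n) = c n := by
  choose len p hlen hp0 hp1 hp using fun n => exists_path_of_transGen (h n)
  let next : ℕ × ℕ → ℕ × ℕ := fun x => if x.2 + 1 < len x.1 then (x.1, x.2 + 1) else (x.1 + 1, 0)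
  let s : ℕ → ℕ × ℕ := fun k => Nat.rec (0, 0) (fun _ x => next x) k
  have hs : ∀ k, s (k + 1) = next (s k) := fun _ => rfl
  have hinv : ∀ k, (s k).2 < len (s k).1 := by
    intro k
    induction k with
    | zero => exact hlen 0
    | succ k ih =>
      rw [hs]
      by_cases hk : (s k).2 + 1 < len (s k).1
      · simpa only [next, if_pos hk] using hk
      · simpa only [next, if_neg hk] using hlen _
  let φ : ℕ → ℕ := fun n => Nat.rec 0 (fun n m => m + len n) n
  have hφ : ∀ n, φ (n + 1) = φ n + len n := fun _ => rfl
  have hsφ : ∀ n, s (φ n) = (n, 0) := by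
    intro n
    induction n with
    | zero => rfl
    | succ n ih =>
      have hin : ∀ i < len n, s (φ n + i) = (n, i) := by
        intro i hi
        induction i with
        | zero => exact ih
        | succ i ihi => rw [← Nat.add_assoc, hs, ihi (by omega)]; simp [next, hi]
      have hl := hlen n
      obtain ⟨m, hm⟩ : ∃ m, len n = m + 1 := ⟨len n - 1, by omega⟩
      rw [hφ, hm, ← Nat.add_assoc, hs, hin m (by omega)]
      simp [next, hm]
  refine ⟨fun k => p (s k).1 (s k).2, φ, strictMono_nat_of_lt_succ fun n => ?_, fun k => ?_,
    fun n => ?_⟩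
  · have := hlen n
    rw [hφ]
    omega
  · have h1 := hp _ _ (hinv k)
    change R (p (s k).1 (s k).2) (p (next (s k)).1 (next (s k)).2)
    by_cases hk : (s k).2 + 1 < len (s k).1
    · simpa only [next, if_pos hk] using h1
    · have h2 : (s k).2 + 1 = len (s k).1 := by
        have := hinv k
        omega
      rw [h2, hp1] at h1
      simpa only [next, if_neg hk, hp0] using h1
  · simp only [hsφ, hp0]

theorem exists_tail_unbounded {le : T → T → Prop}
    (hwqo : ∀ t : ℕ → T, ∃ i j, i < j ∧ le (t i) (t j)) (t : ℕ → T) :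
    ∃ N, ∀ n, N ≤ n → ∀ m, ∃ k, m ≤ k ∧ le (t n) (t k) := by
  by_contra hcon
  push Not at hcon
  choose g hg m hm using hcon
  let a : ℕ → ℕ := fun i => Nat.rec 0 (fun _ y => max y (m y)) i
  have ha : ∀ i, a (i + 1) = max (a i) (m (a i)) := fun _ => rfl
  have hmono : Monotone a := monotone_nat_of_le_succ fun i => by
    rw [ha]
    exact le_max_left _ _
  obtain ⟨i, j, hij, hle⟩ := hwqo fun i => t (g (a i))
  refine hm (a i) (g (a j)) (le_trans ?_ (hg _)) hle
  exact le_trans (le_trans (le_max_right _ _) (ha i).ge) (hmono hij)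

theorem exists_unbounded_seq {Rz : T → α → α → Prop} {le : T → T → Prop}
    (hwqo : ∀ t : ℕ → T, ∃ i j, i < j ∧ le (t i) (t j)) {c : ℕ → α}
    (h : ∀ n, Relation.TransGen (fun a b => ∃ t, Rz t a b) (c n) (c (n + 1))) :
    ∃ (e : ℕ → α) (φ : ℕ → ℕ) (N : ℕ) (l : ℕ → T), StrictMono φ ∧
      (∀ k, Rz (l k) (e k) (e (k + 1))) ∧ (∀ n m, ∃ k, m ≤ k ∧ le (l n) (l k)) ∧
      ∀ n, e (φ n) = c (n + N) := by
  obtain ⟨e, φ, hφ, he, hec⟩ := exists_path_seq h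
  choose l hl using he
  obtain ⟨N, hN⟩ := exists_tail_unbounded hwqo l
  have hle : ∀ n, N ≤ φ (n + N) := fun n => (Nat.le_add_left N n).trans (hφ.id_le _)
  refine ⟨fun k => e (k + N), fun n => φ (n + N) - N, N, fun k => l (k + N), ?_, fun k => ?_,
    fun n m => ?_, fun n => ?_⟩
  · intro a b hab
    have := hφ (Nat.add_lt_add_right hab N)
    have := hle a
    simp only
    omega
  · have := hl (k + N)
    rwa [Nat.add_right_comm] at this
  · obtain ⟨k, hk, hle⟩ := hN (n + N) (by omega) (m + N)
    refine ⟨k - N, by omega, ?_⟩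
    simpa only [Nat.sub_add_cancel (show N ≤ k by omega)] using hle
  · simp only [Nat.sub_add_cancel (hle n), hec]

end Sequences

section Decompose

variable {L : Type*} {ρ : L → L → Prop} {D : Set ℝ} {v : ℝ → L}

/-- `D ∩ (a, b)` is coded by a single tree, and `a`, `b` lie off `D`. -/
def Coded (ρ : L → L → Prop) (D : Set ℝ) (v : ℝ → L) (t : Tree L) (a b : ℝ) : Prop :=
  a ∉ D ∧ b ∉ D ∧ Realizes ρ D v t a b

/-- `D ∩ (a, b)` is a finite sum of pieces coded by trees. -/
def FinCoded (ρ : L → L → Prop) (D : Set ℝ) (v : ℝ → L) : ℝ → ℝ → Prop :=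
  Relation.ReflTransGen fun a b => ∃ t, Coded ρ D v t a b

/-- All the pieces of `D` with end points off `D` in `(u, w)` are finitely coded. -/
def FinCodedOn (ρ : L → L → Prop) (D : Set ℝ) (v : ℝ → L) (u w : ℝ) : Prop :=
  ∀ a b, a ∉ D → b ∉ D → u < a → a ≤ b → b < w → FinCoded ρ D v a b

/-- The point `x` has a neighbourhood in which `D` is finitely coded. -/
def LocCoded (ρ : L → L → Prop) (D : Set ℝ) (v : ℝ → L) (x : ℝ) : Prop :=
  ∃ u w, u < x ∧ x < w ∧ FinCodedOn ρ D v u w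

theorem FinCoded.exists_realizesSum {a b : ℝ} (h : FinCoded ρ D v a b) :
    ∃ ts, RealizesSum ρ D v ts a b := by
  induction h using Relation.ReflTransGen.head_induction_on with
  | refl => exact ⟨[], .nil b⟩
  | head h _ ih =>
    obtain ⟨t, _, hc, ht⟩ := h
    obtain ⟨ts, hts⟩ := ih
    exact ⟨t :: ts, .cons hc ht hts⟩

theorem FinCoded.transGen {a b : ℝ} (h : FinCoded ρ D v a b) (hab : a ≠ b) :
    Relation.TransGen (fun a b => ∃ t, Coded ρ D v t a b) a b := by
  rcases Relation.reflTransGen_iff_eq_or_transGen.1 h with h | h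
  · exact absurd h.symm hab
  · exact h

theorem locCoded_of_notMem (hD : IsClosed D) {x : ℝ} (hx : x ∉ D) : LocCoded ρ D v x := by
  obtain ⟨ε, hε, h⟩ := Metric.isOpen_iff.1 hD.isOpen_compl x hx
  refine ⟨x - ε, x + ε, by linarith, by linarith, fun a b ha hb hua hab hbw => ?_⟩
  rcases hab.eq_or_lt with rfl | hab
  · exact .refl
  · refine .single ⟨.nil, ha, hb, .nil hab fun y hy => ?_⟩
    refine h (?_ : y ∈ Metric.ball x ε) hy.1
    rw [Real.ball_eq_Ioo]
    exact ⟨hua.trans hy.2.1, hy.2.2.trans hbw⟩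

theorem isOpen_setOf_locCoded : IsOpen {x | LocCoded ρ D v x} := by
  rw [isOpen_iff_mem_nhds]
  rintro x ⟨u, w, hu, hw, h⟩
  filter_upwards [Ioo_mem_nhds hu hw] with y hy
  exact ⟨u, w, hy.1, hy.2, h⟩

theorem finCoded_of_forall_locCoded (hDc : D.Countable) {a b : ℝ} (ha : a ∉ D) (hb : b ∉ D)
    (hab : a ≤ b) (h : ∀ x ∈ Icc a b, LocCoded ρ D v x) : FinCoded ρ D v a b := by
  choose! u w hu hw huw using h
  obtain ⟨δ, hδ, hball⟩ := lebesgue_number_lemma_of_metric (isCompact_Icc (a := a) (b := b))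
    (c := fun x : Icc a b => Ioo (u x) (w x)) (fun _ => isOpen_Ioo) fun x hx =>
      mem_iUnion.2 ⟨⟨x, hx⟩, hu x hx, hw x hx⟩
  have hsmall : ∀ c d, c ∉ D → d ∉ D → a ≤ c → c ≤ d → d ≤ b → d < c + δ →
      FinCoded ρ D v c d := by
    intro c d hc hd hac hcd hdb hlt
    obtain ⟨⟨x, hx⟩, hsub⟩ := hball c ⟨hac, hcd.trans hdb⟩
    rw [Real.ball_eq_Ioo] at hsub
    exact huw x hx c d hc hd (hsub ⟨by linarith, by linarith⟩).1 hcd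
      (hsub ⟨by linarith, hlt⟩).2
  have key : ∀ n : ℕ, ∀ c, c ∉ D → a ≤ c → c ≤ b → b - c ≤ n * (δ / 2) → FinCoded ρ D v c b := by
    intro n
    induction n with
    | zero =>
      intro c hc hac hcb hn
      exact hsmall c b hc hb hac hcb le_rfl (by norm_num at hn; linarith)
    | succ n ih =>
      intro c hc hac hcb hn
      by_cases hlt : b < c + δ
      · exact hsmall c b hc hb hac hcb le_rfl hlt
      · obtain ⟨m, hm, hcm, hmd⟩ := (hDc.dense_compl ℝ).exists_between
          (show c + δ / 2 < c + δ by linarith)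
        have h1 : FinCoded ρ D v m b := ih m hm (by linarith) (by linarith) (by
          push_cast at hn
          linarith)
        exact (hsmall c m hc hm hac (by linarith) (by linarith) hmd).trans h1
  obtain ⟨n, hn⟩ := exists_nat_ge ((b - a) / (δ / 2))
  exact key n a ha le_rfl hab ((div_le_iff₀ (by linarith)).1 hn)

theorem locCoded_of_punctured (hDc : D.Countable)
    (hwqo : ∀ t : ℕ → Tree L, ∃ i j, i < j ∧ Tree.Le ρ (t i) (t j)) {x u w : ℝ} (hx : x ∈ D)
    (hux : u < x) (hxw : x < w) (h : ∀ y ∈ Ioo u w, y ≠ x → LocCoded ρ D v y) :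
    LocCoded ρ D v x := by
  have hdense := hDc.dense_compl ℝ
  have hside : ∀ a b, a ∉ D → b ∉ D → u < a → a ≤ b → b < w → b < x ∨ x < a →
      FinCoded ρ D v a b := by
    intro a b ha hb hua hab hbw hor
    refine finCoded_of_forall_locCoded hDc ha hb hab fun y hy =>
      h y ⟨hua.trans_le hy.1, hy.2.trans_lt hbw⟩ ?_
    rintro rfl
    rcases hor with hor | hor
    · exact absurd hy.2 (not_le.2 hor)
    · exact absurd hy.1 (not_le.2 hor)
  obtain ⟨c, hc, hcm, hcx⟩ := hdense.exists_seq_strictMono_tendsto_of_lt hux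
  obtain ⟨d, hd, hdm, hdx⟩ := hdense.exists_seq_strictAnti_tendsto_of_lt hxw
  obtain ⟨e, φ, N, l, hφ, hel, hlu, hec⟩ := exists_unbounded_seq (Rz := Coded ρ D v) (c := c) hwqo
    fun n => (hside _ _ (hcm n).2 (hcm _).2 (hcm n).1.1 (hc n.lt_succ_self).le
      ((hcm _).1.2.trans hxw) (Or.inl (hcm _).1.2)).transGen (hc n.lt_succ_self).ne
  obtain ⟨f, ψ, M, r, hψ, hfr, hru, hfd⟩ := exists_unbounded_seq
    (Rz := fun t a b => Coded ρ D v t b a) (c := d) hwqo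
    fun n => Relation.transGen_swap.2 <| (hside _ _ (hdm (n + 1)).2 (hdm n).2
      (hux.trans (hdm _).1.1) (hd n.lt_succ_self).le (hdm _).1.2
      (Or.inr (hdm _).1.1)).transGen (hd n.lt_succ_self).ne
  have he : StrictMono e := strictMono_nat_of_lt_succ fun n => (hel n).2.2.lt
  have hf : StrictAnti f := strictAnti_nat_of_succ_lt fun n => (hfr n).2.2.lt
  have hex : Tendsto e atTop (𝓝 x) := by
    refine (tendsto_iff_tendsto_subseq_of_monotone he.monotone hφ.tendsto_atTop).2 ?_
    exact ((tendsto_add_atTop_iff_nat N).2 hcx).congr fun n => (hec n).symm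
  have hfx : Tendsto f atTop (𝓝 x) := by
    refine (tendsto_iff_tendsto_subseq_of_antitone hf.antitone hψ.tendsto_atTop).2 ?_
    exact ((tendsto_add_atTop_iff_nat M).2 hdx).congr fun n => (hfd n).symm
  refine ⟨u, w, hux, hxw, fun a b ha hb hua hab hbw => ?_⟩
  rcases lt_trichotomy x a with hxa | rfl | hax
  · exact hside a b ha hb hua hab hbw (Or.inr hxa)
  · exact absurd hx ha
  rcases lt_trichotomy b x with hbx | rfl | hxb
  · exact hside a b ha hb hua hab hbw (Or.inl hbx)
  · exact absurd hx hb
  obtain ⟨k, hk⟩ := (hex.eventually (lt_mem_nhds hax)).exists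
  obtain ⟨j, hj⟩ := (hfx.eventually (gt_mem_nhds hxb)).exists
  have hek := lt_of_strictMono_tendsto he hex k
  have hfj := lt_of_strictAnti_tendsto hf hfx j
  have htail : ∀ {s : ℕ → Tree L} (k : ℕ), (∀ n m, ∃ i, m ≤ i ∧ Tree.Le ρ (s n) (s i)) →
      ∀ n m, ∃ i, m ≤ i ∧ Tree.Le ρ (s (k + n)) (s (k + i)) := by
    intro s k hs n m
    obtain ⟨i, hi, hle⟩ := hs (k + n) (k + m)
    refine ⟨i - k, by omega, ?_⟩
    rwa [show k + (i - k) = i by omega]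
  have hmid : Realizes ρ D v (.node (v x) (fun n => l (k + n)) fun n => r (j + n))
      (e (k + 0)) (f (j + 0)) :=
    .node hx (fun n => l (k + n)) (fun n => r (j + n)) (fun n => e (k + n)) (fun n => f (j + n))
      (fun a b hab => he (Nat.add_lt_add_left hab k))
      (fun a b hab => hf (Nat.add_lt_add_left hab j))
      (hex.comp (tendsto_atTop_mono (Nat.le_add_left · k) tendsto_id))
      (hfx.comp (tendsto_atTop_mono (Nat.le_add_left · j) tendsto_id))
      (fun n => (hel (k + (n + 1))).1) (fun n => (hfr (j + (n + 1))).2.1)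
      (fun n => (hel (k + n)).2.2) (fun n => (hfr (j + n)).2.2) (htail k hlu) (htail j hru)
  have h1 := hside a (e k) ha (hel k).1 hua hk.le (hek.trans hxw) (Or.inl hek)
  have h2 := hside (f j) b (hfr j).2.1 hb (hux.trans hfj) hj.le hbw (Or.inr hfj)
  exact (h1.tail ⟨_, (hel k).1, (hfr j).2.1, hmid⟩).trans h2

theorem locCoded (hD : IsClosed D) (hDc : D.Countable)
    (hwqo : ∀ t : ℕ → Tree L, ∃ i j, i < j ∧ Tree.Le ρ (t i) (t j)) (x : ℝ) :
    LocCoded ρ D v x := by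
  by_contra hx
  let P : Set ℝ := {x | ¬ LocCoded ρ D v x}
  have hPD : P ⊆ D := fun y hy => by_contra fun h => hy (locCoded_of_notMem hD h)
  have hperf : Perfect P := by
    refine ⟨isOpen_setOf_locCoded.isClosed_compl, preperfect_iff_nhds.2 fun y hy U hU => ?_⟩
    by_contra! hcon
    obtain ⟨u, w, hyuw, hsub⟩ := mem_nhds_iff_exists_Ioo_subset.1 hU
    exact hy (locCoded_of_punctured hDc hwqo (hPD hy) hyuw.1 hyuw.2 fun z hz hzy =>
      by_contra fun h => hzy (hcon z ⟨hsub hz, h⟩))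
  obtain ⟨f, hf, -, hinj⟩ := hperf.exists_nat_bool_injection ⟨x, hx⟩
  have : Countable (range f) := (hDc.mono (hf.trans hPD)).to_subtype
  have : Countable (ℕ → Bool) := (Equiv.ofInjective f hinj).injective.countable
  obtain ⟨g, hg⟩ := exists_injective_nat (ℕ → Bool)
  exact Function.cantor_injective _
    (hg.comp (Equiv.arrowCongr (Equiv.refl ℕ) Equiv.propEquivBool).injective)

theorem exists_realizesSum (hD : IsClosed D) (hDc : D.Countable)
    (hwqo : ∀ t : ℕ → Tree L, ∃ i j, i < j ∧ Tree.Le ρ (t i) (t j)) {a b : ℝ} (ha : a ∉ D)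
    (hb : b ∉ D) (hab : a ≤ b) : ∃ ts, RealizesSum ρ D v ts a b :=
  (finCoded_of_forall_locCoded hDc ha hb hab fun x _ =>
    locCoded hD hDc hwqo x).exists_realizesSum

end Decompose

/-! ### Embeddings between countable closed sets -/

theorem exists_isEmb_of_arrayBqo {L : Type*} {ρ : L → L → Prop} (hrefl : ∀ q, ρ q q)
    (htrans : ∀ p q s, ρ p q → ρ q s → ρ p s) (hρ : ArrayBqo ρ) {D : ℕ → Set ℝ} (v : ℕ → ℝ → L)
    (hD : ∀ n, IsClosed (D n)) (hDc : ∀ n, (D n).Countable) {a b : ℝ} (hab : a ≤ b)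
    (ha : ∀ n, a ∉ D n) (hb : ∀ n, b ∉ D n) :
    ∃ n m, n < m ∧ ∃ h, IsEmb ρ (v n) (v m) (D n ∩ Ioo a b) (D m ∩ Ioo a b) h := by
  have hwqo : ∀ t : ℕ → Tree L, ∃ i j, i < j ∧ Tree.Le ρ (t i) (t j) :=
    (Tree.arrayBqo_le hρ).exists_lt
  have : IsPreorder (Tree L) (Tree.Le ρ) :=
    { refl := Tree.Le.refl hrefl
      trans := fun _ _ _ => Tree.Le.trans htrans }
  choose ts hts using fun n =>
    exists_realizesSum (ρ := ρ) (v := v n) (hD n) (hDc n) hwqo (ha n) (hb n) hab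
  have hpwo : (univ : Set (Tree L)).PartiallyWellOrderedOn (Tree.Le ρ) :=
    fun t => hwqo fun n => (t n).1
  obtain ⟨n, m, hnm, hle⟩ := hpwo.partiallyWellOrderedOn_sublistForall₂ _
    fun n => ⟨ts n, fun _ _ => mem_univ _⟩
  exact ⟨n, m, hnm, RealizesSum.exists_isEmb htrans hle (hts n) (hts m)⟩

/-! ### Compactification -/

section Compactify

open Real

variable {Q : Type}

/-- The domain of a `Q`-cclo, moved into `(-π/2, π/2)` and closed off by both end points. -/
def compactDom (A : QCclo Q) : Set ℝ :=
  {y | y ∈ Ioo (-(π / 2)) (π / 2) ∧ tan y ∈ A.dom} ∪ {-(π / 2), π / 2}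

open Classical in
/-- The labels on `compactDom A`, with the new label `none` outside `(-π/2, π/2)`. -/
noncomputable def compactVal (A : QCclo Q) (y : ℝ) : Option Q :=
  if y ∈ Ioo (-(π / 2)) (π / 2) then some (A.val (tan y)) else none

theorem tan_continuousAt_of_mem_Ioo {y : ℝ} (hy : y ∈ Ioo (-(π / 2)) (π / 2)) :
    ContinuousAt tan y :=
  continuousOn_tan_Ioo.continuousAt (Ioo_mem_nhds hy.1 hy.2)

theorem arctan_mem_compactDom {A : QCclo Q} {x : ℝ} (hx : x ∈ A.dom) :
    arctan x ∈ compactDom A :=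
  Or.inl ⟨arctan_mem_Ioo x, by rwa [tan_arctan]⟩

theorem tan_mem_dom {A : QCclo Q} {y : ℝ} (hy : y ∈ compactDom A)
    (h : y ∈ Ioo (-(π / 2)) (π / 2)) : tan y ∈ A.dom := by
  rcases hy with hy | rfl | rfl
  · exact hy.2
  · exact absurd h.1 (lt_irrefl _)
  · exact absurd h.2 (lt_irrefl _)

theorem compactDom_subset (A : QCclo Q) : compactDom A ⊆ Icc (-(π / 2)) (π / 2) := by
  rintro y (hy | rfl | rfl)
  · exact Ioo_subset_Icc_self hy.1
  · exact left_mem_Icc.2 (by linarith [pi_pos])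
  · exact right_mem_Icc.2 (by linarith [pi_pos])

theorem compactDom_subset_Ioo (A : QCclo Q) : compactDom A ⊆ Ioo (-2) 2 :=
  (compactDom_subset A).trans fun y hy =>
    ⟨by linarith [hy.1, pi_lt_four], by linarith [hy.2, pi_lt_four]⟩

theorem compactDom_countable (A : QCclo Q) : (compactDom A).Countable := by
  refine Countable.union ((A.dom_countable.image arctan).mono ?_) (by simp)
  rintro y ⟨hy, hyA⟩
  exact ⟨tan y, hyA, arctan_tan hy.1 hy.2⟩

theorem compactDom_isClosed (A : QCclo Q) : IsClosed (compactDom A) := by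
  rw [← isOpen_compl_iff, isOpen_iff_mem_nhds]
  intro y hy
  by_cases hyI : y ∈ Icc (-(π / 2)) (π / 2)
  · have hne : y ≠ -(π / 2) ∧ y ≠ π / 2 :=
      ⟨fun h => hy (Or.inr (Or.inl h)), fun h => hy (Or.inr (Or.inr h))⟩
    have hyo : y ∈ Ioo (-(π / 2)) (π / 2) :=
      ⟨lt_of_le_of_ne hyI.1 hne.1.symm, lt_of_le_of_ne hyI.2 hne.2⟩
    have htan : tan y ∉ A.dom := fun h => hy (Or.inl ⟨hyo, h⟩)
    filter_upwards [Ioo_mem_nhds hyo.1 hyo.2,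
      (tan_continuousAt_of_mem_Ioo hyo).preimage_mem_nhds
        (A.dom_closed.isOpen_compl.mem_nhds htan)] with z hz hzA hzD
    exact hzA (tan_mem_dom hzD hz)
  · filter_upwards [isClosed_Icc.isOpen_compl.mem_nhds hyI] with z hz hzD
    exact hz (compactDom_subset A hzD)

variable [Preorder Q]

theorem emb_of_isEmb {A B : QCclo Q} {h : ℝ → ℝ}
    (hh : IsEmb (optLe (· ≤ ·)) (compactVal A) (compactVal B) (compactDom A ∩ Ioo (-2) 2)
      (compactDom B ∩ Ioo (-2) 2) h) : QCclo.Emb A B := by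
  have hmem : ∀ x ∈ A.dom, arctan x ∈ compactDom A ∩ Ioo (-2) 2 := fun x hx =>
    ⟨arctan_mem_compactDom hx, compactDom_subset_Ioo A (arctan_mem_compactDom hx)⟩
  have hlab : ∀ x ∈ A.dom, h (arctan x) ∈ Ioo (-(π / 2)) (π / 2) ∧
      A.val x ≤ B.val (tan (h (arctan x))) := by
    intro x hx
    have h1 := hh.lab _ (hmem x hx)
    rw [compactVal, if_pos (arctan_mem_Ioo x), tan_arctan, compactVal] at h1
    split_ifs at h1 with h2
    · exact ⟨h2, h1⟩
    · exact h1.elim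
  refine ⟨fun x => tan (h (arctan x)), ⟨fun x hx => ?_, fun x hx y hy hxy => ?_, ?_⟩,
    fun x hx => (hlab x hx).2⟩
  · exact tan_mem_dom (hh.maps _ (hmem x hx)).1 (hlab x hx).1
  · exact strictMonoOn_tan (hlab x hx).1 (hlab y hy).1
      (hh.mono (hmem x hx) (hmem y hy) (arctan_strictMono hxy))
  · exact continuousOn_tan_Ioo.comp (hh.cont.comp continuous_arctan.continuousOn hmem)
      fun x hx => (hlab x hx).1

end Compactify

end CcloBqo

/-- If `(Q, ≤)` is a bqo, then the class of all `Q`-cclos is a wqo under `⪯`: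
every infinite sequence of `Q`-cclos is good. -/
theorem stmt4 (Q : Type) [Preorder Q]
    (hQ : IsBqo (fun p q : Q => p ≤ q)) (K : ℕ → QCclo Q) :
    ∃ n m, n < m ∧ QCclo.Emb (K n) (K m) := by
  obtain ⟨n, m, hnm, h, hh⟩ := CcloBqo.exists_isEmb_of_arrayBqo
    (ρ := CcloBqo.optLe fun p q : Q => p ≤ q)
    (by rintro (_ | q) <;> simp [CcloBqo.optLe])
    (by
      rintro (_ | p) (_ | q) (_ | s) <;> simp only [CcloBqo.optLe] <;> try tauto
      exact le_trans)
    (CcloBqo.arrayBqo_of_isBqo hQ).option (fun n => CcloBqo.compactVal (K n))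
    (fun n => CcloBqo.compactDom_isClosed (K n)) (fun n => CcloBqo.compactDom_countable (K n))
    (a := -2) (b := 2) (by norm_num)
    (fun n hn => lt_irrefl _ (CcloBqo.compactDom_subset_Ioo (K n) hn).1)
    (fun n hn => lt_irrefl _ (CcloBqo.compactDom_subset_Ioo (K n) hn).2)
  exact ⟨n, m, hnm, CcloBqo.emb_of_isEmb hh⟩
end

section
/- Let (Q, ≤) be a quasi-order equipped with a rank function ρ into the ordinals (i.e. x ≤ y implies ρ(x) ≤ ρ(y)), and let F be the collection of all functions g : B → Q where B is a barrier of finite subsets of ℕ. If F contains some bad function, then F contains a bad function f that is minimal with respect to 'shorter', i.e. no bad function in F is shorter than f. -/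
open Set Filter Topology

/-- `c` (as a finite set) extends `b`: `b` is an initial segment of `c`. -/
def FinExtends (c b : Finset ℕ) : Prop := SExtends (c : Set ℕ) b

/-- `C` is an extended sub-barrier of `B`. -/
def ExtSubBarrier (C B : Set (Finset ℕ)) : Prop :=
  (⋃ c ∈ C, (c : Set ℕ)) ⊆ (⋃ b ∈ B, (b : Set ℕ)) ∧
  ∀ c ∈ C, ∃ b ∈ B, FinExtends c b

/-- `C` is a proper extended sub-barrier of `B`. -/
def ProperExtSubBarrier (C B : Set (Finset ℕ)) : Prop :=
  ExtSubBarrier C B ∧ ∃ c ∈ C, ∃ b ∈ B, FinExtends c b ∧ c ≠ b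

/-- `h : C → Q` is shorter than `g : B → Q` (w.r.t. the rank function `ρ`). -/
def Shorter {Q : Type} [Preorder Q] (ρ : Q → Ordinal)
    (C : Set (Finset ℕ)) (h : Finset ℕ → Q)
    (B : Set (Finset ℕ)) (g : Finset ℕ → Q) : Prop :=
  ProperExtSubBarrier C B ∧
  (∀ b ∈ B ∩ C, h b = g b) ∧
  ∀ c ∈ C, ∀ b ∈ B, FinExtends c b → c ≠ b → h c ≤ g b ∧ ρ (h c) < ρ (g b)

namespace SExtends

lemma iff_mem {d : Set ℕ} {b : Finset ℕ} :
    SExtends d b ↔ ∀ i, i ∈ b ↔ i ∈ d ∧ ∃ m ∈ b, i ≤ m := by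
  simp [SExtends, Set.ext_iff]

lemma subset {d : Set ℕ} {b : Finset ℕ} (h : SExtends d b) : (b : Set ℕ) ⊆ d :=
  fun i hi => ((iff_mem.1 h i).1 hi).1

lemma mem_of_le {d : Set ℕ} {b : Finset ℕ} (h : SExtends d b) {i m : ℕ} (hi : i ∈ d)
    (hm : m ∈ b) (him : i ≤ m) : i ∈ b :=
  (iff_mem.1 h i).2 ⟨hi, m, hm, him⟩

lemma of_initial {d : Set ℕ} {b : Finset ℕ} (hbd : (b : Set ℕ) ⊆ d)
    (h : ∀ i ∈ d, ∀ m ∈ b, i ≤ m → i ∈ b) : SExtends d b :=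
  iff_mem.2 fun i => ⟨fun hi => ⟨hbd hi, i, hi, le_rfl⟩, fun ⟨hi, m, hm, him⟩ => h i hi m hm him⟩

lemma trans {d : Set ℕ} {c b : Finset ℕ} (hc : SExtends d c) (hb : SExtends (c : Set ℕ) b) :
    SExtends d b :=
  of_initial (hb.subset.trans hc.subset) fun _ hi _ hm him =>
    hb.mem_of_le (hc.mem_of_le hi (hb.subset hm) him) hm him

lemma refl (b : Finset ℕ) : SExtends (b : Set ℕ) b :=
  of_initial subset_rfl fun _ hi _ _ _ => hi

lemma subset_total {d : Set ℕ} {b c : Finset ℕ} (hb : SExtends d b) (hc : SExtends d c) :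
    b ⊆ c ∨ c ⊆ b := by
  by_contra! hcon
  obtain ⟨x, hxb, hxc⟩ := Finset.not_subset.1 hcon.1
  obtain ⟨y, hyc, hyb⟩ := Finset.not_subset.1 hcon.2
  rcases le_total x y with hxy | hxy
  · exact hxc (hc.mem_of_le (hb.subset hxb) hyc hxy)
  · exact hyb (hb.mem_of_le (hc.subset hyc) hxb hxy)

/-- A finite set is extended by its union with any set of numbers above its maximum. -/
lemma union_above {b : Finset ℕ} {k : ℕ} (hk : IsGreatest (b : Set ℕ) k) (X : Set ℕ) :
    SExtends ((b : Set ℕ) ∪ {x ∈ X | k < x}) b := by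
  refine of_initial subset_union_left fun i hi m hm him => ?_
  rcases hi with hi | hi
  · exact hi
  · exact absurd (him.trans (hk.2 hm)) hi.2.not_ge

end SExtends

lemma exists_isGreatest_of_nonempty {b : Finset ℕ} (hb : b.Nonempty) :
    ∃ k, IsGreatest (b : Set ℕ) k :=
  ⟨b.max' hb, b.isGreatest_max' hb⟩

lemma infinite_sep_lt {X : Set ℕ} (hX : X.Infinite) (k : ℕ) : {x ∈ X | k < x}.Infinite := by
  refine (hX.sdiff (Set.finite_Iic k)).mono ?_
  rintro x ⟨hx, hxk⟩
  exact ⟨hx, not_le.1 hxk⟩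

/-- The union of a family of finite sets. -/
def barrierBase (B : Set (Finset ℕ)) : Set ℕ := ⋃ b ∈ B, (b : Set ℕ)

lemma mem_barrierBase {B : Set (Finset ℕ)} {x : ℕ} : x ∈ barrierBase B ↔ ∃ b ∈ B, x ∈ b := by
  simp [barrierBase]

lemma subset_barrierBase {B : Set (Finset ℕ)} {b : Finset ℕ} (hb : b ∈ B) :
    (b : Set ℕ) ⊆ barrierBase B :=
  fun _ hx => mem_barrierBase.2 ⟨b, hb, hx⟩

namespace IsBarrier

variable {B : Set (Finset ℕ)}

lemma eq_of_subset (hB : IsBarrier B) {b c : Finset ℕ} (hb : b ∈ B) (hc : c ∈ B) (h : b ⊆ c) :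
    b = c := by
  by_contra hne
  exact hB.2 b hb c hc hne h

lemma eq_of_sExtends (hB : IsBarrier B) {d : Set ℕ} {b c : Finset ℕ} (hb : b ∈ B) (hc : c ∈ B)
    (hdb : SExtends d b) (hdc : SExtends d c) : b = c := by
  rcases hdb.subset_total hdc with h | h
  · exact hB.eq_of_subset hb hc h
  · exact (hB.eq_of_subset hc hb h).symm

lemma nonempty_of_mem (hB : IsBarrier B) {b : Finset ℕ} (hb : b ∈ B) : b.Nonempty := by
  rw [Finset.nonempty_iff_ne_empty]
  rintro rfl
  refine hB.1.1 ((Set.finite_singleton ∅).subset fun c hc => ?_)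
  exact (hB.eq_of_subset hb hc (Finset.empty_subset c)).symm

lemma base_infinite (hB : IsBarrier B) : (barrierBase B).Infinite := by
  intro hfin
  refine hB.1.1 ((Finset.finite_toSet hfin.toFinset.powerset).subset fun b hb => ?_)
  simp only [Finset.mem_coe, Finset.mem_powerset]
  intro x hx
  simpa using subset_barrierBase hb hx

lemma exists_sExtends (hB : IsBarrier B) {Y : Set ℕ} (hY : Y.Infinite) (hYB : Y ⊆ barrierBase B) :
    ∃ b ∈ B, SExtends Y b :=
  hB.1.2 Y hY hYB

end IsBarrier

lemma infinite_of_forall_exists_sExtends {C : Set (Finset ℕ)} {X : Set ℕ} (hX : X.Infinite)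
    (hne : ∀ c ∈ C, c.Nonempty)
    (h : ∀ Y : Set ℕ, Y.Infinite → Y ⊆ X → ∃ c ∈ C, SExtends Y c) : C.Infinite := by
  intro hC
  have hfin : (barrierBase C).Finite := hC.biUnion fun c _ => c.finite_toSet
  obtain ⟨c, hc, hYc⟩ := h _ (hX.sdiff hfin) sdiff_subset
  obtain ⟨x, hx⟩ := hne c hc
  exact (hYc.subset hx).2 (subset_barrierBase hc hx)

namespace BarrierPrec

lemma mem_or_lt {b c : Finset ℕ} (h : BarrierPrec b c) {x : ℕ} (hx : x ∈ c) :
    x ∈ b ∨ ∀ y ∈ b, y < x := by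
  obtain ⟨m, k, i, -, hkm, hi, rfl, rfl⟩ := h
  obtain ⟨t, ht, rfl⟩ := Finset.mem_image.1 hx
  rw [Finset.mem_Icc] at ht
  by_cases htk : t ≤ k
  · exact Or.inl (Finset.mem_image_of_mem _ (Finset.mem_Icc.2 ⟨by omega, htk⟩))
  · refine Or.inr fun y hy => ?_
    obtain ⟨s, hs, rfl⟩ := Finset.mem_image.1 hy
    rw [Finset.mem_Icc] at hs
    exact hi ⟨hs.1, by omega⟩ ⟨by omega, ht.2⟩ (by omega)

lemma of_finExtends {b c a : Finset ℕ} (h : BarrierPrec b c) (hca : FinExtends c a)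
    (hab : ¬ a ⊆ b) : BarrierPrec b a := by
  obtain ⟨m, k, i, hk, hkm, hi, rfl, rfl⟩ := h
  obtain ⟨z, hz, hzb⟩ := Finset.not_subset.1 hab
  obtain ⟨l, hl⟩ := exists_isGreatest_of_nonempty ⟨z, hz⟩
  obtain ⟨j, hj, rfl⟩ := Finset.mem_image.1 (hca.subset hl.1)
  rw [Finset.mem_Icc] at hj
  have ha : a = (Finset.Icc 2 j).image i := by
    ext x
    constructor
    · intro hx
      obtain ⟨t, ht, rfl⟩ := Finset.mem_image.1 (hca.subset hx)
      rw [Finset.mem_Icc] at ht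
      refine Finset.mem_image_of_mem _ (Finset.mem_Icc.2 ⟨ht.1, ?_⟩)
      exact (hi.le_iff_le ⟨by omega, ht.2⟩ ⟨by omega, hj.2⟩).1 (hl.2 hx)
    · intro hx
      obtain ⟨t, ht, rfl⟩ := Finset.mem_image.1 hx
      rw [Finset.mem_Icc] at ht
      refine hca.mem_of_le (Finset.mem_image_of_mem _ (Finset.mem_Icc.2 ⟨ht.1, by omega⟩)) hl.1 ?_
      exact (hi.le_iff_le ⟨by omega, by omega⟩ ⟨by omega, hj.2⟩).2 ht.2
  refine ⟨j, k, i, hk, ?_, hi.mono (Set.Icc_subset_Icc_right hj.2), rfl, ha⟩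
  by_contra! hjk
  refine hab ?_
  rw [ha]
  exact Finset.image_subset_image (Finset.Icc_subset_Icc (by omega) hjk)

end BarrierPrec

/-- The reflexive counterpart of `Shorter`: no proper extension is required to occur. -/
def WeakShorter {Q : Type} [Preorder Q] (ρ : Q → Ordinal)
    (C : Set (Finset ℕ)) (h : Finset ℕ → Q) (B : Set (Finset ℕ)) (g : Finset ℕ → Q) : Prop :=
  ExtSubBarrier C B ∧ (∀ b ∈ B ∩ C, h b = g b) ∧
  ∀ c ∈ C, ∀ b ∈ B, FinExtends c b → c ≠ b → h c ≤ g b ∧ ρ (h c) < ρ (g b)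

section

variable {Q : Type} [Preorder Q] {ρ : Q → Ordinal} {B C D : Set (Finset ℕ)}
  {f g h : Finset ℕ → Q}

lemma Shorter.weak (H : Shorter ρ C h B g) : WeakShorter ρ C h B g := ⟨H.1.1, H.2⟩

namespace WeakShorter

lemma shorter (H : WeakShorter ρ C h B g)
    (hp : ∃ c ∈ C, ∃ b ∈ B, FinExtends c b ∧ c ≠ b) : Shorter ρ C h B g :=
  ⟨⟨H.1, hp⟩, H.2⟩

lemma base_subset (H : WeakShorter ρ C h B g) : barrierBase C ⊆ barrierBase B := H.1.1

lemma refl (hB : IsBarrier B) : WeakShorter ρ B g B g :=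
  ⟨⟨subset_rfl, fun b hb => ⟨b, hb, SExtends.refl b⟩⟩, fun _ _ => rfl, fun _ hc _ hb hcb hne =>
    absurd (hB.eq_of_subset hb hc hcb.subset).symm hne⟩

lemma eq_of_mem (H : WeakShorter ρ C h B g) {b : Finset ℕ} (hb : b ∈ B) (hc : b ∈ C) :
    h b = g b :=
  H.2.1 b ⟨hb, hc⟩

lemma trans (hB : IsBarrier B) (H : WeakShorter ρ D f C h) (K : WeakShorter ρ C h B g) :
    WeakShorter ρ D f B g := by
  have key : ∀ d ∈ D, ∃ c ∈ C, ∃ b ∈ B, FinExtends d c ∧ FinExtends c b := fun d hd => by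
    obtain ⟨c, hc, hdc⟩ := H.1.2 d hd
    obtain ⟨b, hb, hcb⟩ := K.1.2 c hc
    exact ⟨c, hc, b, hb, hdc, hcb⟩
  refine ⟨⟨H.1.1.trans K.1.1, fun d hd => ?_⟩, ?_, ?_⟩
  · obtain ⟨c, hc, b, hb, hdc, hcb⟩ := key d hd
    exact ⟨b, hb, hdc.trans hcb⟩
  · rintro d ⟨hdB, hd⟩
    obtain ⟨c, hc, b, hb, hdc, hcb⟩ := key d hd
    obtain rfl := hB.eq_of_subset hb hdB (hdc.trans hcb).subset
    obtain rfl : c = b := Finset.Subset.antisymm hdc.subset hcb.subset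
    rw [H.eq_of_mem hc hd, K.eq_of_mem hb hc]
  · intro d hd b hb hdb hne
    obtain ⟨c, hc, b', hb', hdc, hcb⟩ := key d hd
    obtain rfl := hB.eq_of_sExtends hb hb' hdb (hdc.trans hcb)
    by_cases hdc' : d = c
    · subst hdc'
      rw [H.eq_of_mem hc hd]
      exact K.2.2 d hc b hb hcb hne
    · have h₁ := H.2.2 d hd c hc hdc hdc'
      by_cases hcb' : c = b
      · subst hcb'
        rwa [← K.eq_of_mem hb hc]
      · have h₂ := K.2.2 c hc b hb hcb hcb'
        exact ⟨h₁.1.trans h₂.1, h₁.2.trans h₂.2⟩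

/-- An element that has been properly extended does not reappear in a weakly shorter barrier. -/
lemma notMem_of_proper (H : WeakShorter ρ D f C h) (hC : IsBarrier C) {b c : Finset ℕ}
    (hc : c ∈ C) (hcb : FinExtends c b) (hne : c ≠ b) : b ∉ D := by
  intro hb
  obtain ⟨a, ha, hba⟩ := H.1.2 b hb
  obtain rfl := hC.eq_of_subset ha hc (Finset.Subset.trans hba.subset hcb.subset)
  exact hne (Finset.Subset.antisymm hba.subset hcb.subset)

end WeakShorter

lemma shorter_of_proper (hB : IsBarrier B) (H : WeakShorter ρ D f C h)
    (K : WeakShorter ρ C h B g) {d c : Finset ℕ} (hd : d ∈ D) (hc : c ∈ C) (hdc : FinExtends d c)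
    (hne : d ≠ c) :
    Shorter ρ D f B g ∧ ∃ b ∈ B, FinExtends d b ∧ d ≠ b ∧ b ⊆ c := by
  obtain ⟨b, hb, hcb⟩ := K.1.2 c hc
  have hdb : d ≠ b := by
    rintro rfl
    exact hne (Finset.Subset.antisymm hcb.subset hdc.subset)
  exact ⟨(H.trans hB K).shorter ⟨d, hd, b, hb, hdc.trans hcb, hdb⟩,
    b, hb, hdc.trans hcb, hdb, hcb.subset⟩

/-- A shorter bad function all of whose proper extensions happen at or above `k` can be enlarged
so as to retain every element of the base up to `k`. -/
lemma exists_fill (hB : IsBarrier B) (hg : IsBadOn (· ≤ ·) B g)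
    (hC : IsBarrier C) (hh : IsBadOn (· ≤ ·) C h) (H : WeakShorter ρ C h B g) (k : ℕ)
    (hk : ∀ c ∈ C, ∀ b ∈ B, FinExtends c b → c ≠ b → ∃ m ∈ b, k ≤ m) :
    ∃ (C' : Set (Finset ℕ)) (h' : Finset ℕ → Q), IsBarrier C' ∧ IsBadOn (· ≤ ·) C' h' ∧
      WeakShorter ρ C' h' B g ∧ C ⊆ C' ∧
      ∀ x ∈ barrierBase B, x ≤ k → x ∈ barrierBase C' := by
  classical
  set Z : Set ℕ := {x ∈ barrierBase B | x ≤ k} ∪ barrierBase C with hZ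
  have hZB : Z ⊆ barrierBase B := union_subset (fun x hx => hx.1) H.base_subset
  have hCZ : barrierBase C ⊆ Z := subset_union_right
  have hZk : ∀ x ∈ Z, k < x → x ∈ barrierBase C := by
    rintro x (hx | hx) hkx
    · exact absurd hx.2 hkx.not_ge
    · exact hx
  set N : Set (Finset ℕ) := {b ∈ B | (b : Set ℕ) ⊆ Z ∧ ¬ (b : Set ℕ) ⊆ barrierBase C} with hN
  have hCN : ∀ c ∈ C, c ∉ N := fun c hc hcN => hcN.2.2 (subset_barrierBase hc)
  have hbase : barrierBase (C ∪ N) ⊆ Z := by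
    intro x hx
    obtain ⟨b, hb | hb, hxb⟩ := mem_barrierBase.1 hx
    · exact hCZ (subset_barrierBase hb hxb)
    · exact hb.2.1 hxb
  have hblock : ∀ Y : Set ℕ, Y.Infinite → Y ⊆ Z → ∃ c ∈ C ∪ N, SExtends Y c := by
    intro Y hY hYZ
    obtain ⟨b, hb, hYb⟩ := hB.exists_sExtends hY (hYZ.trans hZB)
    by_cases hbC : (b : Set ℕ) ⊆ barrierBase C
    swap
    · exact ⟨b, Or.inr ⟨hb, hYb.subset.trans hYZ, hbC⟩, hYb⟩
    by_cases hbC' : b ∈ C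
    · exact ⟨b, Or.inl hbC', hYb⟩
    obtain ⟨l, hl⟩ := exists_isGreatest_of_nonempty (hB.nonempty_of_mem hb)
    obtain ⟨c, hc, hWc⟩ := hC.exists_sExtends
      (Y := (b : Set ℕ) ∪ {x ∈ barrierBase C | l < x})
      ((infinite_sep_lt hC.base_infinite l).mono subset_union_right)
      (union_subset hbC fun x hx => hx.1)
    obtain ⟨b', hb', hcb⟩ := H.1.2 c hc
    obtain rfl := hB.eq_of_sExtends hb hb' (SExtends.union_above hl _) (hWc.trans hcb)
    obtain ⟨m, hm, hkm⟩ := hk c hc b hb hcb fun hcb' => hbC' (hcb' ▸ hc)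
    have hYC : Y ⊆ barrierBase C := by
      intro y hy
      by_cases hym : y ≤ m
      · exact hbC (hYb.mem_of_le hy hm hym)
      · exact hZk y (hYZ hy) (by omega)
    obtain ⟨e, he, hYe⟩ := hC.exists_sExtends hY hYC
    exact ⟨e, Or.inl he, hYe⟩
  refine ⟨C ∪ N, fun b => if b ∈ C then h b else g b, ⟨⟨hC.1.1.mono subset_union_left, ?_⟩, ?_⟩,
    ?_, ⟨⟨hbase.trans hZB, ?_⟩, ?_, ?_⟩, subset_union_left, ?_⟩
  · exact fun Y hY hYC => hblock Y hY (hYC.trans hbase)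
  · rintro b (hb | hb) c (hc | hc) hne hbc
    · exact hC.2 b hb c hc hne hbc
    · obtain ⟨a, ha, hba⟩ := H.1.2 b hb
      obtain rfl := hB.eq_of_subset ha hc.1 (Finset.Subset.trans hba.subset hbc)
      exact hc.2.2 (hba.subset.trans (subset_barrierBase hb))
    · exact hb.2.2 (subset_trans (Finset.coe_subset.2 hbc) (subset_barrierBase hc))
    · exact hB.2 b hb.1 c hc.1 hne hbc
  · rintro b (hb | hb) c (hc | hc) hbc
    · simpa only [hb, hc, if_true] using hh b hb c hc hbc
    · have hcC : c ∉ C := fun h' => hCN c h' hc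
      simp only [hb, hcC, if_true, if_false]
      obtain ⟨a, ha, hba⟩ := H.1.2 b hb
      by_cases hab : b = a
      · subst hab
        rw [H.eq_of_mem ha hb]
        exact hg b ha c hc.1 hbc
      · obtain ⟨m, hm, hkm⟩ := hk b hb a ha hba hab
        refine absurd (fun x hx => ?_) hc.2.2
        rcases hbc.mem_or_lt hx with hxb | hxb
        · exact subset_barrierBase hb hxb
        · exact hZk x (hc.2.1 hx) (hkm.trans_lt (hxb m (hba.subset hm)))
    · have hbC : b ∉ C := fun h' => hCN b h' hb
      simp only [hbC, hc, if_true, if_false]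
      obtain ⟨a, ha, hca⟩ := H.1.2 c hc
      have hle : h c ≤ g a := by
        by_cases hac : c = a
        · subst hac
          exact (H.eq_of_mem ha hc).le
        · exact (H.2.2 c hc a ha hca hac).1
      have hab : ¬ a ⊆ b := by
        intro hab
        obtain rfl := hB.eq_of_subset ha hb.1 hab
        exact hb.2.2 (hca.subset.trans (subset_barrierBase hc))
      exact fun hbc' => hg b hb.1 a ha (hbc.of_finExtends hca hab) (hbc'.trans hle)
    · have hbC : b ∉ C := fun h' => hCN b h' hb
      have hcC : c ∉ C := fun h' => hCN c h' hc
      simpa only [hbC, hcC, if_false] using hg b hb.1 c hc.1 hbc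
  · rintro c (hc | hc)
    · exact H.1.2 c hc
    · exact ⟨c, hc.1, SExtends.refl c⟩
  · rintro b ⟨hb, -⟩
    by_cases hbC : b ∈ C
    · simpa only [hbC, if_true] using H.eq_of_mem hb hbC
    · simp only [hbC, if_false]
  · rintro c (hc | hc) b hb hcb hne
    · simpa only [hc, if_true] using H.2.2 c hc b hb hcb hne
    · exact absurd (hB.eq_of_subset hb hc.1 hcb.subset).symm hne
  · intro x hx hxk
    have hxZ : x ∈ Z := Or.inl ⟨hx, hxk⟩
    obtain ⟨c, hc, hYc⟩ := hblock ({x} ∪ {y ∈ barrierBase C | x < y})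
      ((infinite_sep_lt hC.base_infinite x).mono subset_union_right)
      (union_subset (singleton_subset_iff.2 hxZ) fun y hy => hCZ hy.1)
    have hcne : c.Nonempty := by
      rcases hc with hc | hc
      · exact hC.nonempty_of_mem hc
      · exact hB.nonempty_of_mem hc.1
    obtain ⟨y, hy⟩ := hcne
    refine subset_barrierBase hc (hYc.mem_of_le (Or.inl rfl) hy ?_)
    rcases hYc.subset hy with rfl | hy'
    · exact le_rfl
    · exact hy'.2.le

/-- If no bad function is minimal, every bad function has a shorter bad function whose first
proper extension happens as early as possible and which keeps the base up to that place. -/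
lemma exists_shorter_earliest (hB : IsBarrier B) (hg : IsBadOn (· ≤ ·) B g)
    (hex : ∃ (C : Set (Finset ℕ)) (h : Finset ℕ → Q), IsBarrier C ∧ IsBadOn (· ≤ ·) C h ∧
      Shorter ρ C h B g) :
    ∃ (C : Set (Finset ℕ)) (h : Finset ℕ → Q) (k : ℕ), IsBarrier C ∧ IsBadOn (· ≤ ·) C h ∧
      WeakShorter ρ C h B g ∧
      (∃ c ∈ C, ∃ b ∈ B, FinExtends c b ∧ c ≠ b ∧ IsGreatest (b : Set ℕ) k) ∧
      (∀ x ∈ barrierBase B, x ≤ k → x ∈ barrierBase C) ∧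
      ∀ (D : Set (Finset ℕ)) (f : Finset ℕ → Q), IsBarrier D → IsBadOn (· ≤ ·) D f →
        Shorter ρ D f B g → ∀ d ∈ D, ∀ b ∈ B, FinExtends d b → d ≠ b → ∃ m ∈ b, k ≤ m := by
  classical
  have hk : ∃ k, ∃ (C : Set (Finset ℕ)) (h : Finset ℕ → Q), IsBarrier C ∧ IsBadOn (· ≤ ·) C h ∧
      Shorter ρ C h B g ∧
      ∃ c ∈ C, ∃ b ∈ B, FinExtends c b ∧ c ≠ b ∧ IsGreatest (b : Set ℕ) k := by
    obtain ⟨C, h, hC, hh, H⟩ := hex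
    obtain ⟨c, hc, b, hb, hcb, hne⟩ := H.1.2
    obtain ⟨k, hk⟩ := exists_isGreatest_of_nonempty (hB.nonempty_of_mem hb)
    exact ⟨k, C, h, hC, hh, H, c, hc, b, hb, hcb, hne, hk⟩
  have hmin : ∀ (D : Set (Finset ℕ)) (f : Finset ℕ → Q), IsBarrier D → IsBadOn (· ≤ ·) D f →
      Shorter ρ D f B g → ∀ d ∈ D, ∀ b ∈ B, FinExtends d b → d ≠ b →
      ∃ m ∈ b, Nat.find hk ≤ m := by
    intro D f hD hf K d hd b hb hdb hne
    obtain ⟨l, hl⟩ := exists_isGreatest_of_nonempty (hB.nonempty_of_mem hb)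
    exact ⟨l, hl.1, Nat.find_min' hk ⟨D, f, hD, hf, K, d, hd, b, hb, hdb, hne, hl⟩⟩
  obtain ⟨C, h, hC, hh, H, c, hc, b, hb, hcb⟩ := Nat.find_spec hk
  obtain ⟨C', h', hC', hh', H', hCC', hfill⟩ :=
    exists_fill hB hg hC hh H.weak (Nat.find hk) (hmin C h hC hh H)
  exact ⟨C', h', Nat.find hk, hC', hh', H', ⟨c, hCC' hc, b, hb, hcb⟩, hfill, hmin⟩

end

section

variable {Q : Type} [Preorder Q] {ρ : Q → Ordinal} {B : ℕ → Set (Finset ℕ)}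
  {f : ℕ → Finset ℕ → Q} {k : ℕ → ℕ}

lemma WeakShorter.of_le (hB : ∀ n, IsBarrier (B n))
    (hW : ∀ n, WeakShorter ρ (B (n + 1)) (f (n + 1)) (B n) (f n)) {m n : ℕ} (hmn : m ≤ n) :
    WeakShorter ρ (B n) (f n) (B m) (f m) := by
  induction n, hmn using Nat.le_induction with
  | base => exact WeakShorter.refl (hB m)
  | succ n _ ih => exact (hW n).trans (hB m) ih

lemma exists_lt_of_proper_extensions (hB : ∀ n, IsBarrier (B n))
    (hW : ∀ n, WeakShorter ρ (B (n + 1)) (f (n + 1)) (B n) (f n))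
    (hp : ∀ n, ∃ c ∈ B (n + 1), ∃ b ∈ B n, FinExtends c b ∧ c ≠ b ∧ IsGreatest (b : Set ℕ) (k n))
    (N : ℕ) : ∃ n, N < k n := by
  by_contra! hN
  choose c hc b hb hcb hne hbk using hp
  have hnot : ∀ m n, m < n → b m ≠ b n := by
    intro m n hmn heq
    exact (WeakShorter.of_le hB hW (Nat.succ_le_of_lt hmn)).notMem_of_proper (hB _) (hc m) (hcb m)
      (hne m) (heq ▸ hb n)
  have hinj : Function.Injective b := by
    intro m n heq
    rcases lt_trichotomy m n with h | h | h
    · exact absurd heq (hnot m n h)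
    · exact h
    · exact absurd heq.symm (hnot n m h)
  refine Set.infinite_range_of_injective hinj
    ((Finset.finite_toSet (Finset.range (N + 1)).powerset).subset ?_)
  rintro _ ⟨n, rfl⟩
  simp only [Finset.mem_coe, Finset.mem_powerset]
  intro x hx
  exact Finset.mem_range.2 (Nat.lt_succ_of_le (((hbk n).2 hx).trans (hN n)))

/-- The limit of a sequence of successively shorter bad functions whose proper extensions start
ever later is a bad function shorter than all of them. -/
lemma exists_shorter_limit (hB : ∀ n, IsBarrier (B n)) (hbad : ∀ n, IsBadOn (· ≤ ·) (B n) (f n))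
    (hW : ∀ n, WeakShorter ρ (B (n + 1)) (f (n + 1)) (B n) (f n))
    (hp : ∀ n, ∃ c ∈ B (n + 1), ∃ b ∈ B n, FinExtends c b ∧ c ≠ b ∧ IsGreatest (b : Set ℕ) (k n))
    (hfill : ∀ n, ∀ x ∈ barrierBase (B n), x ≤ k n → x ∈ barrierBase (B (n + 1)))
    (hk : Monotone k) :
    ∃ (C : Set (Finset ℕ)) (h : Finset ℕ → Q), IsBarrier C ∧ IsBadOn (· ≤ ·) C h ∧
      ∀ n, Shorter ρ C h (B n) (f n) := by
  have hle : ∀ {m n : ℕ}, m ≤ n → WeakShorter ρ (B n) (f n) (B m) (f m) :=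
    fun hmn => WeakShorter.of_le hB hW hmn
  set X : Set ℕ := ⋂ n, barrierBase (B n) with hX
  have hmemX : ∀ n, ∀ x ∈ barrierBase (B n), x ≤ k n → x ∈ X := by
    intro n x hx hxk
    have hup : ∀ m, n ≤ m → x ∈ barrierBase (B m) := by
      intro m hm
      induction m, hm using Nat.le_induction with
      | base => exact hx
      | succ m hm ih => exact hfill m x ih (hxk.trans (hk hm))
    refine mem_iInter.2 fun m => ?_
    rcases le_total n m with hnm | hnm
    · exact hup m hnm
    · exact (hle hnm).base_subset hx
  have hXinf : X.Infinite := by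
    refine Set.infinite_of_not_bddAbove ?_
    rintro ⟨N, hN⟩
    obtain ⟨n, hn⟩ := exists_lt_of_proper_extensions hB hW hp N
    obtain ⟨c, -, b, hb, -, -, hbk⟩ := hp n
    exact hn.not_ge (hN (hmemX n _ (subset_barrierBase hb hbk.1) le_rfl))
  set C : Set (Finset ℕ) := {b | ∃ n, ∀ m, n ≤ m → b ∈ B m} with hC
  have hval : ∀ b, ∃ q : Q, ∀ n, (∀ m, n ≤ m → b ∈ B m) → ∀ m, n ≤ m → f m b = q := by
    intro b
    by_cases hb : b ∈ C
    · obtain ⟨n, hn⟩ := hb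
      refine ⟨f n b, fun l hl m hm => ?_⟩
      rcases le_total n m with hnm | hnm
      · exact (hle hnm).eq_of_mem (hn n le_rfl) (hn m hnm)
      · exact ((hle hnm).eq_of_mem (hl m hm) (hn n le_rfl)).symm
    · exact ⟨f 0 b, fun n hn => absurd ⟨n, hn⟩ hb⟩
  choose h hh using hval
  have hev : ∀ b ∈ C, ∃ n, ∀ m, n ≤ m → b ∈ B m ∧ f m b = h b := by
    rintro b ⟨n, hn⟩
    exact ⟨n, fun m hm => ⟨hn m hm, hh b n hn m hm⟩⟩
  have hCX : barrierBase C ⊆ X := by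
    intro x hx
    obtain ⟨c, hc, hxc⟩ := mem_barrierBase.1 hx
    obtain ⟨n, hn⟩ := hc
    refine mem_iInter.2 fun m => ?_
    exact (hle (le_max_right n m)).base_subset
      (subset_barrierBase (hn _ (le_max_left n m)) hxc)
  have hblock : ∀ Y : Set ℕ, Y.Infinite → Y ⊆ X → ∃ c ∈ C, SExtends Y c := by
    intro Y hY hYX
    choose b hb hYb using fun n =>
      (hB n).exists_sExtends hY (hYX.trans (iInter_subset _ n))
    obtain ⟨n, hn⟩ : ∃ n, ∀ m, ρ (f n (b n)) ≤ ρ (f m (b m)) := by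
      obtain ⟨_, ⟨n, rfl⟩, hn⟩ := WellFounded.has_min (wellFounded_lt (α := Ordinal))
        (Set.range fun n => ρ (f n (b n))) (Set.range_nonempty _)
      exact ⟨n, fun m => not_lt.1 (hn _ ⟨m, rfl⟩)⟩
    refine ⟨b n, ⟨n, fun m hm => ?_⟩, hYb n⟩
    obtain ⟨a, ha, hba⟩ := (hle hm).1.2 (b m) (hb m)
    obtain rfl := (hB n).eq_of_sExtends ha (hb n) ((hYb m).trans hba) (hYb n)
    by_cases hne : b m = b n
    · exact hne ▸ hb m
    · exact absurd ((hle hm).2.2 _ (hb m) _ ha hba hne).2 (hn m).not_gt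
  have hne : ∀ c ∈ C, c.Nonempty := by
    rintro c ⟨n, hn⟩
    exact (hB n).nonempty_of_mem (hn n le_rfl)
  have hCbar : IsBarrier C := by
    refine ⟨⟨infinite_of_forall_exists_sExtends hXinf hne hblock,
      fun Y hY hYC => hblock Y hY (hYC.trans hCX)⟩, ?_⟩
    rintro b ⟨n, hn⟩ c ⟨m, hm⟩
    exact (hB (max n m)).2 b (hn _ (le_max_left n m)) c (hm _ (le_max_right n m))
  have hCW : ∀ n, WeakShorter ρ C h (B n) (f n) := by
    intro n
    have hstage : ∀ c ∈ C, ∃ m, n ≤ m ∧ c ∈ B m ∧ f m c = h c := by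
      intro c hc
      obtain ⟨m, hm⟩ := hev c hc
      exact ⟨max n m, le_max_left n m, hm _ (le_max_right n m)⟩
    refine ⟨⟨hCX.trans (iInter_subset _ n), fun c hc => ?_⟩, ?_, ?_⟩
    · obtain ⟨m, hnm, hcm, -⟩ := hstage c hc
      exact (hle hnm).1.2 c hcm
    · rintro b ⟨hb, hbC⟩
      obtain ⟨m, hnm, hcm, hval⟩ := hstage b hbC
      rw [← hval, (hle hnm).eq_of_mem hb hcm]
    · intro c hc b hb hcb hne'
      obtain ⟨m, hnm, hcm, hval⟩ := hstage c hc
      rw [← hval]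
      exact (hle hnm).2.2 c hcm b hb hcb hne'
  refine ⟨C, h, hCbar, ?_, fun n => (hCW n).shorter ?_⟩
  · intro b hb c hc hbc
    obtain ⟨n, hn⟩ := hev b hb
    obtain ⟨m, hm⟩ := hev c hc
    obtain ⟨hbm, hbv⟩ := hn _ (le_max_left n m)
    obtain ⟨hcm, hcv⟩ := hm _ (le_max_right n m)
    rw [← hbv, ← hcv]
    exact hbad _ b hbm c hcm hbc
  · obtain ⟨c, hc, b, hb, hcb, hne', hbk⟩ := hp n
    obtain ⟨d, hd, hYd⟩ := hblock ((b : Set ℕ) ∪ {x ∈ X | k n < x})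
      ((infinite_sep_lt hXinf _).mono subset_union_right)
      (union_subset (fun x hx => hmemX n x (subset_barrierBase hb hx) (hbk.2 hx)) fun x hx => hx.1)
    obtain ⟨a, ha, hda⟩ := (hCW n).1.2 d hd
    obtain rfl := (hB n).eq_of_sExtends ha hb (hYd.trans hda) (SExtends.union_above hbk _)
    refine ⟨d, hd, a, ha, hda, ?_⟩
    rintro rfl
    exact (hCW (n + 1)).notMem_of_proper (hB _) hc hcb hne' hd

end

/-- If the family of all barrier functions into `Q` contains a bad function, then it
contains a bad function minimal with respect to `shorter`. -/
theorem stmt5 (Q : Type) [Preorder Q] (ρ : Q → Ordinal)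
    (hρ : ∀ x y : Q, x ≤ y → ρ x ≤ ρ y)
    (hbad : ∃ (B : Set (Finset ℕ)) (g : Finset ℕ → Q),
      IsBarrier B ∧ IsBadOn (fun p q : Q => p ≤ q) B g) :
    ∃ (B : Set (Finset ℕ)) (g : Finset ℕ → Q),
      IsBarrier B ∧ IsBadOn (fun p q : Q => p ≤ q) B g ∧
      ∀ (C : Set (Finset ℕ)) (h : Finset ℕ → Q),
        IsBarrier C → IsBadOn (fun p q : Q => p ≤ q) C h → ¬ Shorter ρ C h B g := by
  by_contra hcon
  let S := {p : Set (Finset ℕ) × (Finset ℕ → Q) // IsBarrier p.1 ∧ IsBadOn (· ≤ ·) p.1 p.2}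
  have hex : ∀ s : S, ∃ (C : Set (Finset ℕ)) (h : Finset ℕ → Q), IsBarrier C ∧
      IsBadOn (· ≤ ·) C h ∧ Shorter ρ C h s.1.1 s.1.2 := by
    intro s
    by_contra hs
    exact hcon ⟨s.1.1, s.1.2, s.2.1, s.2.2, fun C h hC hh H => hs ⟨C, h, hC, hh, H⟩⟩
  choose C h k hC hh hW hp hfill hmin using
    fun s : S => exists_shorter_earliest s.2.1 s.2.2 (hex s)
  obtain ⟨B₀, g₀, hB₀, hg₀⟩ := hbad
  let next : S → S := fun s => ⟨(C s, h s), hC s, hh s⟩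
  let s : ℕ → S := fun n => next^[n] ⟨(B₀, g₀), hB₀, hg₀⟩
  have hs : ∀ n, s (n + 1) = next (s n) := fun n => Function.iterate_succ_apply' next n _
  have hB : ∀ n, IsBarrier (s n).1.1 := fun n => (s n).2.1
  have hWs : ∀ n, WeakShorter ρ (s (n + 1)).1.1 (s (n + 1)).1.2 (s n).1.1 (s n).1.2 := by
    intro n
    rw [hs]
    exact hW (s n)
  have hps : ∀ n, ∃ c ∈ (s (n + 1)).1.1, ∃ b ∈ (s n).1.1,
      FinExtends c b ∧ c ≠ b ∧ IsGreatest (b : Set ℕ) (k (s n)) := by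
    intro n
    rw [hs]
    exact hp (s n)
  have hks : Monotone fun n => k (s n) := by
    refine monotone_nat_of_le_succ fun n => ?_
    obtain ⟨d, hd, c, hc, hdc, hne, hck⟩ := hps (n + 1)
    obtain ⟨H, b, hb, hdb, hne', hbc⟩ :=
      shorter_of_proper (hB n) (hWs (n + 1)) (hWs n) hd hc hdc hne
    obtain ⟨m, hm, hkm⟩ := hmin (s n) _ _ (hB (n + 2)) (s (n + 2)).2.2 H d hd b hb hdb hne'
    exact hkm.trans (hck.2 (hbc hm))
  obtain ⟨D, f, hD, hf, hDs⟩ := exists_shorter_limit (ρ := ρ) (B := fun n => (s n).1.1)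
    (f := fun n => (s n).1.2) hB (fun n => (s n).2.2) hWs hps
    (fun n => by rw [hs]; exact hfill (s n)) hks
  obtain ⟨E, e, hE, he, H⟩ := hex ⟨(D, f), hD, hf⟩
  obtain ⟨d, hd, c, hc, hdc, hne⟩ := H.1.2
  obtain ⟨l, hl⟩ := exists_isGreatest_of_nonempty (hD.nonempty_of_mem hc)
  obtain ⟨n, hn⟩ := exists_lt_of_proper_extensions (f := fun n => (s n).1.2) hB hWs hps l
  obtain ⟨K, b, hb, hdb, hne', hbc⟩ :=
    shorter_of_proper (hB n) H.weak (hDs n).weak hd hc hdc hne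
  obtain ⟨m, hm, hkm⟩ := hmin (s n) E e hE he K d hd b hb hdb hne'
  exact hn.not_ge (hkm.trans (hl.2 (hbc hm)))
end

section
/- Let Q be a quasi-order and let L, K ∈ C' = C'_{ω₁} with C'-terms L = L₀+L₁+⋯+p+⋯+¹L+⁰L and K = K₀+K₁+⋯+q+⋯+¹K+⁰K. If p ≤_Q q, each L_i is ⪯-embeddable into some K_j, and each ⁱL is ⪯-embeddable into some ʲK, then L ⪯ K. -/
open Set Filter Topology

/-- `rk'(L)`: the least `α` with `L ∈ C'_{α+1}`. -/
noncomputable def rk' (Q : Type) [Preorder Q] (L : QCclo Q) : Ordinal.{0} :=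
  sInf {α : Ordinal.{0} | L ∈ CFam' Q (α + 1)}

/-- A `C'`-term for `L`: a decomposition of `L` as an unbounded ω-sum all of whose
summands lie in `C'` and have `rk'` strictly below `rk'(L)`. -/
def IsC'Term (Q : Type) [Preorder Q] (L : QCclo Q)
    (Ls Rs : ℕ → QCclo Q) (p : Q) (x : ℝ) : Prop :=
  IsOmegaSum L Ls Rs p x ∧
  (∀ n, ∃ k > n, QCclo.Emb (Ls n) (Ls k)) ∧
  (∀ n, ∃ k > n, QCclo.Emb (Rs n) (Rs k)) ∧
  (∀ n, Ls n ∈ CFam' Q ((Cardinal.aleph 1).ord : Ordinal.{0}) ∧ rk' Q (Ls n) < rk' Q L) ∧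
  (∀ n, Rs n ∈ CFam' Q ((Cardinal.aleph 1).ord : Ordinal.{0}) ∧ rk' Q (Rs n) < rk' Q L)

lemma QCclo.Emb.trans {Q : Type} [Preorder Q] {A B C : QCclo Q}
    (hAB : QCclo.Emb A B) (hBC : QCclo.Emb B C) : QCclo.Emb A C := by
  obtain ⟨f, ⟨fm, fs, fc⟩, fv⟩ := hAB
  obtain ⟨g, ⟨gm, gs, gc⟩, gv⟩ := hBC
  exact ⟨g ∘ f, ⟨fun a ha => gm _ (fm a ha),
    fun a ha b hb hab => gs _ (fm a ha) _ (fm b hb) (fs a ha b hb hab),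
    gc.comp fc fm⟩, fun a ha => (fv a ha).trans (gv _ (fm a ha))⟩

/-- In an unbounded sequence, whatever embeds into one term embeds into arbitrarily late ones. -/
lemma frequently_emb_of_unbounded {Q : Type} [Preorder Q] {A : QCclo Q} {K : ℕ → QCclo Q}
    (hK : ∀ n, ∃ k > n, QCclo.Emb (K n) (K k)) (hA : ∃ j, QCclo.Emb A (K j)) :
    ∃ᶠ k in atTop, QCclo.Emb A (K k) := by
  rw [frequently_atTop]
  intro N
  induction N with
  | zero => obtain ⟨j, hj⟩ := hA; exact ⟨j, Nat.zero_le _, hj⟩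
  | succ N ih =>
    obtain ⟨k, hk, hAk⟩ := ih
    obtain ⟨l, hl, hkl⟩ := hK k
    exact ⟨l, by omega, hAk.trans hkl⟩

/-- Consecutive nonempty sets converging to `x` from the left are separated by an increasing
sequence of cuts converging to `x`. -/
lemma exists_cuts {A : ℕ → Set ℝ} {x : ℝ} (hne : ∀ n, (A n).Nonempty)
    (hlt : ∀ n, DomLt (A n) (A (n + 1)))
    (hlim : ∀ a : ℕ → ℝ, (∀ n, a n ∈ A n) → Tendsto a atTop (𝓝 x)) :
    ∃ c : ℕ → ℝ, Tendsto c atTop (𝓝 x) ∧ (∀ n, c n < x) ∧ (∀ n, ∀ a ∈ A n, a < c n) ∧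
      ∀ n m, n < m → ∀ a ∈ A m, c n < a := by
  have hcut : ∀ n, ∃ c : ℝ, (∀ a ∈ A n, a < c) ∧ ∀ b ∈ A (n + 1), c < b := fun n => by
    rcases hlt n with h | h | h
    · exact absurd h (hne n).ne_empty
    · exact absurd h (hne (n + 1)).ne_empty
    · exact h
  choose c hc hc' using hcut
  choose a ha using hne
  have hmono : StrictMono c :=
    strictMono_nat_of_lt_succ fun n => (hc' n _ (ha _)).trans (hc _ _ (ha _))
  have hlima := hlim a ha
  have hlimc : Tendsto c atTop (𝓝 x) :=
    tendsto_of_tendsto_of_tendsto_of_le_of_le hlima ((tendsto_add_atTop_iff_nat 1).2 hlima)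
      (fun n => (hc n _ (ha n)).le) fun n => (hc' n _ (ha (n + 1))).le
  refine ⟨c, hlimc, fun n => (hmono n.lt_succ_self).trans_le
    (hmono.monotone.ge_of_tendsto hlimc _), hc, fun n m hnm b hb => ?_⟩
  obtain ⟨k, rfl⟩ := Nat.exists_eq_add_of_lt hnm
  exact (hmono.monotone (Nat.le_add_right n k)).trans_lt (hc' _ b hb)

/-- Embeddings of the terms of an increasing convergent sequence of sets into the terms of another
one glue to an embedding of the unions together with their limits. -/
lemma exists_smcEmbedding_left {A B : ℕ → Set ℝ} {x y : ℝ} {r : ℝ → ℝ → Prop}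
    (hA : (∀ n, A n = ∅) ∨ ∀ n, (A n).Nonempty)
    (hB : (∀ n, B n = ∅) ∨ ∀ n, (B n).Nonempty)
    (hAlt : ∀ n, DomLt (A n) (A (n + 1))) (hBlt : ∀ n, DomLt (B n) (B (n + 1)))
    (hAlim : ∀ a : ℕ → ℝ, (∀ n, a n ∈ A n) → Tendsto a atTop (𝓝 x))
    (hBlim : ∀ b : ℕ → ℝ, (∀ n, b n ∈ B n) → Tendsto b atTop (𝓝 y))
    (hemb : ∀ i, ∃ᶠ j in atTop, ∃ h, IsSmcEmbedding (A i) (B j) h ∧ ∀ a ∈ A i, r a (h a))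
    (hxy : r x y) :
    ∃ h, IsSmcEmbedding ((⋃ n, A n) ∪ {x}) ((⋃ n, B n) ∪ {y}) h ∧ h x = y ∧
      ∀ a ∈ (⋃ n, A n) ∪ {x}, r a (h a) := by
  classical
  rcases hA with hA | hA
  · exact ⟨fun _ => y, by simp [IsSmcEmbedding, hA], rfl, by simpa [hA] using hxy⟩
  obtain ⟨j, hj, hemb⟩ := extraction_forall_of_frequently hemb
  choose h hsmc hr using hemb
  have hB : ∀ n, (B n).Nonempty := hB.resolve_left fun hB => by
    obtain ⟨a, ha⟩ := hA 0
    simpa [hB] using (hsmc 0).1 a ha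
  obtain ⟨c, hclim, hcx, hc, hc'⟩ := exists_cuts hA hAlt hAlim
  obtain ⟨d, hdlim, hdy, hd, hd'⟩ := exists_cuts hB hBlt hBlim
  have hle : ∀ {n m a b}, a ∈ A n → b ∈ A m → a ≤ b → n ≤ m := fun {n m a b} ha hb hab =>
    not_lt.1 fun hmn => absurd hab (not_le.2 ((hc m b hb).trans (hc' m n hmn a ha)))
  let H : ℝ → ℝ := fun a => if ha : ∃ n, a ∈ A n then h ha.choose a else y
  have hH : ∀ {n a}, a ∈ A n → H a = h n a := fun {n a} ha => by
    have hex : ∃ n, a ∈ A n := ⟨n, ha⟩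
    have : hex.choose = n := le_antisymm (hle hex.choose_spec ha le_rfl)
      (hle ha hex.choose_spec le_rfl)
    simp only [H, dif_pos hex, this]
  have hAx : ∀ {n a}, a ∈ A n → a < x := fun {n a} ha => (hc n a ha).trans (hcx n)
  have hHx : H x = y := dif_neg fun ⟨n, hn⟩ => (hAx hn).false
  have hHB : ∀ {n a}, a ∈ A n → H a ∈ B (j n) := fun {n a} ha => hH ha ▸ (hsmc n).1 a ha
  have hHy : ∀ {n a}, a ∈ A n → H a < y := fun {n a} ha => (hd _ _ (hHB ha)).trans (hdy _)
  have hsplit : ∀ {a}, a ∈ (⋃ n, A n) ∪ {x} → (∃ n, a ∈ A n) ∨ a = x := fun {a} ha => by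
    simpa [or_comm] using ha
  refine ⟨H, ⟨fun a ha => ?_, fun a ha b hb hab => ?_, fun a ha => ?_⟩, hHx, fun a ha => ?_⟩
  · rcases hsplit ha with ⟨n, hn⟩ | rfl
    · exact Or.inl (mem_iUnion.2 ⟨_, hHB hn⟩)
    · exact Or.inr hHx
  · rcases hsplit ha with ⟨n, hn⟩ | rfl <;> rcases hsplit hb with ⟨m, hm⟩ | rfl
    · rcases (hle hn hm hab.le).eq_or_lt with rfl | hnm
      · rw [hH hn, hH hm]
        exact (hsmc n).2.1 a hn b hm hab
      · exact (hd _ _ (hHB hn)).trans (hd' _ _ (hj hnm) _ (hHB hm))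
    · rw [hHx]
      exact hHy hn
    · exact absurd hab (hAx hm).not_gt
    · exact absurd hab (lt_irrefl _)
  · rcases hsplit ha with ⟨n, hn⟩ | rfl
    · have hcont : ContinuousWithinAt H (A n) a :=
        ((hsmc n).2.2 a hn).congr (fun b hb => hH hb) (hH hn)
      refine hcont.mono_of_mem_nhdsWithin ?_
      have hright : ∀ᶠ z in 𝓝[(⋃ n, A n) ∪ {x}] a, z < c n :=
        nhdsWithin_le_nhds (Iio_mem_nhds (hc n a hn))
      have hleft : ∀ᶠ z in 𝓝[(⋃ n, A n) ∪ {x}] a, ∀ m, m < n → c m < z := by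
        refine nhdsWithin_le_nhds ?_
        exact (eventually_all_finite (finite_Iio n)).2
          fun m hm => Ioi_mem_nhds (hc' m n hm a hn)
      filter_upwards [hright, hleft, self_mem_nhdsWithin] with z hz hz' hzS
      rcases hsplit hzS with ⟨m, hm⟩ | rfl
      · rcases lt_trichotomy m n with hmn | rfl | hmn
        · exact absurd (hz' m hmn) (hc m z hm).not_gt
        · exact hm
        · exact absurd hz (hc' n m hmn z hm).not_gt
      · exact absurd hz (hcx n).not_gt
    · rw [ContinuousWithinAt, hHx, tendsto_order]
      constructor
      · intro b hb
        obtain ⟨N, hN⟩ := (hdlim.eventually (lt_mem_nhds hb)).exists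
        filter_upwards [nhdsWithin_le_nhds (Ioi_mem_nhds (hcx N)), self_mem_nhdsWithin]
          with z hz hzS
        rcases hsplit hzS with ⟨m, hm⟩ | rfl
        · have hNm : N < m := not_le.1 fun hmN => by
            rcases hmN.eq_or_lt with rfl | hmN
            · exact absurd hz (hc m z hm).not_gt
            · obtain ⟨w, hw⟩ := hA N
              exact absurd hz (((hc m z hm).trans (hc' m N hmN w hw)).trans (hc N w hw)).not_gt
          exact hN.trans (hd' N _ (hNm.trans_le (hj.id_le m)) _ (hHB hm))
        · rwa [hHx]
      · intro b hb
        filter_upwards [self_mem_nhdsWithin] with z hzS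
        rcases hsplit hzS with ⟨m, hm⟩ | rfl
        · exact (hHy hm).trans hb
        · rwa [hHx]
  · rcases hsplit ha with ⟨n, hn⟩ | rfl
    · rw [hH hn]
      exact hr n a hn
    · rwa [hHx]

lemma IsSmcEmbedding.neg {V W : Set ℝ} {h : ℝ → ℝ} (hh : IsSmcEmbedding V W h) :
    IsSmcEmbedding (-V) (-W) fun a => -h (-a) :=
  ⟨fun a ha => by simpa using hh.1 (-a) ha,
    fun a ha b hb hab => neg_lt_neg (hh.2.1 _ hb _ ha (neg_lt_neg hab)),
    (hh.2.2.comp continuous_neg.continuousOn fun _ ha => ha).neg⟩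

lemma DomLt.neg {A B : Set ℝ} (h : DomLt A B) : DomLt (-B) (-A) := by
  rcases h with rfl | rfl | ⟨c, hc, hc'⟩
  · exact Or.inr (Or.inl neg_empty)
  · exact Or.inl neg_empty
  · exact Or.inr (Or.inr ⟨-c, fun a ha => lt_neg_of_lt_neg (hc' _ ha),
      fun b hb => neg_lt_of_neg_lt (hc _ hb)⟩)

/-- Mirror image of `exists_smcEmbedding_left`. -/
lemma exists_smcEmbedding_right {A B : ℕ → Set ℝ} {x y : ℝ} {r : ℝ → ℝ → Prop}
    (hA : (∀ n, A n = ∅) ∨ ∀ n, (A n).Nonempty)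
    (hB : (∀ n, B n = ∅) ∨ ∀ n, (B n).Nonempty)
    (hAlt : ∀ n, DomLt (A (n + 1)) (A n)) (hBlt : ∀ n, DomLt (B (n + 1)) (B n))
    (hAlim : ∀ a : ℕ → ℝ, (∀ n, a n ∈ A n) → Tendsto a atTop (𝓝 x))
    (hBlim : ∀ b : ℕ → ℝ, (∀ n, b n ∈ B n) → Tendsto b atTop (𝓝 y))
    (hemb : ∀ i, ∃ᶠ j in atTop, ∃ h, IsSmcEmbedding (A i) (B j) h ∧ ∀ a ∈ A i, r a (h a))
    (hxy : r x y) :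
    ∃ h, IsSmcEmbedding ((⋃ n, A n) ∪ {x}) ((⋃ n, B n) ∪ {y}) h ∧ h x = y ∧
      ∀ a ∈ (⋃ n, A n) ∪ {x}, r a (h a) := by
  have hlim : ∀ {A : ℕ → Set ℝ} {x : ℝ},
      (∀ a : ℕ → ℝ, (∀ n, a n ∈ A n) → Tendsto a atTop (𝓝 x)) →
      ∀ a : ℕ → ℝ, (∀ n, a n ∈ -A n) → Tendsto a atTop (𝓝 (-x)) := fun hA a ha => by
    simpa using (hA (fun n => -a n) ha).neg
  obtain ⟨h, hh, hx, hr⟩ := exists_smcEmbedding_left (A := fun n => -A n) (B := fun n => -B n)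
    (x := -x) (y := -y) (r := fun a b => r (-a) (-b)) (by simpa using hA) (by simpa using hB)
    (fun n => (hAlt n).neg) (fun n => (hBlt n).neg) (hlim hAlim) (hlim hBlim)
    (fun i => (hemb i).mono fun j ⟨h, hh, hr⟩ =>
      ⟨_, hh.neg, fun a ha => by simpa using hr (-a) ha⟩) (by simpa using hxy)
  have hneg : ∀ (A : ℕ → Set ℝ) (x : ℝ), -((⋃ n, -A n) ∪ {-x}) = (⋃ n, A n) ∪ {x} := by
    intro A x
    ext a
    simp
  refine ⟨fun a => -h (-a), ?_, by simp [hx], fun a ha => ?_⟩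
  · simpa only [hneg] using hh.neg
  · rw [← hneg, Set.mem_neg] at ha
    simpa using hr (-a) ha

/-- Every point of the left part of an ω-sum lies to the left of its centre. -/
lemma lt_of_mem_of_domLt {A : ℕ → Set ℝ} {x : ℝ} (hA : (∀ n, A n = ∅) ∨ ∀ n, (A n).Nonempty)
    (hlt : ∀ n, DomLt (A n) (A (n + 1)))
    (hlim : ∀ a : ℕ → ℝ, (∀ n, a n ∈ A n) → Tendsto a atTop (𝓝 x)) :
    ∀ a ∈ ⋃ n, A n, a < x := by
  intro a ha
  obtain ⟨n, hn⟩ := mem_iUnion.1 ha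
  have hA := hA.resolve_left fun hA => by simp [hA] at hn
  obtain ⟨c, -, hcx, hc, -⟩ := exists_cuts hA hlt hlim
  exact (hc n a hn).trans (hcx n)

/-- Every point of the right part of an ω-sum lies to the right of its centre. -/
lemma gt_of_mem_of_domLt {A : ℕ → Set ℝ} {x : ℝ} (hA : (∀ n, A n = ∅) ∨ ∀ n, (A n).Nonempty)
    (hlt : ∀ n, DomLt (A (n + 1)) (A n))
    (hlim : ∀ a : ℕ → ℝ, (∀ n, a n ∈ A n) → Tendsto a atTop (𝓝 x)) :
    ∀ a ∈ ⋃ n, A n, x < a := by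
  intro a ha
  refine neg_lt_neg_iff.1 (lt_of_mem_of_domLt (A := fun n => -A n) (by simpa using hA)
    (fun n => (hlt n).neg) (fun b hb => ?_) (-a) (by simpa using ha))
  simpa using (hlim (fun n => -b n) hb).neg

/-- Two embeddings agreeing at a common endpoint glue. -/
lemma IsSmcEmbedding.glue {V₁ V₂ W₁ W₂ : Set ℝ} {x y : ℝ} {f g : ℝ → ℝ}
    (hf : IsSmcEmbedding (V₁ ∪ {x}) (W₁ ∪ {y}) f) (hg : IsSmcEmbedding (V₂ ∪ {x}) (W₂ ∪ {y}) g)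
    (hfx : f x = y) (hgx : g x = y) (hV₁ : ∀ a ∈ V₁, a < x) (hV₂ : ∀ a ∈ V₂, x < a)
    (hclosed : IsClosed (V₁ ∪ {x} ∪ V₂)) :
    ∃ h, IsSmcEmbedding (V₁ ∪ {x} ∪ V₂) (W₁ ∪ {y} ∪ W₂) h ∧
      (∀ a ∈ V₁ ∪ {x}, h a = f a) ∧ ∀ a ∈ V₂ ∪ {x}, h a = g a := by
  classical
  have hle : ∀ {a}, a ∈ V₁ ∪ {x} → a ≤ x := by
    rintro a (ha | rfl)
    exacts [(hV₁ a ha).le, le_rfl]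
  have hge : ∀ {a}, a ∈ V₂ ∪ {x} → x ≤ a := by
    rintro a (ha | rfl)
    exacts [(hV₂ a ha).le, le_rfl]
  let h : ℝ → ℝ := fun a => if a ≤ x then f a else g a
  have h₁ : ∀ a ∈ V₁ ∪ {x}, h a = f a := fun a ha => if_pos (hle ha)
  have h₂ : ∀ a ∈ V₂ ∪ {x}, h a = g a := fun a ha => by
    rcases (hge ha).eq_or_lt with rfl | hxa
    · rw [hgx, ← hfx]
      exact if_pos le_rfl
    · exact if_neg hxa.not_ge
  have hmem : ∀ a ∈ V₁ ∪ {x} ∪ V₂, a ∈ V₁ ∪ {x} ∨ a ∈ V₂ := fun a ha => ha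
  have hV : V₁ ∪ {x} ∪ V₂ = (V₁ ∪ {x}) ∪ (V₂ ∪ {x}) := by
    ext a
    simp only [mem_union, mem_singleton_iff]
    tauto
  have hyf : ∀ a ∈ V₁ ∪ {x}, f a ≤ y := fun a ha => by
    rcases (hle ha).eq_or_lt with rfl | hax
    · exact hfx.le
    · exact hfx ▸ (hf.2.1 a ha x (Or.inr rfl) hax).le
  refine ⟨h, ⟨fun a ha => ?_, fun a ha b hb hab => ?_, ?_⟩, h₁, h₂⟩
  · rcases hmem a ha with ha | ha
    · rw [h₁ a ha]
      exact Or.inl (hf.1 a ha)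
    · rw [h₂ a (Or.inl ha)]
      rcases hg.1 a (Or.inl ha) with hga | hga
      exacts [Or.inr hga, Or.inl (Or.inr hga)]
  · rcases hmem a ha with ha | ha <;> rcases hmem b hb with hb | hb
    · rw [h₁ a ha, h₁ b hb]
      exact hf.2.1 a ha b hb hab
    · rw [h₁ a ha, h₂ b (Or.inl hb)]
      exact (hyf a ha).trans_lt (hgx ▸ hg.2.1 x (Or.inr rfl) b (Or.inl hb) (hV₂ b hb))
    · exact absurd (hab.trans_le (hle hb)) (hV₂ a ha).not_gt
    · rw [h₂ a (Or.inl ha), h₂ b (Or.inl hb)]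
      exact hg.2.1 a (Or.inl ha) b (Or.inl hb) hab
  · have hcl₁ : IsClosed (V₁ ∪ {x}) := by
      convert hclosed.inter (isClosed_Iic (a := x)) using 1
      ext a
      constructor
      · exact fun ha => ⟨Or.inl ha, hle ha⟩
      · rintro ⟨ha | ha, hax⟩
        exacts [ha, absurd hax (hV₂ a ha).not_ge]
    have hcl₂ : IsClosed (V₂ ∪ {x}) := by
      convert hclosed.inter (isClosed_Ici (a := x)) using 1
      ext a
      constructor
      · exact fun ha => ⟨hV ▸ Or.inr ha, hge ha⟩
      · rintro ⟨(ha | ha) | ha, hax⟩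
        exacts [absurd hax (hV₁ a ha).not_ge, Or.inr ha, Or.inl ha]
    rw [hV]
    exact (hf.2.2.congr h₁).union_of_isClosed (hg.2.2.congr h₂) hcl₁ hcl₂

/-- If `L, K ∈ C'` have `C'`-terms with `p ≤ q`, every `L_i` embeddable into some `K_j`
and every `ⁱL` embeddable into some `ʲK`, then `L ⪯ K`. -/
theorem stmt6 (Q : Type) [Preorder Q] (L K : QCclo Q)
    (hL : L ∈ CFam' Q ((Cardinal.aleph 1).ord : Ordinal.{0}))
    (hK : K ∈ CFam' Q ((Cardinal.aleph 1).ord : Ordinal.{0}))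
    (Ls Rs Ks Js : ℕ → QCclo Q) (p q : Q) (x y : ℝ)
    (hLterm : IsC'Term Q L Ls Rs p x) (hKterm : IsC'Term Q K Ks Js q y)
    (hpq : p ≤ q)
    (hleft : ∀ i, ∃ j, QCclo.Emb (Ls i) (Ks j))
    (hright : ∀ i, ∃ j, QCclo.Emb (Rs i) (Js j)) :
    QCclo.Emb L K := by
  obtain ⟨⟨hLs, hRs, -, hLlt, -, hRlt, hLlim, hRlim, hLdom, hLval, hRval, hLx⟩, -⟩ := hLterm
  obtain ⟨⟨hKs, hJs, -, hKlt, -, hJlt, hKlim, hJlim, hKdom, hKval, hJval, hKy⟩,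
    hKub, hJub, -⟩ := hKterm
  have hxy : L.val x ≤ K.val y := by rwa [hLx, hKy]
  obtain ⟨f, hf, hfx, hfv⟩ := exists_smcEmbedding_left (A := fun n => (Ls n).dom)
    (B := fun n => (Ks n).dom) (r := fun a b => L.val a ≤ K.val b) hLs hKs hLlt hKlt hLlim hKlim
    (fun i => (frequently_emb_of_unbounded hKub (hleft i)).mono fun j ⟨h, hh, hv⟩ =>
      ⟨h, hh, fun a ha => by rw [hLval i a ha, hKval j _ (hh.1 a ha)]; exact hv a ha⟩) hxy
  obtain ⟨g, hg, hgx, hgv⟩ := exists_smcEmbedding_right (A := fun n => (Rs n).dom)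
    (B := fun n => (Js n).dom) (r := fun a b => L.val a ≤ K.val b) hRs hJs hRlt hJlt hRlim hJlim
    (fun i => (frequently_emb_of_unbounded hJub (hright i)).mono fun j ⟨h, hh, hv⟩ =>
      ⟨h, hh, fun a ha => by rw [hRval i a ha, hJval j _ (hh.1 a ha)]; exact hv a ha⟩) hxy
  obtain ⟨h, hh, hhf, hhg⟩ := hf.glue hg hfx hgx (lt_of_mem_of_domLt hLs hLlt hLlim)
    (gt_of_mem_of_domLt hRs hRlt hRlim) (hLdom ▸ L.dom_closed)
  refine ⟨h, by rwa [hLdom, hKdom], fun a ha => ?_⟩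
  rw [hLdom] at ha
  rcases ha with ha | ha
  · rw [hhf a ha]
    exact hfv a ha
  · rw [hhg a (Or.inl ha)]
    exact hgv a (Or.inl ha)
end

section
/- Let (Q, ≤) be a wqo with uncountably many ≡-equivalence classes. Then there exists an injective monotone map f : ω₁ → Q; indeed there is a map f from ω₁ to Q such that for all i < j < ω₁, f(i) ≤ f(j) but not f(j) ≤ f(i). -/
open Set Filter Topology

/-- In an uncountable wqo there is an uncountable set in which every element lies below
all but countably many members. -/
theorem exists_uncountable_forall_countable_not_le {P : Type*} [Preorder P]
    (hwqo : ∀ f : ℕ → P, ∃ n k, n < k ∧ f n ≤ f k) (hP : Uncountable P) :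
    ∃ A : Set P, ¬ A.Countable ∧ ∀ p ∈ A, {q ∈ A | ¬ p ≤ q}.Countable := by
  by_contra! h
  choose p hpA hp using h
  let S : ℕ → {A : Set P // ¬ A.Countable} := fun n =>
    Nat.rec ⟨Set.univ, fun h => not_countable (Set.countable_univ_iff.mp h)⟩
      (fun _ A => ⟨{q ∈ A.1 | ¬ p A.1 A.2 ≤ q}, hp A.1 A.2⟩) n
  have hS : ∀ n, (S (n + 1)).1 = {q ∈ (S n).1 | ¬ p (S n).1 (S n).2 ≤ q} := fun _ => rfl
  have hanti : Antitone fun n => (S n).1 :=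
    antitone_nat_of_succ_le fun n q hq => by
      rw [hS] at hq
      exact hq.1
  obtain ⟨n, k, hnk, hle⟩ := hwqo fun n => p (S n).1 (S n).2
  have hmem : p (S k).1 (S k).2 ∈ (S (n + 1)).1 := hanti hnk (hpA _ _)
  rw [hS] at hmem
  exact hmem.2 hle

/-- If every countable subset of `A` is strictly bounded by an element of `A`, then any
well-order with countable proper initial segments maps strictly monotonically into `A`. -/
theorem exists_strictMono_of_forall_countable_exists_lt {P I : Type*} [Preorder P]
    [LinearOrder I] [WellFoundedLT I] (hI : ∀ i : I, (Set.Iio i).Countable) {A : Set P}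
    (hA : ∀ C ⊆ A, C.Countable → ∃ a ∈ A, ∀ c ∈ C, c < a) :
    ∃ f : I → P, StrictMono f := by
  obtain ⟨a₀, ha₀, -⟩ := hA ∅ (Set.empty_subset A) Set.countable_empty
  have hex : ∀ C : Set P, ∃ a ∈ A, C ⊆ A → C.Countable → ∀ c ∈ C, c < a := fun C => by
    by_cases h : C ⊆ A ∧ C.Countable
    · obtain ⟨a, ha, hlt⟩ := hA C h.1 h.2
      exact ⟨a, ha, fun _ _ => hlt⟩
    · exact ⟨a₀, ha₀, fun h₁ h₂ => absurd ⟨h₁, h₂⟩ h⟩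
  choose b hbA hb using hex
  let f : I → P := (wellFounded_lt (α := I)).fix fun i ih =>
    b (Set.range fun j : Set.Iio i => ih j.1 j.2)
  have hf : ∀ i, f i = b (Set.range fun j : Set.Iio i => f j.1) := fun i =>
    WellFounded.fix_eq _ _ _
  refine ⟨f, fun i j hij => ?_⟩
  rw [hf j]
  have := (hI j).to_subtype
  refine hb _ ?_ (Set.countable_range _) _ ⟨⟨i, hij⟩, rfl⟩
  rintro _ ⟨k, rfl⟩
  exact Set.mem_of_eq_of_mem (hf k) (hbA _)

/-- Countable sets are strictly bounded in an uncountable set all of whose elements lie below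
all but countably many members. -/
theorem exists_forall_lt_of_countable {P : Type*} [PartialOrder P] {A : Set P}
    (hA : ¬ A.Countable) (hle : ∀ p ∈ A, {q ∈ A | ¬ p ≤ q}.Countable) {C : Set P}
    (hCA : C ⊆ A) (hC : C.Countable) : ∃ a ∈ A, ∀ c ∈ C, c < a := by
  have hU : (C ∪ ⋃ c ∈ C, {q ∈ A | ¬ c ≤ q}).Countable :=
    hC.union (hC.biUnion fun c hc => hle c (hCA hc))
  obtain ⟨a, ha, hau⟩ := Set.not_subset.mp fun h => hA (hU.mono h)
  refine ⟨a, ha, fun c hc => lt_of_le_of_ne ?_ ?_⟩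
  · by_contra hca
    exact hau (Or.inr (Set.mem_biUnion hc ⟨ha, hca⟩))
  · rintro rfl
    exact hau (Or.inl hc)

theorem Ordinal.countable_Iio_subtype_lt_ord_aleph_one
    (i : {o : Ordinal // o < (Cardinal.aleph 1).ord}) : (Set.Iio i).Countable := by
  have hcard : i.1.card ≤ Cardinal.aleph0 := by
    rw [← Order.lt_succ_iff, Cardinal.succ_aleph0]
    exact Cardinal.lt_ord.mp i.2
  have hIio : (Set.Iio i.1).Countable := by
    rw [← Cardinal.le_aleph0_iff_set_countable, Cardinal.mk_Iio_ordinal,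
      Cardinal.lift_le_aleph0]
    exact hcard
  exact hIio.preimage Subtype.val_injective

/-- A wqo with uncountably many `≡`-classes contains a strictly increasing
`ω₁`-chain. -/
theorem stmt7 (Q : Type) [Preorder Q]
    (hwqo : ∀ f : ℕ → Q, ∃ n k, n < k ∧ f n ≤ f k)
    (huncount : ¬ Countable (Antisymmetrization Q (· ≤ ·))) :
    ∃ f : {o : Ordinal // o < (Cardinal.aleph 1).ord} → Q,
      ∀ i j, i < j → f i ≤ f j ∧ ¬ f j ≤ f i := by
  obtain ⟨A, hA, hle⟩ := exists_uncountable_forall_countable_not_le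
    (P := Antisymmetrization Q (· ≤ ·))
    (fun f => by
      obtain ⟨n, k, hnk, h⟩ := hwqo fun n => ofAntisymmetrization (· ≤ ·) (f n)
      exact ⟨n, k, hnk, ofAntisymmetrization_le_ofAntisymmetrization_iff.mp h⟩)
    (not_countable_iff.mp huncount)
  obtain ⟨f, hf⟩ := exists_strictMono_of_forall_countable_exists_lt
    Ordinal.countable_Iio_subtype_lt_ord_aleph_one
    fun _ hCA hC => exists_forall_lt_of_countable hA hle hCA hC
  refine ⟨fun i => ofAntisymmetrization (· ≤ ·) (f i), fun i j hij => ?_⟩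
  exact lt_iff_le_not_ge.mp (ofAntisymmetrization_lt_ofAntisymmetrization_iff.mpr (hf hij))
end
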